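/- In the degenerate case σ = 0, ρ = 1 with y = x₁ − x₂ ≥ 0 and z = x₁ + x₂, λ = g + h, ν = g − h, the joint distribution of (X₁(t), X₂(t)) has density with respect to two-dimensional Lebesgue measure given by ℙ(X₁(t) ∈ dξ₁, X₂(t) ∈ dξ₂) = 2 e^{−2λ(ξ₁−ξ₂)} · (ξ₁ − 3ξ₂ + z + 2gt)/√(2πt³) · exp{ −(ξ₁ − 3ξ₂ + z + νt)²/(2t) } dξ₁ dξ₂ on the region {ξ₁ > ξ₂, ξ₂ < x₂ + gt}, and by the same formula with ξ₁ and ξ₂ interchanged on the region {ξ₁ < ξ₂, ξ₁ < x₂ + gt}; and it assigns to the ray {ξ₁ > ξ₂ = x₂ + gt} the one-dimensional density ℙ(X₁(t) ∈ dξ₁, X₂(t) = ξ₂) = (1/√(2πt)) [ exp{−(ξ₁ − x₁ + ht)²/(2t)} − e^{−2λ(ξ₁−ξ₂)} exp{−(ξ₁ − 2ξ₂ + x₁ − ht)²/(2t)} ] dξ₁. -/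

import Mathlib

open MeasureTheory ProbabilityTheory Filter Set

noncomputable section

namespace SDEPaper

/-- The signum convention of the paper: `psgn y = 1` for `y > 0`, `= -1` for `y ≤ 0`. -/
def psgn (y : ℝ) : ℝ := if 0 < y then 1 else -1

variable {Ω : Type*} [m : MeasurableSpace Ω]

/-- The σ-algebra generated by the process `Ξ` on the time interval `[0, t]`. -/
def natSA {E : Type*} [MeasurableSpace E] (Ξ : ℝ → Ω → E) (t : ℝ) : MeasurableSpace Ω :=
  ⨆ s ∈ Icc (0 : ℝ) t, MeasurableSpace.comap (Ξ s) inferInstance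

/-- The `μ`-augmentation of a σ-algebra. -/
def augSA (μ : Measure Ω) (m' : MeasurableSpace Ω) : MeasurableSpace Ω :=
  m' ⊔ MeasurableSpace.generateFrom {A : Set Ω | μ A = 0}

/-- `𝔉^Ξ(t)`: the `μ`-augmented σ-algebra generated by the process `Ξ` up to time `t`. -/
def natFilt {E : Type*} [MeasurableSpace E] (μ : Measure Ω) (Ξ : ℝ → Ω → E) (t : ℝ) :
    MeasurableSpace Ω := augSA μ (natSA Ξ t)

/-- Dyadic left-point Riemann sum of `H` against `X` on `[0,t]`. -/
def rsum (H X : ℝ → Ω → ℝ) (t : ℝ) (n : ℕ) (ω : Ω) : ℝ :=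
  ∑ i ∈ Finset.range (2 ^ n),
    H (t * i / 2 ^ n) ω * (X (t * (i + 1) / 2 ^ n) ω - X (t * i / 2 ^ n) ω)

/-- `I = ∫₀^· H dX`: dyadic Riemann sums converge in probability, and `I 0 = 0` a.s. -/
def IsSI (μ : Measure Ω) (H X I : ℝ → Ω → ℝ) : Prop :=
  (∀ᵐ ω ∂μ, I 0 ω = 0) ∧
  ∀ t : ℝ, 0 ≤ t → TendstoInMeasure μ (fun n => rsum H X t n) atTop (I t)

/-- `I = ∫₀^· H₁ dX₁ + ∫₀^· H₂ dX₂` in the sense of convergence in probability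
of dyadic Riemann sums. -/
def IsSI2 (μ : Measure Ω) (H₁ X₁ H₂ X₂ I : ℝ → Ω → ℝ) : Prop :=
  (∀ᵐ ω ∂μ, I 0 ω = 0) ∧
  ∀ t : ℝ, 0 ≤ t →
    TendstoInMeasure μ (fun n ω => rsum H₁ X₁ t n ω + rsum H₂ X₂ t n ω) atTop (I t)

/-- Dyadic sums of products of increments. -/
def qsum (X Y : ℝ → Ω → ℝ) (t : ℝ) (n : ℕ) (ω : Ω) : ℝ :=
  ∑ i ∈ Finset.range (2 ^ n),
    (X (t * (i + 1) / 2 ^ n) ω - X (t * i / 2 ^ n) ω) *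
      (Y (t * (i + 1) / 2 ^ n) ω - Y (t * i / 2 ^ n) ω)

/-- `C = ⟨X,Y⟩`: the quadratic covariation, as a limit in probability of dyadic sums. -/
def IsQV (μ : Measure Ω) (X Y C : ℝ → Ω → ℝ) : Prop :=
  ∀ t : ℝ, 0 ≤ t → TendstoInMeasure μ (fun n => qsum X Y t n) atTop (C t)

/-- `W` is a standard one-dimensional Brownian motion with respect to the family of
σ-algebras `F` (a filtration contained in the ambient σ-algebra). -/
structure IsBM (μ : Measure Ω) (F : ℝ → MeasurableSpace Ω) (W : ℝ → Ω → ℝ) : Prop where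
  le : ∀ t : ℝ, F t ≤ m
  mono : Monotone F
  adapted : ∀ t : ℝ, 0 ≤ t → MeasurableSpace.comap (W t) inferInstance ≤ F t
  init : ∀ᵐ ω ∂μ, W 0 ω = 0
  cont : ∀ᵐ ω ∂μ, Continuous fun t => W t ω
  law : ∀ s t : ℝ, 0 ≤ s → s ≤ t →
    μ.map (fun ω => W t ω - W s ω) = gaussianReal 0 ((t - s).toNNReal)
  indep : ∀ s t : ℝ, 0 ≤ s → s ≤ t →
    Indep (MeasurableSpace.comap (fun ω => W t ω - W s ω) inferInstance) (F s) μ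

/-- `(B₁, B₂)` is a planar Brownian motion: two independent standard Brownian motions
with respect to the common filtration `F`. -/
def IsPlanarBM (μ : Measure Ω) (F : ℝ → MeasurableSpace Ω) (B₁ B₂ : ℝ → Ω → ℝ) : Prop :=
  IsBM μ F B₁ ∧ IsBM μ F B₂ ∧
    IndepFun (fun ω => (fun t => B₁ t ω)) (fun ω => (fun t => B₂ t ω)) μ

/-- `L` is the (right) local time at the origin of the process `Y`:
`L t = lim_{ε ↓ 0} (4ε)⁻¹ ∫₀ᵗ 1{|Y(s)| < ε} ds`. -/
def IsLocalTime (μ : Measure Ω) (Y L : ℝ → Ω → ℝ) : Prop :=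
  ∀ᵐ ω ∂μ, ∀ t : ℝ, 0 ≤ t →
    Tendsto (fun ε : ℝ =>
        (4 * ε)⁻¹ * ∫ s in (0:ℝ)..t, (if |Y s ω| < ε then (1:ℝ) else 0))
      (nhdsWithin 0 (Ioi 0)) (nhds (L t ω))

/-- A continuous local martingale with respect to the filtration `F`. -/
def IsContLocMart (μ : Measure Ω) (F : Filtration ℝ m) (M : ℝ → Ω → ℝ) : Prop :=
  (∀ᵐ ω ∂μ, Continuous fun t => M t ω) ∧ StronglyAdapted F M ∧
    ∃ τ : ℕ → Ω → ℝ, (∀ n, IsStoppingTime F (fun ω => (τ n ω : WithTop ℝ))) ∧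
      (∀ᵐ ω ∂μ, Tendsto (fun n => τ n ω) atTop atTop) ∧
      ∀ n, Martingale (fun t ω => M (min t (τ n ω)) ω) F μ

/-- Orthogonality: the cross-variation `⟨M,N⟩` vanishes identically. -/
def Orthogonal (μ : Measure Ω) (M N : ℝ → Ω → ℝ) : Prop :=
  IsQV μ M N fun _ _ => 0

/-- Domination: `⟨M⟩(t) = ∫₀ᵗ q(s) d⟨N⟩(s)` for a progressively measurable
process `q` with values in `[0,c]`. -/
def Dominated (μ : Measure Ω) (F : Filtration ℝ m) (M N : ℝ → Ω → ℝ) (c : ℝ) : Prop :=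
  ∃ QM QN q : ℝ → Ω → ℝ, IsQV μ M M QM ∧ IsQV μ N N QN ∧
    ProgMeasurable F q ∧ (∀ t ω, q t ω ∈ Icc (0:ℝ) c) ∧
    ∀ᵐ ω ∂μ, ∃ ν : Measure ℝ,
      (∀ a b : ℝ, 0 ≤ a → a ≤ b → ν (Ioc a b) = ENNReal.ofReal (QN b ω - QN a ω)) ∧
      ∀ t : ℝ, 0 ≤ t → QM t ω = ∫ s in Ioc (0:ℝ) t, q s ω ∂ν

/-- The law of the two-dimensional process `(X₁, X₂)` on path space. -/
def pathLaw (μ : Measure Ω) (X₁ X₂ : ℝ → Ω → ℝ) : Measure (ℝ → ℝ × ℝ) :=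
  μ.map fun ω => (fun t => (X₁ t ω, X₂ t ω))
/-- `(X₁, X₂)` solves the system (1.1)-(1.2) driven by `(B₁, B₂)`. -/
def Solves11 (μ : Measure Ω) (F : ℝ → MeasurableSpace Ω) (g h ρ σ x₁ x₂ : ℝ)
    (B₁ B₂ X₁ X₂ : ℝ → Ω → ℝ) : Prop :=
  (∀ t : ℝ, 0 ≤ t →
    MeasurableSpace.comap (fun ω => (X₁ t ω, X₂ t ω)) inferInstance ≤ F t) ∧
  (∀ᵐ ω ∂μ, Continuous (fun t => X₁ t ω) ∧ Continuous (fun t => X₂ t ω)) ∧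
  ∃ I₁ I₂ : ℝ → Ω → ℝ,
    IsSI μ (fun s ω => if X₁ s ω ≤ X₂ s ω then σ else ρ) B₁ I₁ ∧
    IsSI μ (fun s ω => if X₁ s ω ≤ X₂ s ω then ρ else σ) B₂ I₂ ∧
    ∀ᵐ ω ∂μ, ∀ t : ℝ, 0 ≤ t →
      X₁ t ω = x₁ + (∫ s in (0:ℝ)..t, (if X₁ s ω ≤ X₂ s ω then g else -h)) + I₁ t ω ∧
      X₂ t ω = x₂ + (∫ s in (0:ℝ)..t, (if X₁ s ω ≤ X₂ s ω then -h else g)) + I₂ t ω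

/-- `(X₁, X₂)` solves the system (4.7)-(4.8), driven by the single Brownian motion `W`. -/
def Solves47 (μ : Measure Ω) (F : ℝ → MeasurableSpace Ω) (g h x₁ x₂ : ℝ)
    (W X₁ X₂ : ℝ → Ω → ℝ) : Prop :=
  (∀ t : ℝ, 0 ≤ t →
    MeasurableSpace.comap (fun ω => (X₁ t ω, X₂ t ω)) inferInstance ≤ F t) ∧
  (∀ᵐ ω ∂μ, Continuous (fun t => X₁ t ω) ∧ Continuous (fun t => X₂ t ω)) ∧
  ∃ I₁ I₂ : ℝ → Ω → ℝ,
    IsSI μ (fun s ω => if X₁ s ω ≤ X₂ s ω then (0:ℝ) else 1) W I₁ ∧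
    IsSI μ (fun s ω => if X₁ s ω ≤ X₂ s ω then (-1:ℝ) else 0) W I₂ ∧
    ∀ᵐ ω ∂μ, ∀ t : ℝ, 0 ≤ t →
      X₁ t ω = x₁ + (∫ s in (0:ℝ)..t, (if X₁ s ω ≤ X₂ s ω then g else -h)) + I₁ t ω ∧
      X₂ t ω = x₂ + (∫ s in (0:ℝ)..t, (if X₁ s ω ≤ X₂ s ω then -h else g)) + I₂ t ω

/-- `(X₁, X₂)` solves the system (4.9)-(4.10), driven by the single Brownian motion `V`. -/
def Solves49 (μ : Measure Ω) (F : ℝ → MeasurableSpace Ω) (g h x₁ x₂ : ℝ)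
    (V X₁ X₂ : ℝ → Ω → ℝ) : Prop :=
  (∀ t : ℝ, 0 ≤ t →
    MeasurableSpace.comap (fun ω => (X₁ t ω, X₂ t ω)) inferInstance ≤ F t) ∧
  (∀ᵐ ω ∂μ, Continuous (fun t => X₁ t ω) ∧ Continuous (fun t => X₂ t ω)) ∧
  ∃ I₁ I₂ : ℝ → Ω → ℝ,
    IsSI μ (fun s ω => if X₁ s ω ≤ X₂ s ω then (0:ℝ) else 1) V I₁ ∧
    IsSI μ (fun s ω => if X₁ s ω ≤ X₂ s ω then (1:ℝ) else 0) V I₂ ∧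
    ∀ᵐ ω ∂μ, ∀ t : ℝ, 0 ≤ t →
      X₁ t ω = x₁ + (∫ s in (0:ℝ)..t, (if X₁ s ω ≤ X₂ s ω then g else -h)) + I₁ t ω ∧
      X₂ t ω = x₂ + (∫ s in (0:ℝ)..t, (if X₁ s ω ≤ X₂ s ω then -h else g)) + I₂ t ω

/-- `(X₁, X₂)` solves the system (2.12)-(2.13), driven by the planar BM `(W₁, W₂)`. -/
def Solves212 (μ : Measure Ω) (F : ℝ → MeasurableSpace Ω) (g h ρ σ x₁ x₂ : ℝ)
    (W₁ W₂ X₁ X₂ : ℝ → Ω → ℝ) : Prop :=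
  (∀ t : ℝ, 0 ≤ t →
    MeasurableSpace.comap (fun ω => (X₁ t ω, X₂ t ω)) inferInstance ≤ F t) ∧
  (∀ᵐ ω ∂μ, Continuous (fun t => X₁ t ω) ∧ Continuous (fun t => X₂ t ω)) ∧
  ∃ I₁ I₂ : ℝ → Ω → ℝ,
    IsSI2 μ (fun s ω => if X₁ s ω ≤ X₂ s ω then 0 else ρ) W₁
            (fun s ω => if X₁ s ω ≤ X₂ s ω then σ else 0) W₂ I₁ ∧
    IsSI2 μ (fun s ω => if X₁ s ω ≤ X₂ s ω then -ρ else 0) W₁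
            (fun s ω => if X₁ s ω ≤ X₂ s ω then 0 else -σ) W₂ I₂ ∧
    ∀ᵐ ω ∂μ, ∀ t : ℝ, 0 ≤ t →
      X₁ t ω = x₁ + (∫ s in (0:ℝ)..t, (if X₁ s ω ≤ X₂ s ω then g else -h)) + I₁ t ω ∧
      X₂ t ω = x₂ + (∫ s in (0:ℝ)..t, (if X₁ s ω ≤ X₂ s ω then -h else g)) + I₂ t ω

/-- `(X₁, X₂)` solves the system (2.14)-(2.15), driven by the planar BM `(V₁, V₂)`. -/
def Solves214 (μ : Measure Ω) (F : ℝ → MeasurableSpace Ω) (g h ρ σ x₁ x₂ : ℝ)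
    (V₁ V₂ X₁ X₂ : ℝ → Ω → ℝ) : Prop :=
  (∀ t : ℝ, 0 ≤ t →
    MeasurableSpace.comap (fun ω => (X₁ t ω, X₂ t ω)) inferInstance ≤ F t) ∧
  (∀ᵐ ω ∂μ, Continuous (fun t => X₁ t ω) ∧ Continuous (fun t => X₂ t ω)) ∧
  ∃ I₁ I₂ : ℝ → Ω → ℝ,
    IsSI2 μ (fun s ω => if X₁ s ω ≤ X₂ s ω then 0 else ρ) V₁
            (fun s ω => if X₁ s ω ≤ X₂ s ω then σ else 0) V₂ I₁ ∧
    IsSI2 μ (fun s ω => if X₁ s ω ≤ X₂ s ω then ρ else 0) V₁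
            (fun s ω => if X₁ s ω ≤ X₂ s ω then 0 else σ) V₂ I₂ ∧
    ∀ᵐ ω ∂μ, ∀ t : ℝ, 0 ≤ t →
      X₁ t ω = x₁ + (∫ s in (0:ℝ)..t, (if X₁ s ω ≤ X₂ s ω then g else -h)) + I₁ t ω ∧
      X₂ t ω = x₂ + (∫ s in (0:ℝ)..t, (if X₁ s ω ≤ X₂ s ω then -h else g)) + I₂ t ω

/-- `(X₁, X₂)` solves the system `dX = Σ(X) dU + G(X) dt` of (eq:xSigma), where
`Σ(x) = Σ₊ 1{x₁ > x₂} + Σ₋ 1{x₁ ≤ x₂}`. -/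
def SolvesGen (μ : Measure Ω) (F : ℝ → MeasurableSpace Ω) (g h : ℝ)
    (Sp Sm : Matrix (Fin 2) (Fin 2) ℝ) (x₁ x₂ : ℝ)
    (U₁ U₂ X₁ X₂ : ℝ → Ω → ℝ) : Prop :=
  (∀ t : ℝ, 0 ≤ t →
    MeasurableSpace.comap (fun ω => (X₁ t ω, X₂ t ω)) inferInstance ≤ F t) ∧
  (∀ᵐ ω ∂μ, Continuous (fun t => X₁ t ω) ∧ Continuous (fun t => X₂ t ω)) ∧
  ∃ I₁ I₂ : ℝ → Ω → ℝ,
    IsSI2 μ (fun s ω => if X₁ s ω ≤ X₂ s ω then Sm 0 0 else Sp 0 0) U₁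
            (fun s ω => if X₁ s ω ≤ X₂ s ω then Sm 0 1 else Sp 0 1) U₂ I₁ ∧
    IsSI2 μ (fun s ω => if X₁ s ω ≤ X₂ s ω then Sm 1 0 else Sp 1 0) U₁
            (fun s ω => if X₁ s ω ≤ X₂ s ω then Sm 1 1 else Sp 1 1) U₂ I₂ ∧
    ∀ᵐ ω ∂μ, ∀ t : ℝ, 0 ≤ t →
      X₁ t ω = x₁ + (∫ s in (0:ℝ)..t, (if X₁ s ω ≤ X₂ s ω then g else -h)) + I₁ t ω ∧
      X₂ t ω = x₂ + (∫ s in (0:ℝ)..t, (if X₁ s ω ≤ X₂ s ω then -h else g)) + I₂ t ω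


/-- The two-dimensional density (5.8)/(5.10) of the paper (degenerate case), on the
wedge `{ξ₁ > ξ₂, ξ₂ < x₂ + gt}`; on the opposite wedge the arguments are swapped. -/
def wedgeDensity (g h x₁ x₂ t ξ₁ ξ₂ : ℝ) : ℝ :=
  2 * Real.exp (-(2 * (g + h)) * (ξ₁ - ξ₂)) *
    ((ξ₁ - 3 * ξ₂ + (x₁ + x₂) + 2 * g * t) / Real.sqrt (2 * Real.pi * t ^ 3)) *
    Real.exp (-(ξ₁ - 3 * ξ₂ + (x₁ + x₂) + (g - h) * t) ^ 2 / (2 * t))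

/-- The full planar density of `(X₁(t), X₂(t))` in the degenerate case. -/
def planarDensity (g h x₁ x₂ t ξ₁ ξ₂ : ℝ) : ℝ :=
  if ξ₂ < ξ₁ ∧ ξ₂ < x₂ + g * t then wedgeDensity g h x₁ x₂ t ξ₁ ξ₂
  else if ξ₁ < ξ₂ ∧ ξ₁ < x₂ + g * t then wedgeDensity g h x₁ x₂ t ξ₂ ξ₁
  else 0

/-- The one-dimensional density (5.9) of the paper, on the ray
`{ξ₁ > ξ₂ = x₂ + gt}`. -/
def rayDensity (g h x₁ x₂ t ξ₁ : ℝ) : ℝ :=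
  (1 / Real.sqrt (2 * Real.pi * t)) *
    (Real.exp (-(ξ₁ - x₁ + h * t) ^ 2 / (2 * t)) -
      Real.exp (-(2 * (g + h)) * (ξ₁ - (x₂ + g * t))) *
        Real.exp (-(ξ₁ - 2 * (x₂ + g * t) + x₁ - h * t) ^ 2 / (2 * t)))

section Helpers

/-- `G` is centered Gaussian with variance `v`, independent of the sigma-algebra `F`. -/
structure CG {Ω : Type*} (F : MeasurableSpace Ω) [m : MeasurableSpace Ω] (μ : Measure Ω) (G : Ω → ℝ) (v : NNReal) : Prop where
  meas : Measurable G
  ind : ∀ (A : Set Ω) (S : Set ℝ), MeasurableSet[F] A → MeasurableSet S →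
    μ (A ∩ G ⁻¹' S) = μ A * gaussianReal 0 v S

lemma CG.mono {Ω : Type*} {F' F : MeasurableSpace Ω} [m : MeasurableSpace Ω] {μ : Measure Ω} {G : Ω → ℝ} {v : NNReal}
    (h : CG F μ G v) (hF : F' ≤ F) : CG F' μ G v :=
  ⟨h.meas, fun A S hA hS => h.ind A S (hF A hA) hS⟩

lemma CG.map_eq {Ω : Type*} {F : MeasurableSpace Ω} [m : MeasurableSpace Ω] {μ : Measure Ω} [IsProbabilityMeasure μ] {G : Ω → ℝ}
    {v : NNReal} (h : CG F μ G v) : μ.map G = gaussianReal 0 v := by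
  ext S hS
  rw [Measure.map_apply h.meas hS]
  have := h.ind univ S MeasurableSet.univ hS
  simpa using this

lemma CG.of_BM {μ : Measure Ω} [IsProbabilityMeasure μ] {F : ℝ → MeasurableSpace Ω}
    {W : ℝ → Ω → ℝ} (h : IsBM μ F W) {s t : ℝ} (hs : 0 ≤ s) (hst : s ≤ t) :
    CG (F s) μ (fun ω => W t ω - W s ω) ((t - s).toNNReal) := by
  have hW : ∀ r, 0 ≤ r → Measurable (W r) := fun r hr =>
    (measurable_iff_comap_le.2 (h.adapted r hr)).mono (h.le r) le_rfl
  have hm : Measurable (fun ω => W t ω - W s ω) := (hW t (hs.trans hst)).sub (hW s hs)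
  refine ⟨hm, fun A S hA hS => ?_⟩
  have h1 := (Indep_iff _ _ μ).1 (h.indep s t hs hst) ((fun ω => W t ω - W s ω) ⁻¹' S) A
    ⟨S, hS, rfl⟩ hA
  rw [inter_comm, h1, mul_comm, ← h.law s t hs hst, Measure.map_apply hm hS]

lemma CG.ite {Ω : Type*} {F : MeasurableSpace Ω} [m : MeasurableSpace Ω] {μ : Measure Ω} (hF : F ≤ m)
    {G₁ G₂ : Ω → ℝ} {v : NNReal} (h₁ : CG F μ G₁ v) (h₂ : CG F μ G₂ v)
    {E : Set Ω} (hE : MeasurableSet[F] E) [DecidablePred (· ∈ E)] :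
    CG F μ (fun ω => if ω ∈ E then G₁ ω else G₂ ω) v := by
  refine ⟨Measurable.ite (hF _ hE) h₁.meas h₂.meas, fun A S hA hS => ?_⟩
  have e1 := h₁.ind (A ∩ E) S (MeasurableSet.inter hA hE) hS
  have e2 := h₂.ind (A \ E) S (MeasurableSet.diff hA hE) hS
  rw [← measure_inter_add_sdiff (A ∩ _) (hF _ hE), ← measure_inter_add_sdiff A (hF _ hE), add_mul,
    ← e1, ← e2]
  congr 2
  · ext ω; simp only [mem_inter_iff, mem_preimage]
    constructor
    · rintro ⟨⟨a, b⟩, c⟩; simp only [c, if_true] at b; exact ⟨⟨a, c⟩, b⟩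
    · rintro ⟨⟨a, c⟩, b⟩; refine ⟨⟨a, ?_⟩, c⟩; simpa only [c, if_true] using b
  · ext ω; simp only [mem_inter_iff, mem_preimage, Set.mem_sdiff]
    constructor
    · rintro ⟨⟨a, b⟩, c⟩; simp only [c, if_false] at b; exact ⟨⟨a, c⟩, b⟩
    · rintro ⟨⟨a, c⟩, b⟩; refine ⟨⟨a, ?_⟩, c⟩; simpa only [c, if_false] using b

lemma CG.map_prod {Ω : Type*} {F : MeasurableSpace Ω} [m : MeasurableSpace Ω] {μ : Measure Ω} [IsProbabilityMeasure μ] (hF : F ≤ m)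
    {G : Ω → ℝ} {v : NNReal} (h : CG F μ G v) {E : Type*} [MeasurableSpace E] {ψ : Ω → E}
    (hψ : Measurable[F] ψ) :
    μ.map (fun ω => (ψ ω, G ω)) = (μ.map ψ).prod (gaussianReal 0 v) := by
  have hψm : Measurable ψ := hψ.mono hF le_rfl
  have := (indepFun_iff_map_prod_eq_prod_map_map (μ := μ) hψm.aemeasurable h.meas.aemeasurable).1
    (by
      rw [indepFun_iff_measure_inter_preimage_eq_mul]
      intro s t hs ht
      rw [h.ind _ t (hψ hs) ht, ← h.map_eq, Measure.map_apply h.meas ht])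
  rw [this, h.map_eq]

lemma CG.lintegral {Ω : Type*} {F : MeasurableSpace Ω} [m : MeasurableSpace Ω] {μ : Measure Ω} [IsProbabilityMeasure μ] (hF : F ≤ m)
    {G : Ω → ℝ} {v : NNReal} (h : CG F μ G v) {E : Type*} [MeasurableSpace E] {ψ : Ω → E}
    (hψ : Measurable[F] ψ) {Φ : E → ℝ → ENNReal} (hΦ : Measurable (Function.uncurry Φ)) :
    ∫⁻ ω, Φ (ψ ω) (G ω) ∂μ = ∫⁻ ω, (∫⁻ x, Φ (ψ ω) x ∂(gaussianReal 0 v)) ∂μ := by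
  have hψm : Measurable ψ := hψ.mono hF le_rfl
  have h1 := lintegral_map (μ := μ) (g := fun ω => (ψ ω, G ω)) hΦ (hψm.prodMk h.meas)
  simp only [Function.uncurry] at h1
  have h2 := lintegral_prod (μ := μ.map ψ) (ν := gaussianReal 0 v) _ hΦ.aemeasurable
  simp only [Function.uncurry] at h2
  have hm' := hΦ.lintegral_prod_right' (ν := gaussianReal 0 v)
  simp only [Function.uncurry] at hm'
  rw [← h1, h.map_prod hF hψ, h2, lintegral_map hm' hψm]

lemma CG.integral {Ω : Type*} {F : MeasurableSpace Ω} [m : MeasurableSpace Ω] {μ : Measure Ω} [IsProbabilityMeasure μ] (hF : F ≤ m)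
    {G : Ω → ℝ} {v : NNReal} (h : CG F μ G v) {E : Type*} [MeasurableSpace E] {ψ : Ω → E}
    (hψ : Measurable[F] ψ) {Φ : E → ℝ → ℂ} (hΦ : Measurable (Function.uncurry Φ))
    (hi : Integrable (fun ω => Φ (ψ ω) (G ω)) μ) :
    ∫ ω, Φ (ψ ω) (G ω) ∂μ = ∫ ω, (∫ x, Φ (ψ ω) x ∂(gaussianReal 0 v)) ∂μ := by
  have hψm : Measurable ψ := hψ.mono hF le_rfl
  have hpm : Measurable (fun ω => (ψ ω, G ω)) := hψm.prodMk h.meas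
  have hs : ∀ ν : Measure (E × ℝ), AEStronglyMeasurable (Function.uncurry Φ) ν :=
    fun ν => hΦ.aestronglyMeasurable
  have h1 := integral_map (μ := μ) hpm.aemeasurable (hs _)
  simp only [Function.uncurry] at h1
  have hi' : Integrable (Function.uncurry Φ) (μ.map (fun ω => (ψ ω, G ω))) :=
    (integrable_map_measure (hs _) hpm.aemeasurable).2 hi
  rw [← h1]
  rw [h.map_prod hF hψ] at hi' ⊢
  have h2 := integral_prod _ hi'
  simp only [Function.uncurry] at h2
  rw [h2, integral_map hψm.aemeasurable]
  have : StronglyMeasurable (fun x => ∫ y, (Function.uncurry Φ) (x, y) ∂(gaussianReal 0 v)) :=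
    hΦ.stronglyMeasurable.integral_prod_right'
  exact this.aestronglyMeasurable

lemma CG.add {Ω : Type*} {F' F : MeasurableSpace Ω} [m : MeasurableSpace Ω] {μ : Measure Ω} [IsProbabilityMeasure μ] (hF : F ≤ m)
    (hF' : F' ≤ F) {S G : Ω → ℝ} {v₁ v₂ : NNReal} (hS : Measurable[F] S)
    (h₁ : CG F' μ S v₁) (h₂ : CG F μ G v₂) :
    CG F' μ (fun ω => S ω + G ω) (v₁ + v₂) := by
  classical
  refine ⟨h₁.meas.add h₂.meas, fun A T hA hT => ?_⟩
  let χ : Ω → ℝ := fun ω => if ω ∈ A then 1 else 0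
  have hχ : Measurable[F'] χ := Measurable.ite hA measurable_const measurable_const
  let Φ : ℝ × ℝ → ℝ → ENNReal := fun p x => if p.1 = 1 ∧ p.2 + x ∈ T then 1 else 0
  have hΦ : Measurable (Function.uncurry Φ) := by
    refine Measurable.ite (MeasurableSet.inter ?_ ?_) measurable_const measurable_const
    · exact measurableSet_eq_fun (f := fun p : (ℝ × ℝ) × ℝ => p.1.1) (by fun_prop) (by fun_prop)
    · exact hT.preimage (f := fun p : (ℝ × ℝ) × ℝ => p.1.2 + p.2) (by fun_prop)
  let Ψ : ℝ → ℝ → ENNReal := fun p s => ∫⁻ x, Φ (p, s) x ∂(gaussianReal 0 v₂)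
  have hΨ : Measurable (Function.uncurry Ψ) := hΦ.lintegral_prod_right'
  have hAm := hF _ (hF' _ hA)
  have hTm : MeasurableSet ((fun ω => S ω + G ω) ⁻¹' T) := (h₁.meas.add h₂.meas) hT
  have e1 : μ (A ∩ (fun ω => S ω + G ω) ⁻¹' T) = ∫⁻ ω, Φ (χ ω, S ω) (G ω) ∂μ := by
    rw [← lintegral_indicator_one (hAm.inter hTm)]
    refine lintegral_congr fun ω => ?_
    by_cases ha : ω ∈ A <;> by_cases hb : S ω + G ω ∈ T <;>
      simp [Φ, χ, ha, hb, indicator]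
  rw [e1, h₂.lintegral hF (ψ := fun ω => (χ ω, S ω))
    ((hχ.mono hF' le_rfl).prodMk hS) hΦ]
  have e2 := h₁.lintegral (hF'.trans hF) (ψ := χ) hχ hΨ
  simp only [Ψ] at e2
  have e3 : gaussianReal 0 (v₁ + v₂) = (gaussianReal 0 v₁).conv (gaussianReal 0 v₂) := by
    rw [gaussianReal_conv_gaussianReal, add_zero]
  rw [e2, e3]
  rw [Measure.conv, Measure.map_apply (by fun_prop) hT, Measure.prod_apply (by
    exact hT.preimage (by fun_prop))]
  rw [← lintegral_indicator_one hAm, ← lintegral_mul_const _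
    (measurable_one.indicator hAm)]
  refine lintegral_congr fun ω => ?_
  by_cases ha : ω ∈ A
  · simp only [χ, ha, if_true, indicator_of_mem, Pi.one_apply, one_mul]
    refine lintegral_congr fun s => ?_
    rw [← lintegral_indicator_one]
    · refine lintegral_congr fun x => ?_
      by_cases hb : s + x ∈ T <;> simp [Φ, hb, indicator]
    · exact (hT.preimage (f := fun x => s + x) (by fun_prop))
  · simp [χ, ha, Φ]

lemma CG.zero {Ω : Type*} {F : MeasurableSpace Ω} [m : MeasurableSpace Ω] {μ : Measure Ω} :
    CG F μ (fun _ => 0) 0 := by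
  refine ⟨measurable_const, fun A S hA hS => ?_⟩
  by_cases h0 : (0 : ℝ) ∈ S <;> simp [h0, gaussianReal_zero_var, hS]

/-- Sums of conditionally Gaussian increments. -/
lemma CG.sum {μ : Measure Ω} [IsProbabilityMeasure μ] {F : ℕ → MeasurableSpace Ω}
    (hF : ∀ k, F k ≤ m) (hmono : Monotone F) {G : ℕ → Ω → ℝ} {v : NNReal}
    (hG : ∀ k, CG (F k) μ (G k) v) (hGm : ∀ k, Measurable[F (k+1)] (G k)) (a n : ℕ) :
    Measurable[F (a + n)] (fun ω => ∑ k ∈ Finset.range n, G (a + k) ω) ∧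
    CG (F a) μ (fun ω => ∑ k ∈ Finset.range n, G (a + k) ω) (n * v) := by
  induction n with
  | zero => simpa using CG.zero
  | succ n ih =>
    have hs : Measurable[F (a+n)] (fun ω => ∑ k ∈ Finset.range n, G (a + k) ω) := ih.1
    have ha : a + n ≤ a + (n+1) := by lia
    simp only [Finset.sum_range_succ]
    refine ⟨(hs.mono (hmono ha) le_rfl).add (hGm (a+n)), ?_⟩
    have := CG.add (hF (a+n)) (hmono (Nat.le_add_right a n)) hs ih.2 (hG (a+n))
    convert this using 1
    push_cast; ring

lemma lintegral_gauss_sq (v : NNReal) (s c : ℝ) :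
    ∫⁻ x, ENNReal.ofReal ((s + c * x) ^ 2) ∂(gaussianReal 0 v) =
      ENNReal.ofReal (s ^ 2) + v * ENNReal.ofReal (c ^ 2) := by
  have hm : MemLp id 2 (gaussianReal 0 v) := memLp_id_gaussianReal 2
  have i1 : Integrable (fun x : ℝ => x) (gaussianReal 0 v) := hm.integrable (by norm_num)
  have i2 : Integrable (fun x : ℝ => x ^ 2) (gaussianReal 0 v) := hm.integrable_sq
  have hv : ∫ x, x ^ 2 ∂(gaussianReal 0 v) = v := by
    have h1 := variance_of_integral_eq_zero (μ := gaussianReal 0 v) (X := id)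
      aemeasurable_id (by simp)
    rw [variance_id_gaussianReal] at h1
    simpa using h1.symm
  have e : ∀ x : ℝ, (s + c * x) ^ 2 = s ^ 2 + (2 * s * c) * x + c ^ 2 * x ^ 2 := by intro x; ring
  have i3 : Integrable (fun x : ℝ => (s + c * x) ^ 2) (gaussianReal 0 v) := by
    simp_rw [e]
    exact ((integrable_const _).add (i1.const_mul _)).add (i2.const_mul _)
  rw [← ofReal_integral_eq_lintegral_ofReal i3 (ae_of_all _ fun x => sq_nonneg _)]
  simp_rw [e]
  have i4 : Integrable (fun x : ℝ => s ^ 2 + (2 * s * c) * x) (gaussianReal 0 v) :=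
    (integrable_const _).add (i1.const_mul _)
  rw [integral_add i4 (i2.const_mul _),
    integral_add (integrable_const _) (i1.const_mul _), integral_const_mul, integral_const_mul, hv,
    integral_id_gaussianReal]
  simp only [integral_const, probReal_univ, one_smul, mul_zero, add_zero]
  rw [ENNReal.ofReal_add (sq_nonneg _) (by positivity), mul_comm, ENNReal.ofReal_mul v.coe_nonneg]
  simp

/-- Ito isometry for discrete sums. -/
lemma isometry {μ : Measure Ω} [IsProbabilityMeasure μ] {F : ℕ → MeasurableSpace Ω}
    (hF : ∀ k, F k ≤ m) (hmono : Monotone F) {G c : ℕ → Ω → ℝ} {v : NNReal}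
    (hG : ∀ k, CG (F k) μ (G k) v) (hGm : ∀ k, Measurable[F (k+1)] (G k))
    (hc : ∀ k, Measurable[F k] (c k)) (n : ℕ) :
    Measurable[F n] (fun ω => ∑ k ∈ Finset.range n, c k ω * G k ω) ∧
    ∫⁻ ω, ENNReal.ofReal ((∑ k ∈ Finset.range n, c k ω * G k ω) ^ 2) ∂μ =
      ∑ k ∈ Finset.range n, v * ∫⁻ ω, ENNReal.ofReal ((c k ω) ^ 2) ∂μ := by
  induction n with
  | zero => simp
  | succ n ih =>
    have hs : Measurable[F n] (fun ω => ∑ k ∈ Finset.range n, c k ω * G k ω) := ih.1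
    simp only [Finset.sum_range_succ]
    refine ⟨(hs.mono (hmono n.le_succ) le_rfl).add
      (((hc n).mono (hmono n.le_succ) le_rfl).mul (hGm n)), ?_⟩
    have := (hG n).lintegral (hF n) (ψ := fun ω => (∑ k ∈ Finset.range n, c k ω * G k ω, c n ω))
      (hs.prodMk (hc n)) (Φ := fun p x => ENNReal.ofReal ((p.1 + p.2 * x) ^ 2)) (by fun_prop)
    rw [this]
    simp only [lintegral_gauss_sq]
    rw [lintegral_add_left, ih.2, lintegral_const_mul]
    · have := (hc n).mono (hF n) le_rfl
      fun_prop
    · have := hs.mono (hF n) le_rfl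
      fun_prop

/-- Gaussian mass of an interval. -/
lemma gauss_interval {v : NNReal} (hv : v ≠ 0) (r c : ℝ) :
    gaussianReal 0 v {x | |r + x| ≤ c} ≤ ENNReal.ofReal (2 * c / Real.sqrt (2 * Real.pi * v)) := by
  have hvp : (0 : ℝ) < v := by positivity
  rw [gaussianReal_apply _ hv]
  calc ∫⁻ x in {x | |r + x| ≤ c}, gaussianPDF 0 v x
      ≤ ∫⁻ x in {x | |r + x| ≤ c}, ENNReal.ofReal (1 / Real.sqrt (2 * Real.pi * v)) := by
        refine lintegral_mono fun x => ?_
        rw [gaussianPDF]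
        apply ENNReal.ofReal_le_ofReal
        rw [gaussianPDFReal, one_div]
        have : Real.exp (-(x - 0) ^ 2 / (2 * v)) ≤ 1 := by
          rw [Real.exp_le_one_iff]
          apply div_nonpos_of_nonpos_of_nonneg
          · nlinarith [sq_nonneg (x - 0)]
          · positivity
        exact mul_le_of_le_one_right (by positivity) this
    _ = ENNReal.ofReal (1 / Real.sqrt (2 * Real.pi * v)) * ENNReal.ofReal (2 * c) := by
        rw [setLIntegral_const]
        congr 1
        have : {x : ℝ | |r + x| ≤ c} = Icc (-r - c) (-r + c) := by
          ext x; simp only [mem_ofPred_eq, mem_Icc, abs_le]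
          constructor <;> rintro ⟨h1, h2⟩ <;> constructor <;> linarith
        rw [this, Real.volume_Icc]; congr 1; ring
    _ ≤ _ := by
        rw [← ENNReal.ofReal_mul (by positivity)]
        apply le_of_eq; congr 1; ring

lemma CG.anticonc {Ω : Type*} {F : MeasurableSpace Ω} [m : MeasurableSpace Ω] {μ : Measure Ω} [IsProbabilityMeasure μ] (hF : F ≤ m)
    {G : Ω → ℝ} {v : NNReal} (h : CG F μ G v) (hv : v ≠ 0) {R : Ω → ℝ} (hR : Measurable[F] R)
    (c : ℝ) :
    μ {ω | |R ω + G ω| ≤ c} ≤ ENNReal.ofReal (2 * c / Real.sqrt (2 * Real.pi * v)) := by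
  classical
  have hRm : Measurable R := hR.mono hF le_rfl
  have hGm := h.meas
  have hset : MeasurableSet {p : ℝ × ℝ | |p.1 + p.2| ≤ c} :=
    measurableSet_le (by fun_prop) measurable_const
  let Φ : ℝ → ℝ → ENNReal := fun r x =>
    ({p : ℝ × ℝ | |p.1 + p.2| ≤ c}.indicator (1 : ℝ × ℝ → ENNReal)) (r, x)
  have hΦ : Measurable (Function.uncurry Φ) := measurable_one.indicator hset
  have e1 : μ {ω | |R ω + G ω| ≤ c} =
      ∫⁻ ω, Φ (R ω) (G ω) ∂μ := by
    have : MeasurableSet {ω | |R ω + G ω| ≤ c} := measurableSet_le (by fun_prop) measurable_const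
    rw [← lintegral_indicator_one this]
    rfl
  rw [e1, h.lintegral hF hR hΦ]
  · calc _ ≤ ∫⁻ ω, ENNReal.ofReal (2 * c / Real.sqrt (2 * Real.pi * v)) ∂μ := by
          refine lintegral_mono fun ω => ?_
          refine le_trans (le_of_eq ?_) (gauss_interval hv (R ω) c)
          rw [← lintegral_indicator_one (measurableSet_le (by fun_prop) measurable_const)]
          rfl
      _ = _ := by simp

set_option linter.unusedSectionVars false

lemma CG.neg {Ω : Type*} {F : MeasurableSpace Ω} [m : MeasurableSpace Ω] {μ : Measure Ω}
    {G : Ω → ℝ} {v : NNReal} (h : CG F μ G v) : CG F μ (fun ω => - G ω) v := by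
  refine ⟨h.meas.neg, fun A S hA hS => ?_⟩
  have := h.ind A (Neg.neg ⁻¹' S) hA (hS.preimage measurable_neg)
  rw [← Measure.map_apply measurable_neg hS] at this
  have e := gaussianReal_map_neg (μ := 0) (v := v)
  rw [neg_zero] at e
  have e' : (gaussianReal 0 v).map Neg.neg = gaussianReal 0 v := e
  rw [e'] at this
  exact this

lemma sum_meas {Ω : Type*} {F : ℕ → MeasurableSpace Ω}
    (hmono : Monotone F) {G : ℕ → Ω → ℝ} (hGm : ∀ k, Measurable[F (k+1)] (G k)) (n : ℕ) :
    Measurable[F n] (fun ω => ∑ k ∈ Finset.range n, G k ω) := by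
  refine Finset.measurable_fun_sum _ fun k hk => ?_
  exact (hGm k).mono (hmono (Finset.mem_range.1 hk)) le_rfl

/-- Left-point sum with step `d` and `j` steps. -/
def dsum (H X : ℝ → Ω → ℝ) (d : ℝ) (j : ℕ) (ω : Ω) : ℝ :=
  ∑ i ∈ Finset.range j, H (d * i) ω * (X (d * (i + 1 : ℕ)) ω - X (d * i) ω)

lemma rsum_eq_dsum (H X : ℝ → Ω → ℝ) (t : ℝ) (n : ℕ) (ω : Ω) :
    rsum H X t n ω = dsum H X (t / 2 ^ n) (2 ^ n) ω := by
  unfold rsum dsum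
  refine Finset.sum_congr rfl fun i _ => ?_
  have e1 : t * (i : ℝ) / 2 ^ n = t / 2 ^ n * i := by ring
  have e2 : t * ((i : ℝ) + 1) / 2 ^ n = t / 2 ^ n * (i + 1 : ℕ) := by push_cast; ring
  rw [e1, e2]

lemma dsum_refine (H X : ℝ → Ω → ℝ) (d : ℝ) (N : ℕ) (hN : 0 < N) (j : ℕ) (ω : Ω) :
    dsum H X (d * N) j ω = ∑ q ∈ Finset.range (j * N),
      H (d * ((N * (q / N) : ℕ) : ℝ)) ω * (X (d * (q + 1 : ℕ)) ω - X (d * q) ω) := by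
  induction j with
  | zero => simp [dsum]
  | succ j ih =>
    have : dsum H X (d * N) (j + 1) ω = dsum H X (d * N) j ω +
        H (d * N * j) ω * (X (d * N * (j + 1 : ℕ)) ω - X (d * N * j) ω) := by
      unfold dsum; rw [Finset.sum_range_succ]
    rw [this, ih, add_mul, one_mul, Finset.sum_range_add]
    congr 1
    have e : ∀ k ∈ Finset.range N, H (d * ((N * ((j * N + k) / N) : ℕ) : ℝ)) ω *
        (X (d * (j * N + k + 1 : ℕ)) ω - X (d * (j * N + k : ℕ)) ω) =
        H (d * N * j) ω * ((fun k : ℕ => X (d * (j * N + k : ℕ)) ω) (k + 1) -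
          (fun k : ℕ => X (d * (j * N + k : ℕ)) ω) k) := by
      intro k hk
      have hk' := Finset.mem_range.1 hk
      have : (j * N + k) / N = j := by
        rw [mul_comm, Nat.mul_add_div hN, Nat.div_eq_of_lt hk', add_zero]
      rw [this]
      congr 2
      push_cast; ring
    rw [Finset.sum_congr rfl e, ← Finset.mul_sum,
      Finset.sum_range_sub (fun k : ℕ => X (d * (j * N + k : ℕ)) ω)]
    congr 3 <;> push_cast <;> ring_nf

/-- The working context: `Y` solves the scalar equation. -/
structure Ctx (μ : Measure Ω) (F : ℝ → MeasurableSpace Ω) (B₁ B₂ Y I₁ I₂ : ℝ → Ω → ℝ)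
    (lam y : ℝ) : Prop where
  bm₁ : IsBM μ F B₁
  bm₂ : IsBM μ F B₂
  adp : ∀ t, 0 ≤ t → Measurable[F t] (Y t)
  cont : ∀ᵐ ω ∂μ, Continuous fun t => Y t ω
  si₁ : IsSI μ (fun s ω => if Y s ω ≤ 0 then 0 else 1) B₁ I₁
  si₂ : IsSI μ (fun s ω => if Y s ω ≤ 0 then 1 else 0) B₂ I₂
  eqn : ∀ᵐ ω ∂μ, ∀ t : ℝ, 0 ≤ t →
    Y t ω = y + (∫ s in (0:ℝ)..t, (if Y s ω ≤ 0 then lam else -lam)) + (I₁ t ω - I₂ t ω)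
  lam0 : 0 ≤ lam

variable {μ : Measure Ω} {F : ℝ → MeasurableSpace Ω} {B₁ B₂ Y I₁ I₂ : ℝ → Ω → ℝ}
    {lam y : ℝ}

lemma IsBM.meas (h : IsBM μ F B₁) {t : ℝ} (ht : 0 ≤ t) : Measurable[F t] (B₁ t) :=
  measurable_iff_comap_le.2 (h.adapted t ht)

lemma Ctx.leSet (h : Ctx μ F B₁ B₂ Y I₁ I₂ lam y) {t : ℝ} (ht : 0 ≤ t) :
    MeasurableSet[F t] {ω | Y t ω ≤ 0} :=
  h.adp t ht measurableSet_Iic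

lemma Ctx.meas (h : Ctx μ F B₁ B₂ Y I₁ I₂ lam y) {t : ℝ} (ht : 0 ≤ t) : Measurable (Y t) :=
  (h.adp t ht).mono (h.bm₁.le t) le_rfl

/-- Mixture increment. -/
def ginc (B₁ B₂ Y : ℝ → Ω → ℝ) (d : ℝ) (k : ℕ) (ω : Ω) : ℝ :=
  if Y (d * k) ω ≤ 0 then B₂ (d * (k + 1 : ℕ)) ω - B₂ (d * k) ω
  else B₁ (d * (k + 1 : ℕ)) ω - B₁ (d * k) ω

def winc (B₁ B₂ Y : ℝ → Ω → ℝ) (d : ℝ) (k : ℕ) (ω : Ω) : ℝ :=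
  if Y (d * k) ω ≤ 0 then -(B₂ (d * (k + 1 : ℕ)) ω - B₂ (d * k) ω)
  else B₁ (d * (k + 1 : ℕ)) ω - B₁ (d * k) ω

lemma grid_nonneg {d : ℝ} (hd : 0 ≤ d) (k : ℕ) : 0 ≤ d * (k : ℝ) := by positivity

lemma grid_mono {d : ℝ} (hd : 0 ≤ d) {k l : ℕ} (hkl : k ≤ l) : d * (k : ℝ) ≤ d * (l : ℝ) :=
  mul_le_mul_of_nonneg_left (by exact_mod_cast hkl) hd

lemma bm_inc_CG [IsProbabilityMeasure μ] (h : IsBM μ F B₁) {d : ℝ} (hd : 0 ≤ d) (k : ℕ) :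
    CG (F (d * k)) μ (fun ω => B₁ (d * (k + 1 : ℕ)) ω - B₁ (d * k) ω) d.toNNReal := by
  have := CG.of_BM h (grid_nonneg hd k) (grid_mono hd k.le_succ)
  convert this using 2
  push_cast; ring

lemma bm_inc_meas (h : IsBM μ F B₁) {d : ℝ} (hd : 0 ≤ d) (k : ℕ) :
    Measurable[F (d * (k + 1 : ℕ))] (fun ω => B₁ (d * (k + 1 : ℕ)) ω - B₁ (d * k) ω) :=
  (h.meas (grid_nonneg hd _)).sub
    ((h.meas (grid_nonneg hd _)).mono (h.mono (grid_mono hd k.le_succ)) le_rfl)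

lemma Ctx.ginc_CG [IsProbabilityMeasure μ] (h : Ctx μ F B₁ B₂ Y I₁ I₂ lam y) {d : ℝ} (hd : 0 ≤ d)
    (k : ℕ) : CG (F (d * k)) μ (ginc B₁ B₂ Y d k) d.toNNReal := by
  have := CG.ite (E := {ω | Y (d * k) ω ≤ 0}) (h.bm₁.le _) (bm_inc_CG h.bm₂ hd k)
    (bm_inc_CG h.bm₁ hd k) (h.leSet (grid_nonneg hd k))
  exact this

lemma Ctx.winc_CG [IsProbabilityMeasure μ] (h : Ctx μ F B₁ B₂ Y I₁ I₂ lam y) {d : ℝ} (hd : 0 ≤ d)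
    (k : ℕ) : CG (F (d * k)) μ (winc B₁ B₂ Y d k) d.toNNReal := by
  have := CG.ite (E := {ω | Y (d * k) ω ≤ 0}) (h.bm₁.le _) (bm_inc_CG h.bm₂ hd k).neg
    (bm_inc_CG h.bm₁ hd k) (h.leSet (grid_nonneg hd k))
  exact this

lemma Ctx.ginc_meas (h : Ctx μ F B₁ B₂ Y I₁ I₂ lam y) {d : ℝ} (hd : 0 ≤ d)
    (k : ℕ) : Measurable[F (d * (k + 1 : ℕ))] (ginc B₁ B₂ Y d k) :=
  Measurable.ite (h.bm₁.mono (grid_mono hd k.le_succ) _ (h.leSet (grid_nonneg hd k)))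
    (bm_inc_meas h.bm₂ hd k) (bm_inc_meas h.bm₁ hd k)

lemma Ctx.winc_meas (h : Ctx μ F B₁ B₂ Y I₁ I₂ lam y) {d : ℝ} (hd : 0 ≤ d)
    (k : ℕ) : Measurable[F (d * (k + 1 : ℕ))] (winc B₁ B₂ Y d k) :=
  Measurable.ite (h.bm₁.mono (grid_mono hd k.le_succ) _ (h.leSet (grid_nonneg hd k)))
    (bm_inc_meas h.bm₂ hd k).neg (bm_inc_meas h.bm₁ hd k)

def J1 (B₁ Y : ℝ → Ω → ℝ) (d : ℝ) (j : ℕ) (ω : Ω) : ℝ :=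
  dsum (fun s ω => if Y s ω ≤ 0 then 0 else 1) B₁ d j ω
def J2 (B₂ Y : ℝ → Ω → ℝ) (d : ℝ) (j : ℕ) (ω : Ω) : ℝ :=
  dsum (fun s ω => if Y s ω ≤ 0 then 1 else 0) B₂ d j ω

lemma J_sub (d : ℝ) (j : ℕ) (ω : Ω) :
    J1 B₁ Y d j ω - J2 B₂ Y d j ω = ∑ k ∈ Finset.range j, winc B₁ B₂ Y d k ω := by
  unfold J1 J2 dsum
  rw [← Finset.sum_sub_distrib]
  refine Finset.sum_congr rfl fun k _ => ?_
  unfold winc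
  by_cases hY : Y (d * k) ω ≤ 0 <;> simp [hY]

lemma J_add (d : ℝ) (j : ℕ) (ω : Ω) :
    J1 B₁ Y d j ω + J2 B₂ Y d j ω = ∑ k ∈ Finset.range j, ginc B₁ B₂ Y d k ω := by
  unfold J1 J2 dsum
  rw [← Finset.sum_add_distrib]
  refine Finset.sum_congr rfl fun k _ => ?_
  unfold ginc
  by_cases hY : Y (d * k) ω ≤ 0 <;> simp [hY]

lemma Ctx.tendsto₁ (h : Ctx μ F B₁ B₂ Y I₁ I₂ lam y) {t : ℝ} (ht : 0 ≤ t) :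
    TendstoInMeasure μ (fun n => J1 B₁ Y (t / 2 ^ n) (2 ^ n)) atTop (I₁ t) := by
  refine (h.si₁.2 t ht).congr (fun n => ae_of_all _ fun ω => ?_) (ae_of_all _ fun ω => rfl)
  exact rsum_eq_dsum _ _ _ _ _

lemma Ctx.tendsto₂ (h : Ctx μ F B₁ B₂ Y I₁ I₂ lam y) {t : ℝ} (ht : 0 ≤ t) :
    TendstoInMeasure μ (fun n => J2 B₂ Y (t / 2 ^ n) (2 ^ n)) atTop (I₂ t) := by
  refine (h.si₂.2 t ht).congr (fun n => ae_of_all _ fun ω => ?_) (ae_of_all _ fun ω => rfl)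
  exact rsum_eq_dsum _ _ _ _ _

lemma tim_sub {f g : ℕ → Ω → ℝ} {a b : Ω → ℝ} (hf : TendstoInMeasure μ f atTop a)
    (hg : TendstoInMeasure μ g atTop b) :
    TendstoInMeasure μ (fun n ω => f n ω - g n ω) atTop (fun ω => a ω - b ω) := by
  rw [tendstoInMeasure_iff_norm] at *
  intro e he
  have h1 := (hf (e / 2) (by positivity)).add (hg (e / 2) (by positivity))
  rw [add_zero] at h1
  refine tendsto_of_tendsto_of_tendsto_of_le_of_le tendsto_const_nhds h1 (fun _ => zero_le) ?_
  intro n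
  refine (measure_mono ?_).trans (measure_union_le _ _)
  intro ω hω
  simp only [mem_ofPred_eq, mem_union, Real.norm_eq_abs] at *
  by_contra! hcon
  have : f n ω - g n ω - (a ω - b ω) = (f n ω - a ω) - (g n ω - b ω) := by ring
  rw [this] at hω
  have := abs_sub (f n ω - a ω) (g n ω - b ω)
  linarith [hcon.1, hcon.2]

lemma tim_neg {f : ℕ → Ω → ℝ} {a : Ω → ℝ} (hf : TendstoInMeasure μ f atTop a) :
    TendstoInMeasure μ (fun n ω => - f n ω) atTop (fun ω => - a ω) := by
  have h0 : TendstoInMeasure μ (fun (_ : ℕ) (_ : Ω) => (0:ℝ)) atTop (fun _ => 0) := by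
    rw [tendstoInMeasure_iff_norm]
    intro e he
    simp [not_le.2 he]
  simpa using tim_sub h0 hf

lemma tim_add {f g : ℕ → Ω → ℝ} {a b : Ω → ℝ} (hf : TendstoInMeasure μ f atTop a)
    (hg : TendstoInMeasure μ g atTop b) :
    TendstoInMeasure μ (fun n ω => f n ω + g n ω) atTop (fun ω => a ω + b ω) := by
  simpa using tim_sub hf (tim_neg hg)

lemma abs_driftint (f : ℝ → ℝ) (lam a b : ℝ) (hab : a ≤ b) (hl : 0 ≤ lam) :
    |∫ s in a..b, (if f s ≤ 0 then lam else -lam)| ≤ lam * (b - a) := by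
  have := intervalIntegral.norm_integral_le_of_norm_le_const (a := a) (b := b) (C := lam)
    (f := fun s => if f s ≤ 0 then lam else -lam) (by
      intro s _; split_ifs <;> simp [abs_of_nonneg hl])
  rwa [Real.norm_eq_abs, abs_of_nonneg (sub_nonneg.2 hab)] at this

lemma drift_integrable {f : ℝ → ℝ} (hf : Continuous f) (lam a b : ℝ) :
    IntervalIntegrable (fun s => if f s ≤ 0 then lam else -lam) volume a b := by
  have hm : Measurable (fun s => if f s ≤ 0 then lam else -lam) :=
    Measurable.ite (hf.measurable measurableSet_Iic) measurable_const measurable_const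
  refine (intervalIntegrable_const (c := |lam|)).mono_fun hm.aestronglyMeasurable ?_
  refine ae_of_all _ fun s => ?_
  dsimp only
  split_ifs <;> simp

/-- Anti-concentration of `Y v`. -/
lemma Ctx.anticonc [IsProbabilityMeasure μ] (h : Ctx μ F B₁ B₂ Y I₁ I₂ lam y) {v : ℝ} (hv : 0 < v)
    (n : ℕ) {c : ℝ} (hc : 0 < c) :
    μ {ω | |Y v ω| ≤ c} ≤ ENNReal.ofReal (2 * (2 * c + lam * (v / 2 ^ n)) /
      Real.sqrt (2 * Real.pi * (v / 2 ^ n))) := by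
  set η := v / 2 ^ n with hη
  have hηp : 0 < η := by positivity
  set u := v - η with hu
  have hηv : η ≤ v := div_le_self hv.le (one_le_pow₀ (by norm_num))
  have hu0 : 0 ≤ u := by linarith
  set K := ENNReal.ofReal (2 * (2 * c + lam * η) / Real.sqrt (2 * Real.pi * η))
  have T1 := tim_sub (h.tendsto₁ hv.le) (h.tendsto₂ hv.le)
  have T2 := tim_sub (h.tendsto₁ hu0) (h.tendsto₂ hu0)
  rw [tendstoInMeasure_iff_norm] at T1 T2
  have T1' := (T1 (c/2) (by positivity)).comp (tendsto_add_atTop_nat n)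
  have T2' := T2 (c/2) (by positivity)
  have T3 := (tendsto_const_nhds (x := K)).add (T1'.add T2')
  rw [add_zero, add_zero] at T3
  refine ge_of_tendsto' T3 fun k => ?_
  set d := v / 2 ^ (k + n) with hd
  have hd0 : 0 < d := by positivity
  set a := 2 ^ (k + n) - 2 ^ k with ha
  have hle : 2 ^ k ≤ 2 ^ (k + n) := Nat.pow_le_pow_right (by norm_num) (by lia)
  have hak : a + 2 ^ k = 2 ^ (k + n) := by lia
  have hau : d * (a : ℝ) = u := by
    have : (a : ℝ) = 2 ^ (k + n) - 2 ^ k := by rw [ha, Nat.cast_sub hle]; simp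
    rw [this, hd, hu, hη, pow_add]; field_simp
  have S1 := CG.sum (μ := μ) (F := fun k => F (d * k)) (fun _ => h.bm₁.le _)
    (fun i j hij => h.bm₁.mono (grid_mono hd0.le hij)) (h.winc_CG hd0.le) (h.winc_meas hd0.le)
  have Sa := sum_meas (F := fun k : ℕ => F (d * k))
    (fun i j hij => h.bm₁.mono (grid_mono hd0.le hij)) (h.winc_meas hd0.le) a
  have Sb := (S1 a (2 ^ k)).2
  rw [hau] at Sa Sb
  set d' := u / 2 ^ k with hd'
  have hd'0 : 0 ≤ d' := by positivity
  have S2 := sum_meas (F := fun k : ℕ => F (d' * k))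
    (fun i j hij => h.bm₁.mono (grid_mono hd'0 hij)) (h.winc_meas hd'0) (2 ^ k)
  have : d' * ((2 ^ k : ℕ) : ℝ) = u := by rw [hd']; push_cast; field_simp
  rw [this] at S2
  have hR : Measurable[F u] (fun ω => Y u ω + (∑ k ∈ Finset.range a, winc B₁ B₂ Y d k ω)
      - ∑ k ∈ Finset.range (2 ^ k), winc B₁ B₂ Y d' k ω) := ((h.adp u hu0).add Sa).sub S2
  have hvar : ((2 ^ k : ℕ) : NNReal) * d.toNNReal = η.toNNReal := by
    apply NNReal.coe_injective
    push_cast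
    rw [Real.coe_toNNReal _ hd0.le, Real.coe_toNNReal _ hηp.le, hd, hη, pow_add]; field_simp
  rw [hvar] at Sb
  have AC := Sb.anticonc (h.bm₁.le u) (by simpa using hηp) hR (2 * c + lam * η)
  rw [Real.coe_toNNReal _ hηp.le] at AC
  have hsub : {ω | |Y v ω| ≤ c} ≤ᵐ[μ]
      ({ω | |Y u ω + (∑ k ∈ Finset.range a, winc B₁ B₂ Y d k ω)
      - ∑ k ∈ Finset.range (2 ^ k), winc B₁ B₂ Y d' k ω +
        ∑ j ∈ Finset.range (2 ^ k), winc B₁ B₂ Y d (a + j) ω| ≤ 2 * c + lam * η} ∪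
       ({ω | c / 2 ≤ ‖J1 B₁ Y d (2 ^ (k + n)) ω - J2 B₂ Y d (2 ^ (k + n)) ω - (I₁ v ω - I₂ v ω)‖} ∪
        {ω | c / 2 ≤ ‖J1 B₁ Y d' (2 ^ k) ω - J2 B₂ Y d' (2 ^ k) ω - (I₁ u ω - I₂ u ω)‖}) : Set Ω) := by
    filter_upwards [h.cont, h.eqn] with ω hcont heq hω
    have hω : |Y v ω| ≤ c := hω
    by_contra hcon
    have hcon : ω ∉ ({ω | |Y u ω + (∑ k ∈ Finset.range a, winc B₁ B₂ Y d k ω)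
      - ∑ k ∈ Finset.range (2 ^ k), winc B₁ B₂ Y d' k ω +
        ∑ j ∈ Finset.range (2 ^ k), winc B₁ B₂ Y d (a + j) ω| ≤ 2 * c + lam * η} ∪
       ({ω | c / 2 ≤ ‖J1 B₁ Y d (2 ^ (k + n)) ω - J2 B₂ Y d (2 ^ (k + n)) ω - (I₁ v ω - I₂ v ω)‖} ∪
        {ω | c / 2 ≤ ‖J1 B₁ Y d' (2 ^ k) ω - J2 B₂ Y d' (2 ^ k) ω - (I₁ u ω - I₂ u ω)‖}) : Set Ω) := hcon
    simp only [mem_union, mem_ofPred_eq, not_or, not_le, Real.norm_eq_abs, J_sub] at hcon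
    obtain ⟨c1, c2, c3⟩ := hcon
    have e1 : ∑ k ∈ Finset.range (2 ^ (k + n)), winc B₁ B₂ Y d k ω =
        (∑ k ∈ Finset.range a, winc B₁ B₂ Y d k ω) +
        ∑ j ∈ Finset.range (2 ^ k), winc B₁ B₂ Y d (a + j) ω := by
      rw [← Finset.sum_range_add, hak]
    rw [e1] at c2
    have q1 := heq v hv.le
    have q2 := heq u hu0
    have q3 := intervalIntegral.integral_add_adjacent_intervals
      (drift_integrable hcont lam 0 u) (drift_integrable hcont lam u v)
    have q4 := abs_driftint (fun s => Y s ω) lam u v (by linarith) h.lam0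
    have q5 : v - u = η := by rw [hu]; ring
    rw [q5] at q4
    rw [abs_le] at hω q4
    rw [abs_lt] at c2 c3
    rw [lt_abs] at c1
    rcases c1 with c1 | c1 <;> linarith [hω.1, hω.2, q4.1, q4.2, c2.1, c2.2, c3.1, c3.2]
  refine (measure_mono_ae hsub).trans ((measure_union_le _ _).trans ?_)
  refine add_le_add AC ?_
  exact measure_union_le _ _

lemma Ctx.anticonc_unif [IsProbabilityMeasure μ] (h : Ctx μ F B₁ B₂ Y I₁ I₂ lam y)
    {ε : ℝ} (hε : 0 < ε) (T : ℝ) {e : ℝ} (he : 0 < e) :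
    ∃ c > 0, ∀ v, ε ≤ v → v ≤ T → μ {ω | |Y v ω| ≤ c} ≤ ENNReal.ofReal e := by
  have hl := h.lam0
  have T1 : Tendsto (fun n : ℕ => 2 * lam * Real.sqrt (T * (1/2) ^ n)) atTop (nhds 0) := by
    have h1 := tendsto_pow_atTop_nhds_zero_of_lt_one (r := (1/2 : ℝ)) (by norm_num) (by norm_num)
    have h2 := (Real.continuous_sqrt.tendsto _).comp (h1.const_mul T)
    have h3 := h2.const_mul (2 * lam)
    simpa using h3
  obtain ⟨n, hn⟩ := (T1.eventually (gt_mem_nhds (half_pos he))).exists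
  have hs : 0 < Real.sqrt (ε / 2 ^ n) := Real.sqrt_pos.2 (by positivity)
  refine ⟨e / 8 * Real.sqrt (ε / 2 ^ n), by positivity, fun v hv hvT => ?_⟩
  have hv0 : 0 < v := hε.trans_le hv
  refine (h.anticonc hv0 n (by positivity)).trans (ENNReal.ofReal_le_ofReal ?_)
  set η := v / 2 ^ n with hη
  have hηp : 0 < η := by positivity
  have hsη : 0 < Real.sqrt η := Real.sqrt_pos.2 hηp
  have e1 : Real.sqrt η ≤ Real.sqrt (2 * Real.pi * η) := by
    apply Real.sqrt_le_sqrt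
    nlinarith [Real.pi_gt_three]
  have e2 : Real.sqrt (ε / 2 ^ n) ≤ Real.sqrt η := by
    apply Real.sqrt_le_sqrt; rw [hη]; gcongr
  have e3 : Real.sqrt η ≤ Real.sqrt (T * (1/2) ^ n) := by
    apply Real.sqrt_le_sqrt; rw [hη, one_div, inv_pow, ← div_eq_mul_inv]; gcongr
  have e4 : η = Real.sqrt η * Real.sqrt η := (Real.mul_self_sqrt hηp.le).symm
  calc _ ≤ 2 * (2 * (e / 8 * Real.sqrt (ε / 2 ^ n)) + lam * η) / Real.sqrt η := by gcongr
    _ ≤ e := by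
      rw [div_le_iff₀ hsη]
      have q : 2 * lam * Real.sqrt η ≤ e / 2 := by
        refine le_trans ?_ hn.le
        gcongr
      nlinarith

def dif (Y : ℝ → Ω → ℝ) (a b : ℝ) : Set Ω := {ω | ¬(Y a ω ≤ 0 ↔ Y b ω ≤ 0)}

lemma Ctx.dif_meas (h : Ctx μ F B₁ B₂ Y I₁ I₂ lam y) {a b : ℝ} (ha : 0 ≤ a) (hb : 0 ≤ b) :
    MeasurableSet (dif Y a b) := by
  have h1 : MeasurableSet {ω | Y a ω ≤ 0} := h.meas ha measurableSet_Iic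
  have h2 : MeasurableSet {ω | Y b ω ≤ 0} := h.meas hb measurableSet_Iic
  have : dif Y a b = ({ω | Y a ω ≤ 0} \ {ω | Y b ω ≤ 0}) ∪
    ({ω | Y b ω ≤ 0} \ {ω | Y a ω ≤ 0}) := by
    ext ω; simp only [dif, mem_ofPred_eq, mem_union, Set.mem_sdiff]; tauto
  rw [this]
  exact (h1.diff h2).union (h2.diff h1)

lemma Ctx.unifcont [IsProbabilityMeasure μ] (h : Ctx μ F B₁ B₂ Y I₁ I₂ lam y)
    (T : ℝ) {c : ℝ} (hc : 0 < c) {e : ENNReal} (he : 0 < e) :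
    ∃ ρ > 0, ∀ a b : ℝ, 0 ≤ a → a ≤ T → 0 ≤ b → b ≤ T → |a - b| ≤ ρ →
      μ {ω | c ≤ |Y a ω - Y b ω|} ≤ e := by
  by_contra! hcon
  choose a b ha haT hb hbT hab hlt using fun n : ℕ => hcon (1 / ((n : ℝ) + 1)) (by positivity)
  have T0 : TendstoInMeasure μ (fun n ω => Y (a n) ω - Y (b n) ω) atTop (fun _ => 0) := by
    refine tendstoInMeasure_of_tendsto_ae
      (fun n => ((h.meas (ha n)).sub (h.meas (hb n))).aestronglyMeasurable) ?_
    filter_upwards [h.cont] with ω hω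
    have huc : UniformContinuousOn (fun t => Y t ω) (Icc 0 T) :=
      isCompact_Icc.uniformContinuousOn_of_continuous hω.continuousOn
    rw [Metric.uniformContinuousOn_iff] at huc
    rw [Metric.tendsto_atTop]
    intro x hx
    obtain ⟨δ, hδ, hδ'⟩ := huc x hx
    obtain ⟨N, hN⟩ := exists_nat_one_div_lt hδ
    refine ⟨N, fun n hn => ?_⟩
    have hd : dist (a n) (b n) < δ := by
      rw [Real.dist_eq]
      refine (hab n).trans_lt (lt_of_le_of_lt ?_ hN)
      have : (N : ℝ) ≤ n := by exact_mod_cast hn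
      gcongr
    have := hδ' (a n) ⟨ha n, haT n⟩ (b n) ⟨hb n, hbT n⟩ hd
    simpa [Real.dist_eq] using this
  rw [tendstoInMeasure_iff_norm] at T0
  have T1 := T0 c hc
  obtain ⟨n, hn⟩ := (T1.eventually (gt_mem_nhds he)).exists
  have := hlt n
  simp only [sub_zero, Real.norm_eq_abs] at hn
  exact absurd hn (not_lt.2 this.le)

lemma Ctx.dif_small [IsProbabilityMeasure μ] (h : Ctx μ F B₁ B₂ Y I₁ I₂ lam y)
    {ε : ℝ} (hε : 0 < ε) (T : ℝ) {e : ℝ} (he : 0 < e) :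
    ∃ ρ > 0, ∀ a b, ε ≤ a → a ≤ T → ε ≤ b → b ≤ T → |a - b| ≤ ρ →
      μ (dif Y a b) ≤ ENNReal.ofReal e := by
  obtain ⟨c, hc, hc'⟩ := h.anticonc_unif hε T (half_pos he)
  obtain ⟨ρ, hρ, hρ'⟩ := h.unifcont T hc (e := ENNReal.ofReal (e / 2)) (by simpa using he)
  refine ⟨ρ, hρ, fun a b ha haT hb hbT hab => ?_⟩
  have : dif Y a b ⊆ {ω | |Y a ω| ≤ c} ∪ {ω | c ≤ |Y a ω - Y b ω|} := by
    intro ω hω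
    simp only [dif, mem_ofPred_eq, mem_union] at *
    by_contra! hcon
    apply hω
    obtain ⟨h1, h2⟩ := hcon
    rw [lt_abs] at h1
    rw [abs_lt] at h2
    constructor <;> intro h3 <;> rcases h1 with h1 | h1 <;> linarith [h2.1, h2.2]
  refine (measure_mono this).trans ((measure_union_le _ _).trans ?_)
  have := add_le_add (hc' a ha haT) (hρ' a b (hε.le.trans ha) haT (hε.le.trans hb) hbT hab)
  rwa [← ENNReal.ofReal_add (by positivity) (by positivity), add_halves] at this

lemma count_small {d x : ℝ} (hd : 0 ≤ d) (hx : 0 ≤ x) (N : ℕ) :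
    ∑ q ∈ Finset.range N, (if d * (q : ℝ) < x then d else 0) ≤ x + d := by
  have : ∑ q ∈ Finset.range N, (if d * (q : ℝ) < x then d else 0) ≤ d * N ∧
    ∑ q ∈ Finset.range N, (if d * (q : ℝ) < x then d else 0) ≤ x + d := by
    induction N with
    | zero => simp; linarith
    | succ n ih =>
      rw [Finset.sum_range_succ]
      split_ifs with hn
      · push_cast; constructor <;> linarith [ih.1, ih.2]
      · push_cast; constructor <;> linarith [ih.1, ih.2]
  exact this.2

/-- Comparison of two left-point sums on different grids. -/
lemma Ctx.compare [IsProbabilityMeasure μ] (h : Ctx μ F B₁ B₂ Y I₁ I₂ lam y)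
    {B : ℝ → Ω → ℝ} (hB : IsBM μ F B) {p q : ℝ} (hpq : (p - q) ^ 2 ≤ 1)
    {t ε e ρ : ℝ} (ht : 0 < t) (hε : 0 < ε) (he : 0 < e) (hρε : ρ ≤ ε)
    (hsm : ∀ a b, ε ≤ a → a ≤ t → ε ≤ b → b ≤ t → |a - b| ≤ ρ →
      μ (dif Y a b) ≤ ENNReal.ofReal e) {n k : ℕ} (hn : t / 2 ^ n ≤ ρ) (hk : t / 2 ^ k ≤ ρ)
    {j : ℕ} (hj0 : 0 < j) (hj : j ≤ 2 ^ n) :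
    ∫⁻ ω, ENNReal.ofReal ((dsum (fun s ω => if Y s ω ≤ 0 then p else q) B (t / 2 ^ n) j ω -
      dsum (fun s ω => if Y s ω ≤ 0 then p else q) B (t / 2 ^ n * j / 2 ^ k) (2 ^ k) ω) ^ 2) ∂μ
      ≤ ENNReal.ofReal (t * e + 3 * ε) := by
  set d := t / 2 ^ (n + k) with hd
  have hd0 : 0 < d := by positivity
  have e1 : t / 2 ^ n = d * (2 ^ k : ℕ) := by rw [hd, pow_add]; push_cast; field_simp
  have e2 : t / 2 ^ n * j / 2 ^ k = d * j := by rw [hd, pow_add]; field_simp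
  set H : ℝ → Ω → ℝ := fun s ω => if Y s ω ≤ 0 then p else q with hH
  let A : ℕ → ℝ := fun r => d * ((2 ^ k * (r / 2 ^ k) : ℕ) : ℝ)
  let A' : ℕ → ℝ := fun r => d * ((j * (r / j) : ℕ) : ℝ)
  have hAl : ∀ r, A r ≤ d * r := fun r => grid_mono hd0.le (Nat.mul_div_le r _)
  have hA'l : ∀ r, A' r ≤ d * r := fun r => grid_mono hd0.le (Nat.mul_div_le r _)
  have hA0 : ∀ r, 0 ≤ A r := fun r => grid_nonneg hd0.le _
  have hA'0 : ∀ r, 0 ≤ A' r := fun r => grid_nonneg hd0.le _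
  have hAg : ∀ r, d * r ≤ A r + ρ := by
    intro r
    have : (r : ℝ) ≤ ((2 ^ k * (r / 2 ^ k) : ℕ) : ℝ) + (2 ^ k : ℕ) := by
      have := Nat.lt_mul_div_succ r (b := 2 ^ k) (by positivity)
      rw [mul_add, mul_one] at this
      exact_mod_cast this.le
    have h2 := mul_le_mul_of_nonneg_left this hd0.le
    rw [mul_add, ← e1] at h2
    linarith
  have hA'g : ∀ r, d * r ≤ A' r + ρ := by
    intro r
    have : (r : ℝ) ≤ ((j * (r / j) : ℕ) : ℝ) + (2 ^ n : ℕ) := by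
      have := Nat.lt_mul_div_succ r (b := j) hj0
      rw [mul_add, mul_one] at this
      exact_mod_cast this.le.trans (by lia)
    have h2 := mul_le_mul_of_nonneg_left this hd0.le
    have e3 : d * (2 ^ n : ℕ) = t / 2 ^ k := by rw [hd, pow_add]; push_cast; field_simp
    rw [mul_add, e3] at h2
    linarith
  have hHm : ∀ a r : ℝ, 0 ≤ a → a ≤ r → Measurable[F r] (H a) := by
    intro a r ha har
    exact Measurable.ite (hB.mono har _ (h.leSet ha)) measurable_const measurable_const
  have iso := (isometry (μ := μ) (F := fun r : ℕ => F (d * r)) (fun _ => hB.le _)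
    (fun i j hij => hB.mono (grid_mono hd0.le hij))
    (G := fun r ω => B (d * (r + 1 : ℕ)) ω - B (d * r) ω)
    (c := fun r ω => H (A r) ω - H (A' r) ω) (v := d.toNNReal)
    (bm_inc_CG hB hd0.le) (bm_inc_meas hB hd0.le)
    (fun r => (hHm _ _ (hA0 r) (hAl r)).sub (hHm _ _ (hA'0 r) (hA'l r))) (j * 2 ^ k)).2
  have e4 : ∀ ω, dsum H B (t / 2 ^ n) j ω - dsum H B (t / 2 ^ n * j / 2 ^ k) (2 ^ k) ω =
      ∑ r ∈ Finset.range (j * 2 ^ k), (H (A r) ω - H (A' r) ω) *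
        (B (d * (r + 1 : ℕ)) ω - B (d * r) ω) := by
    intro ω
    rw [e2, e1, dsum_refine _ _ _ _ (by positivity), dsum_refine _ _ _ _ hj0, mul_comm (2 ^ k) j,
      ← Finset.sum_sub_distrib]
    refine Finset.sum_congr rfl fun r _ => ?_
    rw [sub_mul]
  simp_rw [e4]
  rw [iso]
  have bound : ∀ r ∈ Finset.range (j * 2 ^ k),
      (d.toNNReal : ENNReal) * ∫⁻ ω, ENNReal.ofReal ((H (A r) ω - H (A' r) ω) ^ 2) ∂μ ≤
      ENNReal.ofReal (d * e + if d * (r : ℝ) < 2 * ε then d else 0) := by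
    intro r hr
    have hr' := Finset.mem_range.1 hr
    have hrt : d * (r : ℝ) ≤ t := by
      have h1 : (r : ℝ) ≤ ((2 ^ n * 2 ^ k : ℕ) : ℝ) := by
        exact_mod_cast hr'.le.trans (Nat.mul_le_mul_right _ hj)
      calc d * (r : ℝ) ≤ d * ((2 ^ n * 2 ^ k : ℕ) : ℝ) := by gcongr
        _ = t := by rw [hd, pow_add]; push_cast; field_simp
    have h1 : ∫⁻ ω, ENNReal.ofReal ((H (A r) ω - H (A' r) ω) ^ 2) ∂μ ≤ μ (dif Y (A r) (A' r)) := by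
      rw [← lintegral_indicator_one (h.dif_meas (hA0 r) (hA'0 r))]
      refine lintegral_mono fun ω => ?_
      by_cases hω : ω ∈ dif Y (A r) (A' r)
      · rw [indicator_of_mem hω]
        simp only [hH, Pi.one_apply]
        rw [ENNReal.ofReal_le_one]
        split_ifs <;> nlinarith
      · rw [indicator_of_notMem hω]
        simp only [dif, mem_ofPred_eq, not_not] at hω
        simp [hH, hω]
    have h2 : μ (dif Y (A r) (A' r)) ≤ ENNReal.ofReal (e + if d * (r : ℝ) < 2 * ε then 1 else 0) := by
      split_ifs with hc
      · refine prob_le_one.trans ?_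
        rw [← ENNReal.ofReal_one]; exact ENNReal.ofReal_le_ofReal (by linarith)
      · rw [add_zero]
        push Not at hc
        have a1 := hAl r; have a2 := hA'l r; have a3 := hAg r; have a4 := hA'g r
        refine hsm _ _ (by linarith) (by linarith) (by linarith) (by linarith) ?_
        rw [abs_le]; constructor <;> linarith
    refine (mul_le_mul_right (h1.trans h2) _).trans (le_of_eq ?_)
    rw [← ENNReal.ofReal, ← ENNReal.ofReal_mul hd0.le, mul_add]
    congr 2
    split_ifs <;> simp
  refine (Finset.sum_le_sum bound).trans ?_
  rw [← ENNReal.ofReal_sum_of_nonneg (by intro r _; split_ifs <;> positivity)]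
  apply ENNReal.ofReal_le_ofReal
  rw [Finset.sum_add_distrib]
  have c1 := count_small hd0.le (x := 2 * ε) (by positivity) (j * 2 ^ k)
  have c2 : d ≤ ε := by
    refine le_trans ?_ (hn.trans hρε)
    rw [hd, pow_add]
    apply div_le_div_of_nonneg_left ht.le (by positivity)
    exact le_mul_of_one_le_right (by positivity) (one_le_pow₀ (by norm_num))
  have c3 : ∑ r ∈ Finset.range (j * 2 ^ k), d * e ≤ t * e := by
    rw [Finset.sum_const, Finset.card_range, nsmul_eq_mul, ← mul_assoc]
    apply mul_le_mul_of_nonneg_right _ he.le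
    have h1 : ((j * 2 ^ k : ℕ) : ℝ) ≤ ((2 ^ n * 2 ^ k : ℕ) : ℝ) := by
      exact_mod_cast Nat.mul_le_mul_right _ hj
    calc ((j * 2 ^ k : ℕ) : ℝ) * d ≤ ((2 ^ n * 2 ^ k : ℕ) : ℝ) * d := by gcongr
      _ = t := by rw [hd, pow_add]; push_cast; field_simp
  linarith

/-- Fubini for the indicator of sign disagreement. -/
lemma Ctx.fubini [IsProbabilityMeasure μ] (h : Ctx μ F B₁ B₂ Y I₁ I₂ lam y)
    {s a b : ℝ} (hs : 0 ≤ s) (ha : 0 ≤ a) (K : ENNReal)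
    (hK : ∀ u ∈ Ioc a b, μ (dif Y u s) ≤ K) :
    ∃ g : Ω → ENNReal, Measurable g ∧
      (∀ᵐ ω ∂μ, ENNReal.ofReal |∫ u in Ioc a b, ((if Y u ω ≤ 0 then lam else -lam) -
        (if Y s ω ≤ 0 then lam else -lam))| ≤ ENNReal.ofReal (2 * lam) * g ω) ∧
      ∫⁻ ω, g ω ∂μ ≤ K * ENNReal.ofReal (b - a) := by
  classical
  obtain ⟨S, hSsub, hSm, hS⟩ : ∃ S, S ⊆ {ω | Continuous fun t => Y t ω} ∧ MeasurableSet S ∧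
      μ Sᶜ = 0 := by
    have := h.cont
    rw [ae_iff] at this
    obtain ⟨N, hN, hNm, hN0⟩ := exists_measurable_superset_of_null this
    refine ⟨Nᶜ, ?_, hNm.compl, by simpa using hN0⟩
    intro ω hω
    by_contra hc
    exact hω (hN hc)
  let Z : ℝ → Ω → ℝ := fun u ω => if ω ∈ S then Y (max u 0) ω else 0
  have hZc : ∀ ω, Continuous fun u => Z u ω := by
    intro ω
    by_cases hω : ω ∈ S
    · have h1 : Continuous fun t => Y t ω := hSsub hω
      simp only [Z, hω, if_true]
      exact h1.comp (continuous_id.max continuous_const)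
    · simp only [Z, hω, if_false]; exact continuous_const
  have hZm : ∀ u, Measurable (Z u) := fun u =>
    Measurable.ite hSm (h.meas (le_max_right _ _)) measurable_const
  have hZ : Measurable (Function.uncurry Z) := measurable_uncurry_of_continuous_of_measurable hZc hZm
  let D : Set (ℝ × Ω) := {p | ¬ (Z p.1 p.2 ≤ 0 ↔ Y s p.2 ≤ 0)}
  have hD : MeasurableSet D := by
    have h1 : MeasurableSet {p : ℝ × Ω | Z p.1 p.2 ≤ 0} := hZ measurableSet_Iic
    have h2 : MeasurableSet {p : ℝ × Ω | Y s p.2 ≤ 0} :=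
      ((h.meas hs).comp measurable_snd) measurableSet_Iic
    have : D = ({p : ℝ × Ω | Z p.1 p.2 ≤ 0} \ {p : ℝ × Ω | Y s p.2 ≤ 0}) ∪
      ({p : ℝ × Ω | Y s p.2 ≤ 0} \ {p : ℝ × Ω | Z p.1 p.2 ≤ 0}) := by
      ext p; simp only [D, mem_ofPred_eq, mem_union, Set.mem_sdiff]; tauto
    rw [this]
    exact (h1.diff h2).union (h2.diff h1)
  let f : Ω → ℝ → ENNReal := fun ω u => D.indicator 1 (u, ω)
  have hf : Measurable (Function.uncurry f) :=
    (measurable_one.indicator hD).comp measurable_swap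
  refine ⟨fun ω => ∫⁻ u in Ioc a b, f ω u, hf.lintegral_prod_right', ?_, ?_⟩
  · have hSae : ∀ᵐ ω ∂μ, ω ∈ S := by rw [ae_iff]; exact hS
    filter_upwards [hSae] with ω hω
    rw [← Real.enorm_eq_ofReal_abs]
    refine (enorm_integral_le_lintegral_enorm _).trans ?_
    rw [← lintegral_const_mul' _ _ ENNReal.ofReal_ne_top]
    refine setLIntegral_mono' measurableSet_Ioc fun u hu => ?_
    have hZu : Z u ω = Y u ω := by
      simp only [Z, hω, if_true, max_eq_left (ha.trans hu.1.le)]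
    have hl := h.lam0
    by_cases hd : (u, ω) ∈ D
    · simp only [f, indicator_of_mem hd, Pi.one_apply, mul_one]
      rw [Real.enorm_eq_ofReal_abs]
      apply ENNReal.ofReal_le_ofReal
      rw [abs_le]
      split_ifs <;> constructor <;> linarith
    · simp only [f, indicator_of_notMem hd]
      simp only [D, mem_ofPred_eq, not_not, hZu] at hd
      simp [hd]
  · rw [lintegral_lintegral_swap hf.aemeasurable]
    calc _ ≤ ∫⁻ u in Ioc a b, K := by
          refine setLIntegral_mono' measurableSet_Ioc fun u hu => ?_
          refine le_trans (le_of_eq ?_) (hK u hu)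
          have : ∀ ω, f ω u = ((fun ω => (u, ω)) ⁻¹' D).indicator 1 ω := fun ω => rfl
          simp_rw [this]
          rw [lintegral_indicator_one (measurable_prodMk_left hD)]
          apply measure_congr
          have hSae : ∀ᵐ ω ∂μ, ω ∈ S := by rw [ae_iff]; exact hS
          filter_upwards [hSae] with ω hω
          have hZu : Z u ω = Y u ω := by
            simp only [Z, hω, if_true, max_eq_left (ha.trans hu.1.le)]
          apply propext
          change ¬ (Z u ω ≤ 0 ↔ Y s ω ≤ 0) ↔ ¬ (Y u ω ≤ 0 ↔ Y s ω ≤ 0)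
          rw [hZu]
      _ = _ := by rw [setLIntegral_const, Real.volume_Ioc]

def hdr (Y : ℝ → Ω → ℝ) (lam : ℝ) (u : ℝ) (ω : Ω) : ℝ := if Y u ω ≤ 0 then lam else -lam

lemma Ctx.drift_compare [IsProbabilityMeasure μ] (h : Ctx μ F B₁ B₂ Y I₁ I₂ lam y)
    {t ε e ρ : ℝ} (ht : 0 < t) (hε : 0 < ε) (he : 0 < e) (hρε : ρ ≤ ε)
    (hsm : ∀ a b, ε ≤ a → a ≤ t → ε ≤ b → b ≤ t → |a - b| ≤ ρ →
      μ (dif Y a b) ≤ ENNReal.ofReal e) {n : ℕ} (hn : t / 2 ^ n ≤ ρ)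
    {j : ℕ} (hj : j ≤ 2 ^ n) :
    ∃ g : Ω → ENNReal, Measurable g ∧
      (∀ᵐ ω ∂μ, ENNReal.ofReal |(∫ u in (0:ℝ)..(t / 2 ^ n * j), hdr Y lam u ω) -
        ∑ i ∈ Finset.range j, t / 2 ^ n * hdr Y lam (t / 2 ^ n * i) ω| ≤ g ω) ∧
      ∫⁻ ω, g ω ∂μ ≤ ENNReal.ofReal (2 * lam * (t * e + 3 * ε)) := by
  set d := t / 2 ^ n with hd
  have hd0 : 0 < d := by positivity
  have hl := h.lam0
  have key : ∀ i, i < j → ∃ g : Ω → ENNReal, Measurable g ∧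
      (∀ᵐ ω ∂μ, ENNReal.ofReal |∫ u in Ioc (d * i) (d * (i + 1 : ℕ)), (hdr Y lam u ω -
        hdr Y lam (d * i) ω)| ≤ ENNReal.ofReal (2 * lam) * g ω) ∧
      ∫⁻ ω, g ω ∂μ ≤ ENNReal.ofReal (d * e + if d * (i : ℝ) < 2 * ε then d else 0) := by
    intro i hi
    have hit : d * (i + 1 : ℕ) ≤ t := by
      have : ((i + 1 : ℕ) : ℝ) ≤ (2 ^ n : ℕ) := by exact_mod_cast (by lia : i + 1 ≤ 2 ^ n)
      calc d * (i + 1 : ℕ) ≤ d * (2 ^ n : ℕ) := by gcongr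
        _ = t := by rw [hd]; push_cast; field_simp
    obtain ⟨g, g1, g2, g3⟩ := h.fubini (s := d * i) (a := d * i) (b := d * (i + 1 : ℕ))
      (grid_nonneg hd0.le _) (grid_nonneg hd0.le _)
      (ENNReal.ofReal (e + if d * (i : ℝ) < 2 * ε then 1 else 0)) (by
        intro u hu
        split_ifs with hc
        · refine prob_le_one.trans ?_
          rw [← ENNReal.ofReal_one]; exact ENNReal.ofReal_le_ofReal (by linarith)
        · rw [add_zero]
          push Not at hc
          have u1 := hu.1; have u2 := hu.2
          push_cast at u2 hit
          refine hsm _ _ (by linarith) (by linarith) (by linarith) (by linarith) ?_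
          rw [abs_le]; constructor <;> linarith)
    refine ⟨g, g1, g2, g3.trans (le_of_eq ?_)⟩
    rw [← ENNReal.ofReal_mul (by split_ifs <;> linarith)]
    congr 1; push_cast
    split_ifs <;> ring
  choose! g g1 g2 g3 using key
  refine ⟨fun ω => ∑ i ∈ Finset.range j, ENNReal.ofReal (2 * lam) * g i ω, ?_, ?_, ?_⟩
  · refine Finset.measurable_fun_sum _ fun i hi => (g1 i (Finset.mem_range.1 hi)).const_mul _
  · have : ∀ᵐ ω ∂μ, ∀ i < j, ENNReal.ofReal |∫ u in Ioc (d * i) (d * (i + 1 : ℕ)),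
        (hdr Y lam u ω - hdr Y lam (d * i) ω)| ≤ ENNReal.ofReal (2 * lam) * g i ω := by
      rw [ae_all_iff]; intro i
      by_cases hi : i < j
      · filter_upwards [g2 i hi] with ω hω _ using hω
      · exact ae_of_all _ fun ω hc => absurd hc hi
    filter_upwards [this, h.cont] with ω hω hcont
    have hintg : ∀ a b, IntervalIntegrable (fun u => hdr Y lam u ω) volume a b := fun a b =>
      drift_integrable hcont lam a b
    have e1 := intervalIntegral.sum_integral_adjacent_intervals (n := j) (μ := volume)
      (a := fun k : ℕ => d * (k : ℝ)) (f := fun u => hdr Y lam u ω) (fun k _ => hintg _ _)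
    simp only [Nat.cast_zero, mul_zero] at e1
    rw [← e1, ← Finset.sum_sub_distrib]
    have e2 : ∀ i ∈ Finset.range j, (∫ u in (d * (i:ℝ))..(d * (i + 1 : ℕ)), hdr Y lam u ω) -
        d * hdr Y lam (d * i) ω = ∫ u in Ioc (d * (i:ℝ)) (d * (i + 1 : ℕ)), (hdr Y lam u ω -
        hdr Y lam (d * i) ω) := by
      intro i _
      rw [← intervalIntegral.integral_of_le (grid_mono hd0.le i.le_succ),
        intervalIntegral.integral_sub (hintg _ _) intervalIntegrable_const,
        intervalIntegral.integral_const]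
      push_cast
      simp only [smul_eq_mul]
      ring
    rw [Finset.sum_congr rfl e2]
    refine (ENNReal.ofReal_le_ofReal (Finset.abs_sum_le_sum_abs _ _)).trans ?_
    rw [ENNReal.ofReal_sum_of_nonneg (fun _ _ => abs_nonneg _)]
    exact Finset.sum_le_sum fun i hi => hω i (Finset.mem_range.1 hi)
  · rw [lintegral_finsetSum' _ (fun i hi =>
      ((g1 i (Finset.mem_range.1 hi)).const_mul _).aemeasurable)]
    calc _ ≤ ∑ i ∈ Finset.range j, ENNReal.ofReal (2 * lam) *
          ENNReal.ofReal (d * e + if d * (i : ℝ) < 2 * ε then d else 0) := by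
          refine Finset.sum_le_sum fun i hi => ?_
          rw [lintegral_const_mul _ (g1 i (Finset.mem_range.1 hi))]
          gcongr
          exact g3 i (Finset.mem_range.1 hi)
      _ ≤ _ := by
          rw [← Finset.mul_sum, ← ENNReal.ofReal_sum_of_nonneg
            (by intro r _; split_ifs <;> positivity), ← ENNReal.ofReal_mul (by positivity)]
          apply ENNReal.ofReal_le_ofReal
          apply mul_le_mul_of_nonneg_left _ (by positivity)
          rw [Finset.sum_add_distrib]
          have c1 := count_small hd0.le (x := 2 * ε) (by positivity) j
          have c2 : d ≤ ε := hn.trans hρε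
          have c3 : ∑ r ∈ Finset.range j, d * e ≤ t * e := by
            rw [Finset.sum_const, Finset.card_range, nsmul_eq_mul, ← mul_assoc]
            apply mul_le_mul_of_nonneg_right _ he.le
            have h1 : (j : ℝ) ≤ ((2 ^ n : ℕ) : ℝ) := by exact_mod_cast hj
            calc (j : ℝ) * d ≤ ((2 ^ n : ℕ) : ℝ) * d := by gcongr
              _ = t := by rw [hd]; push_cast; field_simp
          linarith

/-- Euler scheme for `Y`. -/
def Yh (B₁ B₂ Y : ℝ → Ω → ℝ) (lam y d : ℝ) (j : ℕ) (ω : Ω) : ℝ :=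
  y + (∑ i ∈ Finset.range j, d * hdr Y lam (d * i) ω) + (J1 B₁ Y d j ω - J2 B₂ Y d j ω)

lemma cheb {f : Ω → ℝ} (hf : Measurable f) {δ K : ℝ} (hδ : 0 < δ)
    (h : ∫⁻ ω, ENNReal.ofReal (f ω ^ 2) ∂μ ≤ ENNReal.ofReal K) :
    μ {ω | δ ≤ |f ω|} ≤ ENNReal.ofReal (K / δ ^ 2) := by
  have h1 := meas_ge_le_lintegral_div (μ := μ) (f := fun ω => ENNReal.ofReal (f ω ^ 2))
    (by fun_prop) (ε := ENNReal.ofReal (δ ^ 2)) (by simpa using hδ.ne') ENNReal.ofReal_ne_top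
  rw [ENNReal.ofReal_div_of_pos (by positivity)]
  refine le_trans (measure_mono ?_) (h1.trans (ENNReal.div_le_div_right h _))
  intro ω hω
  apply ENNReal.ofReal_le_ofReal
  rw [← sq_abs (f ω)]
  have : δ ≤ |f ω| := hω
  gcongr

lemma Ctx.dsum_meas (h : Ctx μ F B₁ B₂ Y I₁ I₂ lam y) {B : ℝ → Ω → ℝ} (hB : IsBM μ F B)
    (p q : ℝ) {d : ℝ} (hd : 0 ≤ d) (j : ℕ) :
    Measurable (dsum (fun s ω => if Y s ω ≤ 0 then p else q) B d j) := by
  unfold dsum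
  refine Finset.measurable_fun_sum _ fun i _ => ?_
  refine Measurable.mul ?_ ?_
  · exact Measurable.ite (h.meas (grid_nonneg hd i) measurableSet_Iic) measurable_const
      measurable_const
  · exact (bm_inc_meas hB hd i).mono (hB.le _) le_rfl

lemma Ctx.close [IsProbabilityMeasure μ] (h : Ctx μ F B₁ B₂ Y I₁ I₂ lam y)
    {t δ e₀ : ℝ} (ht : 0 < t) (hδ : 0 < δ) (he₀ : 0 < e₀) :
    ∃ N : ℕ, ∀ n ≥ N, ∀ j ≤ 2 ^ n,
      μ {ω | δ ≤ |Yh B₁ B₂ Y lam y (t / 2 ^ n) j ω - Y (t / 2 ^ n * j) ω|} ≤ ENNReal.ofReal e₀ := by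
  have hl := h.lam0
  set δ' := δ / 5 with hδ'
  have hδ'0 : 0 < δ' := by positivity
  set K := 2 * lam / δ' + 2 / δ' ^ 2 with hK
  have hK0 : 0 < K := by positivity
  set κ := e₀ / K with hκ
  have hκ0 : 0 < κ := by positivity
  set e := κ / (2 * t) with he
  set ε := κ / 6 with hε
  have he0 : 0 < e := by positivity
  have hε0 : 0 < ε := by positivity
  have hκe : t * e + 3 * ε = κ := by rw [he, hε]; field_simp; norm_num
  obtain ⟨ρ₀, hρ₀, hsm₀⟩ := h.dif_small hε0 t he0
  set ρ := min ρ₀ ε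
  have hρ : 0 < ρ := lt_min hρ₀ hε0
  have hρε : ρ ≤ ε := min_le_right _ _
  have hsm : ∀ a b, ε ≤ a → a ≤ t → ε ≤ b → b ≤ t → |a - b| ≤ ρ →
      μ (dif Y a b) ≤ ENNReal.ofReal e := fun a b h1 h2 h3 h4 h5 =>
    hsm₀ a b h1 h2 h3 h4 (h5.trans (min_le_left _ _))
  have T0 : Tendsto (fun n : ℕ => t / 2 ^ n) atTop (nhds 0) := by
    have h1 := tendsto_pow_atTop_nhds_zero_of_lt_one (r := (1/2 : ℝ)) (by norm_num) (by norm_num)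
    have h2 := h1.const_mul t
    simpa [div_eq_mul_inv] using h2
  obtain ⟨N, hN⟩ := eventually_atTop.1 (T0.eventually (gt_mem_nhds hρ))
  refine ⟨N, fun n hn j hj => ?_⟩
  set d := t / 2 ^ n with hd
  have hd0 : 0 < d := by positivity
  have hdρ : d ≤ ρ := (hN n hn).le
  rcases Nat.eq_zero_or_pos j with rfl | hj0
  · have : ∀ᵐ ω ∂μ, ¬ (δ ≤ |Yh B₁ B₂ Y lam y d 0 ω - Y (d * (0 : ℕ)) ω|) := by
      filter_upwards [h.eqn, h.si₁.1, h.si₂.1] with ω h1 h2 h3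
      have := h1 0 le_rfl
      rw [h2, h3] at this
      simp only [Nat.cast_zero, mul_zero, this]
      simp [Yh, J1, J2, dsum, hδ]
    rw [ae_iff] at this
    simp only [not_not] at this
    rw [this]; exact zero_le
  set s := d * (j : ℝ) with hs
  have hs0 : 0 ≤ s := grid_nonneg hd0.le _
  obtain ⟨g, g1, g2, g3⟩ := h.drift_compare ht hε0 he0 hρε hsm (n := n) hdρ hj
  rw [hκe] at g3
  have T1 := h.tendsto₁ hs0
  have T2 := h.tendsto₂ hs0
  rw [tendstoInMeasure_iff_norm] at T1 T2
  have T3 := (tendsto_const_nhds (x := ENNReal.ofReal e₀)).add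
    ((T1 δ' hδ'0).add (T2 δ' hδ'0))
  rw [add_zero, add_zero] at T3
  refine ge_of_tendsto T3 ?_
  filter_upwards [eventually_ge_atTop N] with k hk
  have C1 := h.compare h.bm₁ (p := 0) (q := 1) (by norm_num) ht hε0 he0 hρε hsm (n := n) (k := k)
    hdρ (hN k hk).le hj0 hj
  have C2 := h.compare h.bm₂ (p := 1) (q := 0) (by norm_num) ht hε0 he0 hρε hsm (n := n) (k := k)
    hdρ (hN k hk).le hj0 hj
  rw [hκe] at C1 C2
  have hsk : 0 ≤ s / 2 ^ k := by positivity
  have D1 := cheb (μ := μ) ((h.dsum_meas h.bm₁ 0 1 hd0.le j).sub (h.dsum_meas h.bm₁ 0 1 hsk (2 ^ k)))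
    hδ'0 C1
  have D2 := cheb (μ := μ) ((h.dsum_meas h.bm₂ 1 0 hd0.le j).sub (h.dsum_meas h.bm₂ 1 0 hsk (2 ^ k)))
    hδ'0 C2
  have D3 : μ {ω | ENNReal.ofReal δ' ≤ g ω} ≤ ENNReal.ofReal (2 * lam * κ / δ') := by
    refine (meas_ge_le_lintegral_div g1.aemeasurable (by simpa using hδ'0)
      ENNReal.ofReal_ne_top).trans ?_
    rw [ENNReal.ofReal_div_of_pos hδ'0]
    exact ENNReal.div_le_div_right g3 _
  have hsub : {ω | δ ≤ |Yh B₁ B₂ Y lam y d j ω - Y s ω|} ≤ᵐ[μ]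
      (({ω | ENNReal.ofReal δ' ≤ g ω} ∪
        ({ω | δ' ≤ |J1 B₁ Y d j ω - J1 B₁ Y (s / 2 ^ k) (2 ^ k) ω|} ∪
         {ω | δ' ≤ |J2 B₂ Y d j ω - J2 B₂ Y (s / 2 ^ k) (2 ^ k) ω|})) ∪
        ({ω | δ' ≤ ‖J1 B₁ Y (s / 2 ^ k) (2 ^ k) ω - I₁ s ω‖} ∪
         {ω | δ' ≤ ‖J2 B₂ Y (s / 2 ^ k) (2 ^ k) ω - I₂ s ω‖}) : Set Ω) := by
    filter_upwards [g2, h.eqn] with ω hg heq hω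
    have hω : δ ≤ |Yh B₁ B₂ Y lam y d j ω - Y s ω| := hω
    by_contra hcon
    have hcon : ω ∉ (({ω | ENNReal.ofReal δ' ≤ g ω} ∪
        ({ω | δ' ≤ |J1 B₁ Y d j ω - J1 B₁ Y (s / 2 ^ k) (2 ^ k) ω|} ∪
         {ω | δ' ≤ |J2 B₂ Y d j ω - J2 B₂ Y (s / 2 ^ k) (2 ^ k) ω|})) ∪
        ({ω | δ' ≤ ‖J1 B₁ Y (s / 2 ^ k) (2 ^ k) ω - I₁ s ω‖} ∪
         {ω | δ' ≤ ‖J2 B₂ Y (s / 2 ^ k) (2 ^ k) ω - I₂ s ω‖}) : Set Ω) := hcon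
    simp only [mem_union, mem_ofPred_eq, not_or, not_le, Real.norm_eq_abs] at hcon
    obtain ⟨⟨c1, c2, c3⟩, c4, c5⟩ := hcon
    have c1' := hg.trans_lt c1
    rw [ENNReal.ofReal_lt_ofReal_iff hδ'0] at c1'
    have q1 := heq s hs0
    have q2 : Yh B₁ B₂ Y lam y d j ω - Y s ω =
      (∑ i ∈ Finset.range j, d * hdr Y lam (d * i) ω) + (J1 B₁ Y d j ω - J2 B₂ Y d j ω) -
      (∫ u in (0:ℝ)..s, hdr Y lam u ω) - (I₁ s ω - I₂ s ω) := by
      rw [q1]; unfold Yh hdr; ring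
    rw [q2] at hω
    rw [abs_lt] at c1' c2 c3 c4 c5
    rw [le_abs] at hω
    rcases hω with hω | hω <;> linarith [c1'.1, c1'.2, c2.1, c2.2, c3.1, c3.2, c4.1, c4.2, c5.1, c5.2]
  refine (measure_mono_ae hsub).trans ((measure_union_le _ _).trans ?_)
  refine add_le_add ?_ (measure_union_le _ _)
  refine (measure_union_le _ _).trans ?_
  refine (add_le_add D3 ((measure_union_le _ _).trans (add_le_add D1 D2))).trans ?_
  rw [← ENNReal.ofReal_add (by positivity) (by positivity), ← ENNReal.ofReal_add (by positivity)
    (by positivity)]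
  apply ENNReal.ofReal_le_ofReal
  have : κ * K = e₀ := by rw [hκ]; field_simp
  rw [← this, hK]
  apply le_of_eq; ring

/-- Exponential polynomial on the half line. -/
def pf (A₁ A₂ α₁ α₂ : ℂ) (x : ℝ) : ℂ :=
  A₁ * Complex.exp (α₁ * x) + A₂ * Complex.exp (α₂ * x)

/-- Its even/odd extension. -/
def PF (A₁ A₂ α₁ α₂ τ : ℂ) (x : ℝ) : ℂ :=
  if 0 < x then pf A₁ A₂ α₁ α₂ x else τ * pf A₁ A₂ α₁ α₂ (-x)

/-- Compatibility conditions for the test functions. -/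
structure TF (A₁ A₂ α₁ α₂ τ : ℂ) : Prop where
  ht : τ = 1 ∨ τ = -1
  h0 : (A₁ + A₂) * (1 - τ) = 0
  h1 : (A₁ * α₁ + A₂ * α₂) * (1 + τ) = 0
  r1 : α₁.re ≤ 0
  r2 : α₂.re ≤ 0

section tf
variable {A₁ A₂ α₁ α₂ τ : ℂ}

lemma pf_continuous : Continuous (pf A₁ A₂ α₁ α₂) := by
  unfold pf; fun_prop

lemma TF.norm_tau (h : TF A₁ A₂ α₁ α₂ τ) : ‖τ‖ = 1 := by
  rcases h.ht with h | h <;> simp [h]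

lemma TF.tau_sq (h : TF A₁ A₂ α₁ α₂ τ) : τ * τ = 1 := by
  rcases h.ht with h | h <;> simp [h]

lemma TF.pf_zero (h : TF A₁ A₂ α₁ α₂ τ) : τ * pf A₁ A₂ α₁ α₂ 0 = pf A₁ A₂ α₁ α₂ 0 := by
  simp only [pf, Complex.ofReal_zero, mul_zero, Complex.exp_zero, mul_one]
  linear_combination -h.h0

lemma TF.PF_nonneg (h : TF A₁ A₂ α₁ α₂ τ) {x : ℝ} (hx : 0 ≤ x) :
    PF A₁ A₂ α₁ α₂ τ x = pf A₁ A₂ α₁ α₂ x := by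
  rcases hx.eq_or_lt with rfl | hx
  · simp only [PF, lt_irrefl, if_false, neg_zero, h.pf_zero]
  · simp [PF, hx]

lemma TF.PF_nonpos (_h : TF A₁ A₂ α₁ α₂ τ) {x : ℝ} (hx : x ≤ 0) :
    PF A₁ A₂ α₁ α₂ τ x = τ * pf A₁ A₂ α₁ α₂ (-x) := by
  simp [PF, not_lt.2 hx]

lemma TF.PF_neg (h : TF A₁ A₂ α₁ α₂ τ) (x : ℝ) :
    PF A₁ A₂ α₁ α₂ τ (-x) = τ * PF A₁ A₂ α₁ α₂ τ x := by
  rcases le_total 0 x with hx | hx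
  · rw [h.PF_nonpos (by linarith), h.PF_nonneg hx, neg_neg]
  · rw [h.PF_nonneg (by linarith), h.PF_nonpos hx, ← mul_assoc, h.tau_sq, one_mul]

lemma TF.PF_continuous (h : TF A₁ A₂ α₁ α₂ τ) : Continuous (PF A₁ A₂ α₁ α₂ τ) := by
  have e : PF A₁ A₂ α₁ α₂ τ = fun x => if x ≤ 0 then τ * pf A₁ A₂ α₁ α₂ (-x)
      else pf A₁ A₂ α₁ α₂ x := by
    ext x
    by_cases hx : x ≤ 0
    · simp [PF, hx, not_lt.2 hx]
    · simp [PF, hx, not_le.1 hx]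
  rw [e]
  refine Continuous.if_le ?_ pf_continuous continuous_id continuous_const ?_
  · exact continuous_const.mul (pf_continuous.comp continuous_neg)
  · intro x hx
    have hx : x = 0 := hx
    subst hx
    rw [neg_zero]; exact h.pf_zero

lemma norm_exp_le_one {α : ℂ} (hα : α.re ≤ 0) {x : ℝ} (hx : 0 ≤ x) :
    ‖Complex.exp (α * x)‖ ≤ 1 := by
  rw [Complex.norm_exp]
  simp only [Complex.mul_re, Complex.ofReal_re, Complex.ofReal_im, mul_zero, sub_zero]
  exact Real.exp_le_one_iff.2 (mul_nonpos_of_nonpos_of_nonneg hα hx)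

lemma TF.pf_bound (h : TF A₁ A₂ α₁ α₂ τ) {x : ℝ} (hx : 0 ≤ x) :
    ‖pf A₁ A₂ α₁ α₂ x‖ ≤ ‖A₁‖ + ‖A₂‖ := by
  unfold pf
  refine (norm_add_le _ _).trans ?_
  rw [norm_mul, norm_mul]
  refine add_le_add ?_ ?_
  · exact mul_le_of_le_one_right (norm_nonneg _) (norm_exp_le_one h.r1 hx)
  · exact mul_le_of_le_one_right (norm_nonneg _) (norm_exp_le_one h.r2 hx)

lemma TF.PF_bound (h : TF A₁ A₂ α₁ α₂ τ) (x : ℝ) :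
    ‖PF A₁ A₂ α₁ α₂ τ x‖ ≤ ‖A₁‖ + ‖A₂‖ := by
  rcases le_total 0 x with hx | hx
  · rw [h.PF_nonneg hx]; exact h.pf_bound hx
  · rw [h.PF_nonpos hx, norm_mul, h.norm_tau, one_mul]; exact h.pf_bound (by linarith)

lemma exp_rem (w : ℂ) : ‖Complex.exp w - 1 - w‖ ≤ ‖w‖ ^ 2 * Real.exp ‖w‖ := by
  have := Complex.norm_exp_sub_sum_le_norm_mul_exp w 2
  simpa [Finset.sum_range_succ, sub_sub] using this

lemma TF.cross (h : TF A₁ A₂ α₁ α₂ τ) :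
    ∃ C : ℝ, 0 < C ∧ ∀ v : ℝ, v ≤ 0 →
      ‖PF A₁ A₂ α₁ α₂ τ v - pf A₁ A₂ α₁ α₂ v‖ ≤ C * (v ^ 2 * Real.exp (C * |v|)) := by
  set M := ‖α₁‖ + ‖α₂‖ with hM
  set C := 2 * (‖A₁‖ + ‖A₂‖) * M ^ 2 + M + 1 with hC
  have hM0 : 0 ≤ M := by positivity
  have hC0 : 0 < C := by positivity
  refine ⟨C, hC0, fun v hv => ?_⟩
  have hCM : M ≤ C := by
    have : 0 ≤ 2 * (‖A₁‖ + ‖A₂‖) * M ^ 2 := by positivity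
    linarith
  have rem : ∀ α : ℂ, ‖α‖ ≤ M → ∀ s : ℝ, |s| = |v| →
      ‖Complex.exp (α * s) - 1 - α * s‖ ≤ M ^ 2 * v ^ 2 * Real.exp (C * |v|) := by
    intro α hα s hs
    refine (exp_rem _).trans ?_
    have e1 : ‖α * (s:ℂ)‖ = ‖α‖ * |v| := by rw [norm_mul, Complex.norm_real, Real.norm_eq_abs, hs]
    rw [e1]
    have : M ^ 2 * v ^ 2 = (M * |v|) ^ 2 := by rw [mul_pow, sq_abs]
    rw [this]
    gcongr
    exact hα.trans hCM
  have hα₁ : ‖α₁‖ ≤ M := by rw [hM]; linarith [norm_nonneg α₂]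
  have hα₂ : ‖α₂‖ ≤ M := by rw [hM]; linarith [norm_nonneg α₁]
  rw [h.PF_nonpos hv]
  have key : τ * pf A₁ A₂ α₁ α₂ (-v) - pf A₁ A₂ α₁ α₂ v =
      (τ * A₁ * (Complex.exp (α₁ * (-v : ℝ)) - 1 - α₁ * (-v : ℝ)) -
        A₁ * (Complex.exp (α₁ * v) - 1 - α₁ * v)) +
      (τ * A₂ * (Complex.exp (α₂ * (-v : ℝ)) - 1 - α₂ * (-v : ℝ)) -
        A₂ * (Complex.exp (α₂ * v) - 1 - α₂ * v)) := by
    simp only [pf, Complex.ofReal_neg]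
    linear_combination -h.h0 - (v:ℂ) * h.h1
  rw [key]
  have b1 := rem α₁ hα₁ v rfl
  have b2 := rem α₁ hα₁ (-v) (abs_neg v)
  have b3 := rem α₂ hα₂ v rfl
  have b4 := rem α₂ hα₂ (-v) (abs_neg v)
  set R := M ^ 2 * v ^ 2 * Real.exp (C * |v|) with hR
  have hR0 : 0 ≤ R := by positivity
  calc _ ≤ (‖A₁‖ * R + ‖A₁‖ * R) + (‖A₂‖ * R + ‖A₂‖ * R) := by
        refine (norm_add_le _ _).trans (add_le_add ((norm_sub_le _ _).trans (add_le_add ?_ ?_))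
          ((norm_sub_le _ _).trans (add_le_add ?_ ?_))) <;>
        simp only [norm_mul, h.norm_tau, one_mul] <;> gcongr
    _ = (2 * (‖A₁‖ + ‖A₂‖) * M ^ 2) * (v ^ 2 * Real.exp (C * |v|)) := by rw [hR]; ring
    _ ≤ _ := by
        apply mul_le_mul_of_nonneg_right _ (by positivity)
        rw [hC]; linarith

lemma gauss_moment (C lam T : ℝ) (hC : 0 ≤ C) (hl : 0 ≤ lam) (hT : 0 ≤ T) :
    ∃ K : ℝ, 0 < K ∧ ∀ d : ℝ, 0 ≤ d → d ≤ T → ∀ q : ℕ, q = 1 ∨ q = 2 → ∀ f : ℝ → ℂ, ∀ D : ℝ,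
      0 ≤ D →
      (∀ x, ‖f x‖ ≤ D * ((|x| + lam * d) ^ (2 * q) * Real.exp (C * (|x| + lam * d)))) →
      ‖∫ x, f x ∂(gaussianReal 0 d.toNNReal)‖ ≤ D * (K * d ^ q) := by
  set a := C * √T + 1 with ha
  have hintg : Integrable (fun u : ℝ => 24 * Real.exp (a * (|u| + lam * √T))) (gaussianReal 0 1) := by
    have h1 : Integrable (fun u : ℝ => Real.exp (a * u) + Real.exp (-a * u)) (gaussianReal 0 1) :=
      (integrable_exp_mul_gaussianReal a).add (integrable_exp_mul_gaussianReal (-a))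
    have h2 := h1.const_mul (24 * Real.exp (a * (lam * √T)))
    refine h2.mono' (by fun_prop) (ae_of_all _ fun u => ?_)
    rw [Real.norm_of_nonneg (by positivity), mul_add, Real.exp_add]
    have : Real.exp (a * |u|) ≤ Real.exp (a * u) + Real.exp (-a * u) := by
      rcases abs_cases u with ⟨h, _⟩ | ⟨h, _⟩ <;> rw [h]
      · linarith [Real.exp_pos (-a * u)]
      · rw [mul_neg, ← neg_mul]; linarith [Real.exp_pos (a * u)]
    nlinarith [Real.exp_pos (a * (lam * √T))]
  refine ⟨(∫ u, 24 * Real.exp (a * (|u| + lam * √T)) ∂(gaussianReal 0 1)) + 1, ?_, ?_⟩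
  · have : 0 ≤ ∫ u, 24 * Real.exp (a * (|u| + lam * √T)) ∂(gaussianReal 0 1) :=
      integral_nonneg fun u => by positivity
    linarith
  intro d hd hdT q hq f D hD hf
  set bd : ℝ → ℝ := fun x => D * ((|x| + lam * d) ^ (2 * q) * Real.exp (C * (|x| + lam * d)))
  have hmap : gaussianReal 0 d.toNNReal = (gaussianReal 0 1).map (√d * ·) := by
    rw [gaussianReal_map_const_mul]
    congr 1
    · simp
    · ext
      simp [Real.coe_toNNReal _ hd, Real.sq_sqrt hd]
  have hbc : Continuous bd := by fun_prop
  have hpt : ∀ u : ℝ, bd (√d * u) ≤ D * (d ^ q * (24 * Real.exp (a * (|u| + lam * √T)))) := by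
    intro u
    simp only [bd]
    set w := |u| + lam * √T with hw
    have hw0 : 0 ≤ w := by positivity
    have hsT : √d ≤ √T := Real.sqrt_le_sqrt hdT
    have hr : |√d * u| + lam * d ≤ √d * w := by
      rw [abs_mul, abs_of_nonneg (Real.sqrt_nonneg d), hw, mul_add]
      have : lam * d ≤ √d * (lam * √T) := by
        calc lam * d = lam * (√d * √d) := by rw [Real.mul_self_sqrt hd]
          _ ≤ lam * (√d * √T) := by gcongr
          _ = _ := by ring
      linarith
    have h0 : 0 ≤ |√d * u| + lam * d := by positivity
    apply mul_le_mul_of_nonneg_left _ hD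
    have e1 : (√d * w) ^ (2 * q) = d ^ q * w ^ (2 * q) := by
      rw [mul_pow, pow_mul √d, Real.sq_sqrt hd]
    have e2 : w ^ (2 * q) ≤ 24 * Real.exp w := by
      rcases hq with rfl | rfl
      · have := Real.pow_div_factorial_le_exp w hw0 2
        norm_num [Nat.factorial] at this
        have := Real.exp_pos w
        simp only [mul_one]; linarith
      · have := Real.pow_div_factorial_le_exp w hw0 4
        norm_num [Nat.factorial] at this ⊢
        linarith
    calc _ ≤ (√d * w) ^ (2 * q) * Real.exp (C * (√T * w)) := by
          gcongr
          exact hr.trans (by gcongr)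
      _ ≤ d ^ q * (24 * Real.exp w) * Real.exp (C * (√T * w)) := by
          rw [e1]; gcongr
      _ = _ := by
          have e3 : Real.exp (a * w) = Real.exp w * Real.exp (C * (√T * w)) := by
            rw [← Real.exp_add]; congr 1; rw [ha]; ring
          rw [e3]; ring
  have hbi1 : Integrable (fun u => bd (√d * u)) (gaussianReal 0 1) := by
    refine ((hintg.const_mul (d ^ q)).const_mul D).mono' (by fun_prop) (ae_of_all _ fun u => ?_)
    rw [Real.norm_of_nonneg (by simp only [bd]; positivity)]
    exact hpt u
  have hbi : Integrable bd (gaussianReal 0 d.toNNReal) := by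
    rw [hmap]
    exact (integrable_map_measure hbc.aestronglyMeasurable (by fun_prop)).2 hbi1
  calc _ ≤ ∫ x, bd x ∂(gaussianReal 0 d.toNNReal) :=
        norm_integral_le_of_norm_le hbi (ae_of_all _ hf)
    _ = ∫ u, bd (√d * u) ∂(gaussianReal 0 1) := by
        rw [hmap, integral_map (by fun_prop) hbc.aestronglyMeasurable]
    _ ≤ ∫ u, D * (d ^ q * (24 * Real.exp (a * (|u| + lam * √T)))) ∂(gaussianReal 0 1) :=
        integral_mono hbi1 ((hintg.const_mul (d ^ q)).const_mul D) hpt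
    _ = D * (d ^ q * ∫ u, (24 * Real.exp (a * (|u| + lam * √T))) ∂(gaussianReal 0 1)) := by
        rw [integral_const_mul, integral_const_mul]
    _ ≤ _ := by
        apply mul_le_mul_of_nonneg_left _ hD
        have : 0 ≤ d ^ q := by positivity
        nlinarith

end tf

section onestep
variable {A₁ A₂ α₁ α₂ τ : ℂ}

lemma gexp_norm (w : ℂ) (x : ℝ) : ‖Complex.exp (w * x)‖ = Real.exp (w.re * x) := by
  rw [Complex.norm_exp]; simp

lemma gexp_int (v : NNReal) (w : ℂ) :
    Integrable (fun x : ℝ => Complex.exp (w * x)) (gaussianReal 0 v) := by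
  refine (integrable_exp_mul_gaussianReal w.re).mono' (by fun_prop) (ae_of_all _ fun x => ?_)
  rw [gexp_norm]

lemma gexp_val (v : NNReal) (w : ℂ) :
    ∫ x : ℝ, Complex.exp (w * x) ∂(gaussianReal 0 v) = Complex.exp (v * w ^ 2 / 2) := by
  have := complexMGF_id_gaussianReal (μ := 0) (v := v) w
  rw [complexMGF] at this
  simpa using this

lemma exp_lip (w : ℂ) : ‖Complex.exp w - 1‖ ≤ ‖w‖ * Real.exp ‖w‖ := by
  simpa using Complex.norm_exp_sub_sum_le_norm_mul_exp w 1

lemma onestep_exact (c s α : ℂ) (lam η : ℝ) {d : ℝ} (hd : 0 ≤ d) (x : ℝ) :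
    Complex.exp (s * d) * ∫ g : ℝ, Complex.exp (c * g) *
      Complex.exp (α * (x + η * (g - lam * d) : ℝ)) ∂(gaussianReal 0 d.toNNReal) =
    Complex.exp (α * x) * Complex.exp (d * (s - η * α * lam + (c + η * α) ^ 2 / 2)) := by
  have e : ∀ g : ℝ, Complex.exp (c * g) * Complex.exp (α * (x + η * (g - lam * d) : ℝ)) =
      Complex.exp (α * x - η * α * lam * d) * Complex.exp ((c + η * α) * g) := by
    intro g
    rw [← Complex.exp_add, ← Complex.exp_add]
    congr 1; push_cast; ring
  simp_rw [e]
  rw [integral_const_mul, gexp_val, ← Complex.exp_add, ← Complex.exp_add, ← Complex.exp_add]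
  congr 1
  rw [show ((d.toNNReal : NNReal) : ℂ) = (d : ℂ) by
    exact congrArg Complex.ofReal (Real.coe_toNNReal _ hd)]
  ring

lemma onestep_int (c α : ℂ) (lam η : ℝ) (v : NNReal) (d : ℝ) (x : ℝ) :
    Integrable (fun g : ℝ => Complex.exp (c * g) *
      Complex.exp (α * (x + η * (g - lam * d) : ℝ))) (gaussianReal 0 v) := by
  have e : ∀ g : ℝ, Complex.exp (c * g) * Complex.exp (α * (x + η * (g - lam * d) : ℝ)) =
      Complex.exp (α * x - η * α * lam * d) * Complex.exp ((c + η * α) * g) := by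
    intro g
    rw [← Complex.exp_add, ← Complex.exp_add]
    congr 1; push_cast; ring
  simp_rw [e]
  exact (gexp_int _ _).const_mul _

lemma TF.step_int (h : TF A₁ A₂ α₁ α₂ τ) (c : ℂ) (lam η : ℝ) (v : NNReal) (d : ℝ) (x : ℝ) :
    Integrable (fun g : ℝ => Complex.exp (c * g) *
      PF A₁ A₂ α₁ α₂ τ (x + η * (g - lam * d))) (gaussianReal 0 v) := by
  have h1 := (gexp_int v c).bdd_mul (c := ‖A₁‖ + ‖A₂‖)
    (f := fun g : ℝ => PF A₁ A₂ α₁ α₂ τ (x + η * (g - lam * d)))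
    ((h.PF_continuous.comp (by fun_prop)).aestronglyMeasurable) (ae_of_all _ fun g => h.PF_bound _)
  simpa [mul_comm] using h1

lemma TF.onestep_nonneg (h : TF A₁ A₂ α₁ α₂ τ) (c s : ℂ) (lam T : ℝ) (hl : 0 ≤ lam) (hT : 0 ≤ T)
    (e1 : s - α₁ * lam + (c + α₁) ^ 2 / 2 = 0) (e2 : s - α₂ * lam + (c + α₂) ^ 2 / 2 = 0) :
    ∃ K : ℝ, 0 < K ∧ ∀ d : ℝ, 0 ≤ d → d ≤ T → ∀ x : ℝ, 0 ≤ x → ∀ η : ℝ, η = 1 ∨ η = -1 →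
      ‖Complex.exp (s * d) * (∫ g : ℝ, Complex.exp (c * g) *
        PF A₁ A₂ α₁ α₂ τ (x + η * (g - lam * d)) ∂(gaussianReal 0 d.toNNReal))
        - PF A₁ A₂ α₁ α₂ τ x‖ ≤ K * d ∧
      (0 < x → η = 1 → ‖Complex.exp (s * d) * (∫ g : ℝ, Complex.exp (c * g) *
        PF A₁ A₂ α₁ α₂ τ (x + η * (g - lam * d)) ∂(gaussianReal 0 d.toNNReal))
        - PF A₁ A₂ α₁ α₂ τ x‖ ≤ K * d ^ 2 / x ^ 2) := by
  obtain ⟨C, hC, hcross⟩ := h.cross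
  obtain ⟨K₀, hK₀, hgm⟩ := gauss_moment (C + ‖c‖) lam T (by positivity) hl hT
  set E := Real.exp (‖s‖ * T) with hE
  let Sm : ℂ → ℂ := fun α => s - (-1 : ℝ) * α * lam + (c + (-1 : ℝ) * α) ^ 2 / 2
  let Q : ℂ → ℝ := fun α => ‖Sm α‖ * Real.exp (T * ‖Sm α‖)
  set K := E * (C * K₀) + (‖A₁‖ * Q α₁ + ‖A₂‖ * Q α₂) + 1 with hK
  have hQ : ∀ α, 0 ≤ Q α := fun α => by positivity
  have hQQ : 0 ≤ ‖A₁‖ * Q α₁ + ‖A₂‖ * Q α₂ := by have := hQ α₁; have := hQ α₂; positivity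
  have hEC : 0 < E * (C * K₀) := by positivity
  refine ⟨K, by positivity, fun d hd hdT x hx η hη => ?_⟩
  set γ := gaussianReal 0 d.toNNReal
  have ipf : Integrable (fun g : ℝ => Complex.exp (c * g) *
      pf A₁ A₂ α₁ α₂ (x + η * (g - lam * d))) γ := by
    have := ((onestep_int c α₁ lam η d.toNNReal d x).const_mul A₁).add
      ((onestep_int c α₂ lam η d.toNNReal d x).const_mul A₂)
    refine this.congr (ae_of_all _ fun g => ?_)
    simp only [Pi.add_apply, pf]; ring
  have iPF := h.step_int c lam η d.toNNReal d x
  have vpf : Complex.exp (s * d) * ∫ g : ℝ, Complex.exp (c * g) *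
      pf A₁ A₂ α₁ α₂ (x + η * (g - lam * d)) ∂γ =
      A₁ * (Complex.exp (α₁ * x) * Complex.exp (d * (s - η * α₁ * lam + (c + η * α₁) ^ 2 / 2))) +
      A₂ * (Complex.exp (α₂ * x) * Complex.exp (d * (s - η * α₂ * lam + (c + η * α₂) ^ 2 / 2))) := by
    rw [← onestep_exact c s α₁ lam η hd x, ← onestep_exact c s α₂ lam η hd x]
    have : ∀ g : ℝ, Complex.exp (c * g) * pf A₁ A₂ α₁ α₂ (x + η * (g - lam * d)) =
      A₁ * (Complex.exp (c * g) * Complex.exp (α₁ * (x + η * (g - lam * d) : ℝ))) +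
      A₂ * (Complex.exp (c * g) * Complex.exp (α₂ * (x + η * (g - lam * d) : ℝ))) := by
      intro g; simp only [pf]; ring
    simp_rw [this]
    rw [integral_add ((onestep_int c α₁ lam η d.toNNReal d x).const_mul A₁)
      ((onestep_int c α₂ lam η d.toNNReal d x).const_mul A₂), integral_const_mul,
      integral_const_mul]
    ring
  set f : ℝ → ℂ := fun g => Complex.exp (c * g) * (PF A₁ A₂ α₁ α₂ τ (x + η * (g - lam * d)) -
    pf A₁ A₂ α₁ α₂ (x + η * (g - lam * d))) with hf
  have hdec : ∫ g : ℝ, Complex.exp (c * g) *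
        PF A₁ A₂ α₁ α₂ τ (x + η * (g - lam * d)) ∂γ = ∫ g, f g ∂γ +
        ∫ g : ℝ, Complex.exp (c * g) * pf A₁ A₂ α₁ α₂ (x + η * (g - lam * d)) ∂γ := by
    rw [← sub_eq_iff_eq_add, ← integral_sub iPF ipf]
    refine integral_congr_ae (ae_of_all _ fun g => ?_)
    simp only [hf]; ring
  -- pointwise bounds
  have hcb : ∀ g : ℝ, f g = 0 ∨ (x ≤ |g| + lam * d ∧
      ‖f g‖ ≤ C * ((|g| + lam * d) ^ 2 * Real.exp ((C + ‖c‖) * (|g| + lam * d)))) := by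
    intro g
    set v := x + η * (g - lam * d) with hv
    rcases le_or_gt 0 v with hv0 | hv0
    · left
      simp only [hf]
      rw [h.PF_nonneg hv0, sub_self, mul_zero]
    · right
      have hab : |η * (g - lam * d)| ≤ |g| + lam * d := by
        have : |η| = 1 := by rcases hη with rfl | rfl <;> simp
        rw [abs_mul, this, one_mul]
        refine (abs_sub _ _).trans ?_
        rw [abs_of_nonneg (by positivity : 0 ≤ lam * d)]
      rw [abs_le] at hab
      have hvr : |v| ≤ |g| + lam * d := by
        rw [abs_of_neg hv0]; linarith
      refine ⟨by linarith, ?_⟩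
      simp only [hf]
      rw [norm_mul]
      have b1 : ‖Complex.exp (c * g)‖ ≤ Real.exp (‖c‖ * (|g| + lam * d)) := by
        refine (Complex.norm_exp_le_exp_norm _).trans ?_
        rw [norm_mul, Complex.norm_real, Real.norm_eq_abs]
        apply Real.exp_le_exp.2
        have : 0 ≤ lam * d := by positivity
        gcongr; linarith
      have b2 : ‖PF A₁ A₂ α₁ α₂ τ v - pf A₁ A₂ α₁ α₂ v‖ ≤
          C * ((|g| + lam * d) ^ 2 * Real.exp (C * (|g| + lam * d))) := by
        refine (hcross v hv0.le).trans ?_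
        rw [← sq_abs v]
        gcongr
      calc _ ≤ Real.exp (‖c‖ * (|g| + lam * d)) *
          (C * ((|g| + lam * d) ^ 2 * Real.exp (C * (|g| + lam * d)))) := by gcongr
        _ = _ := by rw [add_mul C, Real.exp_add]; ring
  have hexp : ‖Complex.exp (s * d)‖ ≤ E := by
    refine (Complex.norm_exp_le_exp_norm _).trans ?_
    rw [norm_mul, Complex.norm_real, Real.norm_of_nonneg hd, hE]
    gcongr
  have hI1 : ‖∫ g, f g ∂γ‖ ≤ C * (K₀ * d ^ 1) := by
    refine hgm d hd hdT 1 (Or.inl rfl) f C hC.le fun g => ?_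
    rcases hcb g with h0 | ⟨_, h1⟩
    · rw [h0, norm_zero]; positivity
    · simpa using h1
  rw [hdec, mul_add, vpf, h.PF_nonneg hx]
  have hmain : ∀ α : ℂ, s - α * lam + (c + α) ^ 2 / 2 = 0 → α.re ≤ 0 →
      ‖Complex.exp (α * x) * Complex.exp (d * (s - η * α * lam + (c + η * α) ^ 2 / 2)) -
        Complex.exp (α * x)‖ ≤ Q α * d := by
    intro α hα hr
    rcases hη with rfl | rfl
    · have : s - ((1:ℝ):ℂ) * α * lam + (c + ((1:ℝ):ℂ) * α) ^ 2 / 2 = 0 := by simpa using hα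
      rw [this, mul_zero, Complex.exp_zero, mul_one, sub_self, norm_zero]
      have := hQ α; positivity
    · have : Complex.exp (α * x) * Complex.exp (d * Sm α) -
        Complex.exp (α * x) = Complex.exp (α * x) * (Complex.exp (d * Sm α) - 1) := by ring
      change ‖Complex.exp (α * x) * Complex.exp (d * Sm α) - Complex.exp (α * x)‖ ≤ _
      rw [this, norm_mul]
      have q1 := norm_exp_le_one hr hx
      have q2 := exp_lip (d * Sm α)
      rw [norm_mul, Complex.norm_real, Real.norm_of_nonneg hd] at q2
      calc _ ≤ 1 * (d * ‖Sm α‖ * Real.exp (d * ‖Sm α‖)) := by gcongr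
        _ ≤ 1 * (d * ‖Sm α‖ * Real.exp (T * ‖Sm α‖)) := by gcongr
        _ = _ := by simp only [Q]; ring
  constructor
  · have m1 := hmain α₁ e1 h.r1
    have m2 := hmain α₂ e2 h.r2
    set X₁ := Complex.exp (α₁ * x) * Complex.exp (d * (s - η * α₁ * lam + (c + η * α₁) ^ 2 / 2))
    set X₂ := Complex.exp (α₂ * x) * Complex.exp (d * (s - η * α₂ * lam + (c + η * α₂) ^ 2 / 2))
    have : Complex.exp (s * d) * ∫ g, f g ∂γ + (A₁ * X₁ + A₂ * X₂) - pf A₁ A₂ α₁ α₂ x =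
      Complex.exp (s * d) * ∫ g, f g ∂γ + (A₁ * (X₁ - Complex.exp (α₁ * x)) +
        A₂ * (X₂ - Complex.exp (α₂ * x))) := by simp only [pf]; ring
    rw [this]
    calc _ ≤ E * (C * (K₀ * d ^ 1)) + (‖A₁‖ * (Q α₁ * d) + ‖A₂‖ * (Q α₂ * d)) := by
          refine (norm_add_le _ _).trans (add_le_add ?_ ((norm_add_le _ _).trans
            (add_le_add ?_ ?_))) <;> rw [norm_mul] <;> gcongr
      _ ≤ K * d := by rw [hK]; nlinarith
  · intro hx0 h1
    subst h1
    have s1 : s - ((1:ℝ):ℂ) * α₁ * lam + (c + ((1:ℝ):ℂ) * α₁) ^ 2 / 2 = 0 := by simpa using e1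
    have s2 : s - ((1:ℝ):ℂ) * α₂ * lam + (c + ((1:ℝ):ℂ) * α₂) ^ 2 / 2 = 0 := by simpa using e2
    rw [s1, s2]
    simp only [mul_zero, Complex.exp_zero, mul_one]
    have hI2 : ‖∫ g, f g ∂γ‖ ≤ C / x ^ 2 * (K₀ * d ^ 2) := by
      refine hgm d hd hdT 2 (Or.inr rfl) f _ (by positivity) fun g => ?_
      rcases hcb g with h0 | ⟨hr, h1⟩
      · rw [h0, norm_zero]; positivity
      · refine h1.trans ?_
        have q : (1 : ℝ) ≤ (|g| + lam * d) ^ 2 / x ^ 2 := by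
          rw [le_div_iff₀ (by positivity), one_mul]; gcongr
        calc _ ≤ (C * ((|g| + lam * d) ^ 2 * Real.exp ((C + ‖c‖) * (|g| + lam * d)))) *
              ((|g| + lam * d) ^ 2 / x ^ 2) := by
                apply le_mul_of_one_le_right _ q; positivity
          _ = _ := by ring
    have : Complex.exp (s * d) * ∫ g, f g ∂γ + (A₁ * Complex.exp (α₁ * x) +
      A₂ * Complex.exp (α₂ * x)) - pf A₁ A₂ α₁ α₂ x = Complex.exp (s * d) * ∫ g, f g ∂γ := by
      simp only [pf]; ring
    rw [this, norm_mul]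
    calc _ ≤ E * (C / x ^ 2 * (K₀ * d ^ 2)) := by gcongr
      _ = E * (C * K₀) * d ^ 2 / x ^ 2 := by ring
      _ ≤ _ := by
        gcongr
        rw [hK]; linarith

lemma TF.onestep (h : TF A₁ A₂ α₁ α₂ τ) (c s : ℂ) (lam T : ℝ) (hl : 0 ≤ lam) (hT : 0 ≤ T)
    (e1 : s - α₁ * lam + (c + α₁) ^ 2 / 2 = 0) (e2 : s - α₂ * lam + (c + α₂) ^ 2 / 2 = 0) :
    ∃ K : ℝ, 0 < K ∧ ∀ d : ℝ, 0 ≤ d → d ≤ T → ∀ x : ℝ, ∀ η : ℝ, η = 1 ∨ η = -1 →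
      ‖Complex.exp (s * d) * (∫ g : ℝ, Complex.exp (c * g) *
        PF A₁ A₂ α₁ α₂ τ (x + η * (g - lam * d)) ∂(gaussianReal 0 d.toNNReal))
        - PF A₁ A₂ α₁ α₂ τ x‖ ≤ K * d ∧
      (0 < η * x → ‖Complex.exp (s * d) * (∫ g : ℝ, Complex.exp (c * g) *
        PF A₁ A₂ α₁ α₂ τ (x + η * (g - lam * d)) ∂(gaussianReal 0 d.toNNReal))
        - PF A₁ A₂ α₁ α₂ τ x‖ ≤ K * d ^ 2 / x ^ 2) := by
  obtain ⟨K, hK, H⟩ := h.onestep_nonneg c s lam T hl hT e1 e2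
  refine ⟨K, hK, fun d hd hdT x η hη => ?_⟩
  rcases le_or_gt 0 x with hx | hx
  · obtain ⟨H1, H2⟩ := H d hd hdT x hx η hη
    refine ⟨H1, fun hp => H2 ?_ ?_⟩
    · rcases hx.eq_or_lt with rfl | hx
      · simp at hp
      · exact hx
    · rcases hη with rfl | rfl
      · rfl
      · linarith
  · obtain ⟨H1, H2⟩ := H d hd hdT (-x) (by linarith) (-η) (by
      rcases hη with rfl | rfl
      · right; rfl
      · left; norm_num)
    have e : ∀ g : ℝ, Complex.exp (c * g) * PF A₁ A₂ α₁ α₂ τ (-x + -η * (g - lam * d)) =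
        τ * (Complex.exp (c * g) * PF A₁ A₂ α₁ α₂ τ (x + η * (g - lam * d))) := by
      intro g
      rw [show -x + -η * (g - lam * d) = -(x + η * (g - lam * d)) by ring, h.PF_neg]; ring
    simp_rw [e, h.PF_neg, integral_const_mul] at H1 H2
    have e' : ∀ I : ℂ, Complex.exp (s * d) * (τ * I) - τ * PF A₁ A₂ α₁ α₂ τ x =
      τ * (Complex.exp (s * d) * I - PF A₁ A₂ α₁ α₂ τ x) := fun I => by ring
    rw [e', norm_mul, h.norm_tau, one_mul, neg_sq] at H2
    rw [e', norm_mul, h.norm_tau, one_mul] at H1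
    refine ⟨H1, fun hp => H2 (by linarith) ?_⟩
    rcases hη with rfl | rfl
    · linarith
    · norm_num

end onestep

lemma vitali2 [IsProbabilityMeasure μ] {V : ℕ → Ω → ℂ} {U : Ω → ℂ} {M : ℝ} (hM : 0 ≤ M)
    (hV : ∀ n, Measurable (V n)) (hb : ∀ n, ∫⁻ ω, ENNReal.ofReal (‖V n ω‖ ^ 2) ∂μ ≤ ENNReal.ofReal M)
    (hl : ∀ᵐ ω ∂μ, Tendsto (fun n => V n ω) atTop (nhds (U ω))) :
    Integrable U μ ∧ Tendsto (fun n => ∫ ω, V n ω ∂μ) atTop (nhds (∫ ω, U ω ∂μ)) := by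
  have hUI : UniformIntegrable V 1 μ := by
    refine uniformIntegrable_of le_rfl ENNReal.one_ne_top (fun n => (hV n).aestronglyMeasurable) ?_
    intro ε hε
    refine ⟨(M / ε + 1).toNNReal, fun n => ?_⟩
    have hC : 0 < M / ε + 1 := by positivity
    rw [eLpNorm_one_eq_lintegral_enorm]
    have : ∀ ω, ‖({x | (M / ε + 1).toNNReal ≤ ‖V n x‖₊}.indicator (V n)) ω‖ₑ ≤
        ENNReal.ofReal (1 / (M / ε + 1)) * ENNReal.ofReal (‖V n ω‖ ^ 2) := by
      intro ω
      by_cases hω : ω ∈ {x | (M / ε + 1).toNNReal ≤ ‖V n x‖₊}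
      · rw [indicator_of_mem hω, ← ENNReal.ofReal_mul (by positivity), ← ofReal_norm]
        apply ENNReal.ofReal_le_ofReal
        have h1 : (M / ε + 1).toNNReal ≤ ‖V n ω‖₊ := hω
        have h2 : M / ε + 1 ≤ ‖V n ω‖ := by
          have := NNReal.coe_le_coe.2 h1
          rwa [Real.coe_toNNReal _ hC.le] at this
        rw [one_div, inv_mul_eq_div, le_div_iff₀ hC]
        nlinarith [norm_nonneg (V n ω)]
      · rw [indicator_of_notMem hω]; simp
    refine (lintegral_mono this).trans ?_
    rw [lintegral_const_mul' _ _ ENNReal.ofReal_ne_top]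
    refine (mul_le_mul_right (hb n) _).trans ?_
    rw [← ENNReal.ofReal_mul (by positivity)]
    apply ENNReal.ofReal_le_ofReal
    rw [one_div, inv_mul_eq_div, div_le_iff₀ hC]
    have : ε * (M / ε + 1) = M + ε := by field_simp
    linarith
  have htm := tendstoInMeasure_of_tendsto_ae (fun n => (hV n).aestronglyMeasurable) hl
  have hmem : MemLp U 1 μ := hUI.memLp_of_tendstoInMeasure htm
  refine ⟨memLp_one_iff_integrable.1 hmem, ?_⟩
  refine tendsto_integral_of_L1' U hmem.1 (Eventually.of_forall fun n =>
    memLp_one_iff_integrable.1 (hUI.memLp n)) ?_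
  exact tendsto_Lp_finite_of_tendsto_ae le_rfl ENNReal.one_ne_top
    (fun n => (hV n).aestronglyMeasurable) hmem hUI.unifIntegrable hl

def sg (Y : ℝ → Ω → ℝ) (u : ℝ) (ω : Ω) : ℝ := if Y u ω ≤ 0 then -1 else 1

lemma sg_cases (Y : ℝ → Ω → ℝ) (u : ℝ) (ω : Ω) : sg Y u ω = 1 ∨ sg Y u ω = -1 := by
  unfold sg; split_ifs <;> simp

def Wh (B₁ B₂ Y : ℝ → Ω → ℝ) (d : ℝ) (j : ℕ) (ω : Ω) : ℝ :=
  ∑ k ∈ Finset.range j, ginc B₁ B₂ Y d k ω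

lemma Wh_succ (d : ℝ) (j : ℕ) (ω : Ω) :
    Wh B₁ B₂ Y d (j + 1) ω = Wh B₁ B₂ Y d j ω + ginc B₁ B₂ Y d j ω := by
  simp [Wh, Finset.sum_range_succ]

lemma Yh_eq (d : ℝ) (j : ℕ) (ω : Ω) :
    Yh B₁ B₂ Y lam y d j ω = y + ∑ k ∈ Finset.range j, sg Y (d * k) ω *
      (ginc B₁ B₂ Y d k ω - lam * d) := by
  rw [Yh, J_sub, add_assoc, ← Finset.sum_add_distrib]
  congr 1
  refine Finset.sum_congr rfl fun k _ => ?_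
  unfold hdr winc sg ginc
  split_ifs <;> ring

lemma Yh_succ (d : ℝ) (j : ℕ) (ω : Ω) :
    Yh B₁ B₂ Y lam y d (j + 1) ω = Yh B₁ B₂ Y lam y d j ω + sg Y (d * j) ω *
      (ginc B₁ B₂ Y d j ω - lam * d) := by
  rw [Yh_eq, Yh_eq, Finset.sum_range_succ]; ring

lemma Ctx.sg_meas (h : Ctx μ F B₁ B₂ Y I₁ I₂ lam y) {u : ℝ} (hu : 0 ≤ u) :
    Measurable[F u] (sg Y u) :=
  Measurable.ite (h.leSet hu) measurable_const measurable_const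

lemma Ctx.Wh_meas (h : Ctx μ F B₁ B₂ Y I₁ I₂ lam y) {d : ℝ} (hd : 0 ≤ d) (j : ℕ) :
    Measurable[F (d * j)] (Wh B₁ B₂ Y d j) :=
  sum_meas (F := fun k : ℕ => F (d * k))
    (fun _ _ hij => h.bm₁.mono (grid_mono hd hij)) (h.ginc_meas hd) j

lemma Ctx.Yh_meas (h : Ctx μ F B₁ B₂ Y I₁ I₂ lam y) {d : ℝ} (hd : 0 ≤ d) (j : ℕ) :
    Measurable[F (d * j)] (Yh B₁ B₂ Y lam y d j) := by
  have := sum_meas (F := fun k : ℕ => F (d * k))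
    (fun _ _ hij => h.bm₁.mono (grid_mono hd hij))
    (G := fun k ω => sg Y (d * k) ω * (ginc B₁ B₂ Y d k ω - lam * d)) (fun k => by
      refine Measurable.mul ?_ ((h.ginc_meas hd k).sub measurable_const)
      exact (h.sg_meas (grid_nonneg hd k)).mono (h.bm₁.mono (grid_mono hd k.le_succ)) le_rfl) j
  have e : Yh B₁ B₂ Y lam y d j = fun ω => y + ∑ k ∈ Finset.range j, sg Y (d * k) ω *
      (ginc B₁ B₂ Y d k ω - lam * d) := by
    ext ω; exact Yh_eq d j ω
  rw [e]
  exact measurable_const.add this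

lemma Ctx.Wh_map [IsProbabilityMeasure μ] (h : Ctx μ F B₁ B₂ Y I₁ I₂ lam y) {d : ℝ} (hd : 0 ≤ d)
    (j : ℕ) : μ.map (Wh B₁ B₂ Y d j) = gaussianReal 0 (j * d.toNNReal) := by
  have S1 := CG.sum (μ := μ) (F := fun k => F (d * k)) (fun _ => h.bm₁.le _)
    (fun i j hij => h.bm₁.mono (grid_mono hd hij)) (h.ginc_CG hd) (h.ginc_meas hd) 0 j
  have := S1.2.map_eq
  have e : Wh B₁ B₂ Y d j = fun ω => ∑ k ∈ Finset.range j, ginc B₁ B₂ Y d k ω := rfl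
  rw [e]
  simpa using this

lemma Ctx.Wh_measm (h : Ctx μ F B₁ B₂ Y I₁ I₂ lam y) {d : ℝ} (hd : 0 ≤ d) (j : ℕ) :
    Measurable (Wh B₁ B₂ Y d j) := (h.Wh_meas hd j).mono (h.bm₁.le _) le_rfl

lemma Ctx.Yh_measm (h : Ctx μ F B₁ B₂ Y I₁ I₂ lam y) {d : ℝ} (hd : 0 ≤ d) (j : ℕ) :
    Measurable (Yh B₁ B₂ Y lam y d j) := (h.Yh_meas hd j).mono (h.bm₁.le _) le_rfl

lemma Ctx.Wh_exp [IsProbabilityMeasure μ] (h : Ctx μ F B₁ B₂ Y I₁ I₂ lam y) {d t : ℝ} (hd : 0 ≤ d)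
    (j : ℕ) (hj : d * j ≤ t) (a : ℝ) :
    Integrable (fun ω => Real.exp (a * Wh B₁ B₂ Y d j ω)) μ ∧
    ∫ ω, Real.exp (a * Wh B₁ B₂ Y d j ω) ∂μ ≤ Real.exp (a ^ 2 * t / 2) := by
  have hm := h.Wh_measm hd j
  have hc : Continuous (fun x : ℝ => Real.exp (a * x)) := by fun_prop
  constructor
  · have := integrable_exp_mul_gaussianReal (μ := 0) (v := j * d.toNNReal) a
    rw [← h.Wh_map hd j] at this
    exact (integrable_map_measure hc.aestronglyMeasurable hm.aemeasurable).1 this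
  · have h1 : ∫ ω, Real.exp (a * Wh B₁ B₂ Y d j ω) ∂μ =
        ∫ x, Real.exp (a * x) ∂(gaussianReal 0 (j * d.toNNReal)) := by
      rw [← h.Wh_map hd j, integral_map hm.aemeasurable hc.aestronglyMeasurable]
    have h2 := mgf_gaussianReal (p := gaussianReal 0 (j * d.toNNReal)) (X := id)
      (μ := 0) (v := j * d.toNNReal) (by simp) a
    rw [mgf] at h2
    simp only [id] at h2
    rw [h1, h2]
    apply Real.exp_le_exp.2
    push_cast
    rw [Real.coe_toNNReal _ hd]
    nlinarith [sq_nonneg a]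

section sums
variable {A₁ A₂ α₁ α₂ τ : ℂ}

def Uh (B₁ B₂ Y : ℝ → Ω → ℝ) (lam y : ℝ) (A₁ A₂ α₁ α₂ τ c s : ℂ) (d : ℝ) (j : ℕ) (ω : Ω) : ℂ :=
  Complex.exp (s * (d * j : ℝ) + c * (Wh B₁ B₂ Y d j ω : ℝ)) *
    PF A₁ A₂ α₁ α₂ τ (Yh B₁ B₂ Y lam y d j ω)

lemma expnorm (s c : ℂ) {r t : ℝ} (hr : 0 ≤ r) (hrt : r ≤ t) (w : ℝ) :
    ‖Complex.exp (s * r + c * w)‖ ≤ Real.exp (‖s‖ * t) * Real.exp (c.re * w) := by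
  rw [Complex.exp_add, norm_mul, gexp_norm c]
  gcongr
  rw [gexp_norm]
  apply Real.exp_le_exp.2
  calc s.re * r ≤ ‖s‖ * r := by gcongr; exact Complex.re_le_norm s
    _ ≤ _ := by gcongr

lemma Ctx.Uh_meas (h : Ctx μ F B₁ B₂ Y I₁ I₂ lam y) (hP : TF A₁ A₂ α₁ α₂ τ)
    (c s : ℂ) {d : ℝ} (hd : 0 ≤ d) (j : ℕ) :
    Measurable (Uh B₁ B₂ Y lam y A₁ A₂ α₁ α₂ τ c s d j) := by
  have h1 := h.Wh_measm hd j
  have h2 := h.Yh_measm hd j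
  have h3 := hP.PF_continuous.measurable.comp h2
  unfold Uh
  refine Measurable.mul ?_ h3
  fun_prop

lemma Ctx.Uh_norm (hP : TF A₁ A₂ α₁ α₂ τ)
    (c s : ℂ) {d t : ℝ} (hd : 0 ≤ d) (j : ℕ) (hj : d * j ≤ t) (ω : Ω) :
    ‖Uh B₁ B₂ Y lam y A₁ A₂ α₁ α₂ τ c s d j ω‖ ≤
      Real.exp (‖s‖ * t) * (‖A₁‖ + ‖A₂‖) * Real.exp (c.re * Wh B₁ B₂ Y d j ω) := by
  unfold Uh
  rw [norm_mul]
  have h1 := expnorm s c (grid_nonneg hd j) hj (Wh B₁ B₂ Y d j ω)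
  have h2 := hP.PF_bound (Yh B₁ B₂ Y lam y d j ω)
  calc _ ≤ Real.exp (‖s‖ * t) * Real.exp (c.re * Wh B₁ B₂ Y d j ω) * (‖A₁‖ + ‖A₂‖) := by
        gcongr
    _ = _ := by ring

lemma Ctx.Uh_int [IsProbabilityMeasure μ] (h : Ctx μ F B₁ B₂ Y I₁ I₂ lam y)
    (hP : TF A₁ A₂ α₁ α₂ τ) (c s : ℂ) {d : ℝ} (hd : 0 ≤ d) (j : ℕ) :
    Integrable (Uh B₁ B₂ Y lam y A₁ A₂ α₁ α₂ τ c s d j) μ := by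
  refine ((h.Wh_exp hd j le_rfl c.re).1.const_mul
    (Real.exp (‖s‖ * (d * j)) * (‖A₁‖ + ‖A₂‖))).mono'
    (h.Uh_meas hP c s hd j).aestronglyMeasurable (ae_of_all _ fun ω => ?_)
  exact Ctx.Uh_norm hP c s hd j le_rfl ω

lemma Ctx.Uh_step [IsProbabilityMeasure μ] (h : Ctx μ F B₁ B₂ Y I₁ I₂ lam y)
    (hP : TF A₁ A₂ α₁ α₂ τ) (c s : ℂ) {t K : ℝ} (hK : 0 < K) {d : ℝ} (hd : 0 ≤ d)
    (H : ∀ x : ℝ, ∀ η : ℝ, η = 1 ∨ η = -1 →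
      ‖Complex.exp (s * d) * (∫ g : ℝ, Complex.exp (c * g) *
        PF A₁ A₂ α₁ α₂ τ (x + η * (g - lam * d)) ∂(gaussianReal 0 d.toNNReal))
        - PF A₁ A₂ α₁ α₂ τ x‖ ≤ K * d ∧
      (0 < η * x → ‖Complex.exp (s * d) * (∫ g : ℝ, Complex.exp (c * g) *
        PF A₁ A₂ α₁ α₂ τ (x + η * (g - lam * d)) ∂(gaussianReal 0 d.toNNReal))
        - PF A₁ A₂ α₁ α₂ τ x‖ ≤ K * d ^ 2 / x ^ 2))
    (j : ℕ) (hj : d * j ≤ t) {e δ : ℝ} (he : 0 < e) (hδ : 0 < δ) :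
    ‖(∫ ω, Uh B₁ B₂ Y lam y A₁ A₂ α₁ α₂ τ c s d (j + 1) ω ∂μ) -
      ∫ ω, Uh B₁ B₂ Y lam y A₁ A₂ α₁ α₂ τ c s d j ω ∂μ‖ ≤
      Real.exp (‖s‖ * t) * K * d * (e * Real.exp (2 * c.re ^ 2 * t) +
        e⁻¹ * μ.real {ω | sg Y (d * j) ω * Yh B₁ B₂ Y lam y d j ω ≤ δ} +
        Real.exp (2 * c.re ^ 2 * t) * d / δ ^ 2) := by
  set γ := gaussianReal 0 d.toNNReal with hγ
  set a := c.re
  have ht : 0 ≤ t := (grid_nonneg hd j).trans hj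
  let Φ : ℝ × ℝ × ℝ → ℝ → ℂ := fun p g =>
    Complex.exp (s * (d * j : ℝ) + c * (p.1 : ℝ)) * (Complex.exp (s * d) *
      (Complex.exp (c * g) * PF A₁ A₂ α₁ α₂ τ (p.2.1 + p.2.2 * (g - lam * d)))
      - PF A₁ A₂ α₁ α₂ τ p.2.1)
  let ψ : Ω → ℝ × ℝ × ℝ := fun ω => (Wh B₁ B₂ Y d j ω, Yh B₁ B₂ Y lam y d j ω, sg Y (d * j) ω)
  have hψ : Measurable[F (d * j)] ψ :=
    (h.Wh_meas hd j).prodMk ((h.Yh_meas hd j).prodMk (h.sg_meas (grid_nonneg hd j)))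
  have hΦ : Measurable (Function.uncurry Φ) := by
    apply Continuous.measurable
    have := hP.PF_continuous
    simp only [Φ, Function.uncurry_def]
    fun_prop
  have hΦe : ∀ ω, Φ (ψ ω) (ginc B₁ B₂ Y d j ω) =
      Uh B₁ B₂ Y lam y A₁ A₂ α₁ α₂ τ c s d (j + 1) ω -
      Uh B₁ B₂ Y lam y A₁ A₂ α₁ α₂ τ c s d j ω := by
    intro ω
    simp only [Φ, ψ, Uh, Yh_succ, Wh_succ]
    have : Complex.exp (s * (d * (j + 1 : ℕ) : ℝ) + c * (Wh B₁ B₂ Y d j ω + ginc B₁ B₂ Y d j ω : ℝ))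
        = Complex.exp (s * (d * j : ℝ) + c * (Wh B₁ B₂ Y d j ω : ℝ)) * (Complex.exp (s * d) *
          Complex.exp (c * (ginc B₁ B₂ Y d j ω : ℝ))) := by
      rw [← Complex.exp_add, ← Complex.exp_add]
      congr 1; push_cast; ring
    rw [this]; ring
  have hi : Integrable (fun ω => Φ (ψ ω) (ginc B₁ B₂ Y d j ω)) μ := by
    simp_rw [hΦe]
    exact (h.Uh_int hP c s hd (j + 1)).sub (h.Uh_int hP c s hd j)
  have key := CG.integral (h.bm₁.le _) (h.ginc_CG hd j) hψ hΦ hi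
  rw [← integral_sub (h.Uh_int hP c s hd (j + 1)) (h.Uh_int hP c s hd j)]
  simp_rw [← hΦe]
  rw [key]
  have hin : ∀ p : ℝ × ℝ × ℝ, ∫ x, Φ p x ∂γ = Complex.exp (s * (d * j : ℝ) + c * (p.1 : ℝ)) *
      (Complex.exp (s * d) * (∫ g : ℝ, Complex.exp (c * g) *
        PF A₁ A₂ α₁ α₂ τ (p.2.1 + p.2.2 * (g - lam * d)) ∂γ) - PF A₁ A₂ α₁ α₂ τ p.2.1) := by
    intro p
    simp only [Φ]
    rw [integral_const_mul, integral_sub ((hP.step_int c lam p.2.2 _ d p.2.1).const_mul _)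
      (integrable_const _), integral_const_mul]
    simp [hγ]
  simp_rw [← hγ, hin]
  set E := Real.exp (‖s‖ * t)
  set bad := {ω | sg Y (d * j) ω * Yh B₁ B₂ Y lam y d j ω ≤ δ} with hbad
  have hsgm : Measurable (sg Y (d * j)) := (h.sg_meas (grid_nonneg hd j)).mono (h.bm₁.le _) le_rfl
  have hbm : MeasurableSet bad := (hsgm.mul (h.Yh_measm hd j)) measurableSet_Iic
  obtain ⟨i1, v1⟩ := h.Wh_exp hd j hj a
  obtain ⟨i2, v2⟩ := h.Wh_exp hd j hj (2 * a)
  set w : Ω → ℝ := fun ω => Wh B₁ B₂ Y d j ω with hw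
  have iB : Integrable (fun ω => bad.indicator (fun _ => (1:ℝ)) ω) μ :=
    (integrable_const (1:ℝ)).indicator hbm
  have hbound : ∀ ω, ‖Complex.exp (s * (d * j : ℝ) + c * ((ψ ω).1 : ℝ)) *
      (Complex.exp (s * d) * (∫ g : ℝ, Complex.exp (c * g) *
        PF A₁ A₂ α₁ α₂ τ ((ψ ω).2.1 + (ψ ω).2.2 * (g - lam * d)) ∂γ) -
        PF A₁ A₂ α₁ α₂ τ (ψ ω).2.1)‖ ≤
      E * K * d * (e * Real.exp (2 * a * w ω) + e⁻¹ * bad.indicator (fun _ => (1:ℝ)) ω +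
        Real.exp (a * w ω) * (d / δ ^ 2)) := by
    intro ω
    obtain ⟨H1, H2⟩ := H (Yh B₁ B₂ Y lam y d j ω) (sg Y (d * j) ω) (sg_cases _ _ _)
    have hx := expnorm s c (grid_nonneg hd j) hj (w ω)
    rw [norm_mul]
    have h0 : 0 < Real.exp (a * w ω) := Real.exp_pos _
    have hsq : Real.exp (2 * a * w ω) = Real.exp (a * w ω) ^ 2 := by
      rw [← Real.exp_nat_mul]; congr 1; push_cast; ring
    by_cases hb : ω ∈ bad
    · rw [indicator_of_mem hb]
      have am : Real.exp (a * w ω) ≤ e * Real.exp (2 * a * w ω) + e⁻¹ * 1 := by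
        rw [hsq]
        have : e * Real.exp (a * w ω) ^ 2 + e⁻¹ * 1 - Real.exp (a * w ω) =
          e⁻¹ * ((e * Real.exp (a * w ω) - 1 / 2) ^ 2 + 3 / 4) := by field_simp; ring
        have : 0 ≤ e⁻¹ * ((e * Real.exp (a * w ω) - 1 / 2) ^ 2 + 3 / 4) := by positivity
        linarith
      calc _ ≤ (E * Real.exp (a * w ω)) * (K * d) := by
            exact mul_le_mul hx H1 (norm_nonneg _) (by positivity)
        _ = E * K * d * (Real.exp (a * w ω)) := by ring
        _ ≤ _ := by
            gcongr
            have : 0 ≤ Real.exp (a * w ω) * (d / δ ^ 2) := by positivity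
            linarith
    · rw [indicator_of_notMem hb]
      have hb' : δ < sg Y (d * j) ω * Yh B₁ B₂ Y lam y d j ω := not_le.1 hb
      have H2' := H2 (hδ.trans hb')
      have hx2 : δ ^ 2 ≤ Yh B₁ B₂ Y lam y d j ω ^ 2 := by
        have : Yh B₁ B₂ Y lam y d j ω ^ 2 = (sg Y (d * j) ω * Yh B₁ B₂ Y lam y d j ω) ^ 2 := by
          rcases sg_cases Y (d * j) ω with h | h <;> rw [h] <;> ring
        rw [this]
        exact pow_le_pow_left₀ hδ.le hb'.le 2
      calc _ ≤ (E * Real.exp (a * w ω)) * (K * d ^ 2 / δ ^ 2) := by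
            exact mul_le_mul hx (H2'.trans (by gcongr)) (norm_nonneg _) (by positivity)
        _ = E * K * d * (Real.exp (a * w ω) * (d / δ ^ 2)) := by ring
        _ ≤ _ := by
            gcongr
            have : 0 ≤ e * Real.exp (2 * a * w ω) := by positivity
            linarith
  have iTot : Integrable (fun ω => E * K * d * (e * Real.exp (2 * a * w ω) +
      e⁻¹ * bad.indicator (fun _ => (1:ℝ)) ω + Real.exp (a * w ω) * (d / δ ^ 2))) μ :=
    (((i2.const_mul e).add (iB.const_mul e⁻¹)).add (i1.mul_const _)).const_mul _
  refine (norm_integral_le_of_norm_le iTot (ae_of_all _ hbound)).trans ?_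
  have i12 : Integrable (fun ω => e * Real.exp (2 * a * w ω) +
      e⁻¹ * bad.indicator (fun _ => (1:ℝ)) ω) μ := (i2.const_mul e).add (iB.const_mul e⁻¹)
  rw [integral_const_mul, integral_add i12 (i1.mul_const _),
    integral_add (i2.const_mul e) (iB.const_mul e⁻¹), integral_const_mul, integral_const_mul,
    integral_mul_const, integral_indicator_const _ hbm]
  have v1' : ∫ ω, Real.exp (a * w ω) ∂μ ≤ Real.exp (2 * a ^ 2 * t) :=
    v1.trans (Real.exp_le_exp.2 (by nlinarith [mul_nonneg (sq_nonneg a) ht]))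
  have v2' : ∫ ω, Real.exp (2 * a * w ω) ∂μ ≤ Real.exp (2 * a ^ 2 * t) :=
    v2.trans (Real.exp_le_exp.2 (by nlinarith [mul_nonneg (sq_nonneg a) ht]))
  rw [smul_eq_mul, mul_one, mul_div_assoc (Real.exp (2 * a ^ 2 * t))]
  gcongr

end sums

section lims
variable {A₁ A₂ α₁ α₂ τ : ℂ}

lemma Ctx.bad_small [IsProbabilityMeasure μ] (h : Ctx μ F B₁ B₂ Y I₁ I₂ lam y) {t ε q : ℝ}
    (ht : 0 < t) (hε : 0 < ε) (hq : 0 < q) :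
    ∃ δ > 0, ∃ N : ℕ, ∀ n ≥ N, ∀ j : ℕ, j ≤ 2 ^ n →
      μ.real {ω | sg Y (t / 2 ^ n * j) ω * Yh B₁ B₂ Y lam y (t / 2 ^ n) j ω ≤ δ} ≤
        (if t / 2 ^ n * (j : ℝ) < ε then 1 else 0) + 2 * q := by
  obtain ⟨c, hc, hc'⟩ := h.anticonc_unif hε t hq
  obtain ⟨N, hN⟩ := h.close ht (half_pos hc) hq
  refine ⟨c / 2, half_pos hc, N, fun n hn j hj => ?_⟩
  set d := t / 2 ^ n with hd
  split_ifs with hlt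
  · have : μ.real {ω | sg Y (d * j) ω * Yh B₁ B₂ Y lam y d j ω ≤ c / 2} ≤ 1 := measureReal_le_one
    linarith
  · have hdj : d * j ≤ t := by
      have h1 : (j : ℝ) ≤ 2 ^ n := by exact_mod_cast hj
      have h2 : (0:ℝ) < 2 ^ n := by positivity
      rw [hd, div_mul_eq_mul_div, div_le_iff₀ h2]
      exact mul_le_mul_of_nonneg_left h1 ht.le
    have hsub : {ω | sg Y (d * j) ω * Yh B₁ B₂ Y lam y d j ω ≤ c / 2} ⊆
        {ω | |Y (d * j) ω| ≤ c} ∪ {ω | c / 2 ≤ |Yh B₁ B₂ Y lam y d j ω - Y (d * j) ω|} := by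
      intro ω hω
      simp only [mem_ofPred_eq, mem_union] at *
      by_contra! hcon
      obtain ⟨h1, h2⟩ := hcon
      have h3 := abs_lt.1 h2
      unfold sg at hω
      split_ifs at hω with h0
      · rw [abs_of_nonpos h0] at h1; linarith [h3.2]
      · rw [abs_of_pos (not_le.1 h0)] at h1; linarith [h3.1]
    have := (measure_mono hsub).trans ((measure_union_le _ _).trans
      (add_le_add (hc' (d * j) (not_lt.1 hlt) hdj) (hN n hn j hj)))
    rw [← ENNReal.ofReal_add hq.le hq.le] at this
    have h4 := ENNReal.toReal_mono ENNReal.ofReal_ne_top this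
    rw [ENNReal.toReal_ofReal (by positivity)] at h4
    rw [measureReal_def]
    linarith

lemma Ctx.Uh_total [IsProbabilityMeasure μ] (h : Ctx μ F B₁ B₂ Y I₁ I₂ lam y)
    (hP : TF A₁ A₂ α₁ α₂ τ) (c s : ℂ) {t : ℝ} (ht : 0 < t)
    (e1 : s - α₁ * lam + (c + α₁) ^ 2 / 2 = 0) (e2 : s - α₂ * lam + (c + α₂) ^ 2 / 2 = 0) :
    Tendsto (fun n : ℕ => ∫ ω, Uh B₁ B₂ Y lam y A₁ A₂ α₁ α₂ τ c s (t / 2 ^ n) (2 ^ n) ω ∂μ) atTop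
      (nhds (PF A₁ A₂ α₁ α₂ τ y)) := by
  obtain ⟨K, hK, HK⟩ := hP.onestep c s lam t h.lam0 ht.le e1 e2
  set C₀ := Real.exp (‖s‖ * t) * K with hC₀
  have hC₀p : 0 < C₀ := by positivity
  set M := Real.exp (2 * c.re ^ 2 * t) with hM
  have hMp : 0 < M := Real.exp_pos _
  have hdl : Tendsto (fun n : ℕ => t / 2 ^ n) atTop (nhds 0) := by
    have h1 := tendsto_pow_atTop_nhds_zero_of_lt_one (r := (1/2 : ℝ)) (by norm_num) (by norm_num)
    have h2 := h1.const_mul t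
    rw [mul_zero] at h2
    refine h2.congr fun n => ?_
    rw [one_div, inv_pow]; rfl
  -- quantitative
  have key : ∀ r : ℝ, 0 < r → ∀ᶠ n : ℕ in atTop,
      ‖(∫ ω, Uh B₁ B₂ Y lam y A₁ A₂ α₁ α₂ τ c s (t / 2 ^ n) (2 ^ n) ω ∂μ) - PF A₁ A₂ α₁ α₂ τ y‖ ≤
        C₀ * (t * M + 2 + 2 * t) * r := by
    intro r hr
    obtain ⟨δ, hδ, N, hN⟩ := h.bad_small ht (ε := r ^ 2) (q := r ^ 2) (by positivity) (by positivity)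
    have hlim : Tendsto (fun n : ℕ => r⁻¹ * (t / 2 ^ n) + t * M / δ ^ 2 * (t / 2 ^ n)) atTop
        (nhds 0) := by
      simpa using (hdl.const_mul r⁻¹).add (hdl.const_mul (t * M / δ ^ 2))
    filter_upwards [hlim.eventually (gt_mem_nhds hr), eventually_ge_atTop N] with n hn1 hn2
    set d := t / 2 ^ n with hd
    have hd0 : 0 ≤ d := by positivity
    have h2n : (0:ℝ) < 2 ^ n := by positivity
    have hdN : d * (2 ^ n : ℕ) = t := by rw [hd]; push_cast; field_simp
    have hdt : d ≤ t := by
      rw [hd, div_le_iff₀ h2n]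
      have : (1:ℝ) ≤ 2 ^ n := one_le_pow₀ (by norm_num)
      nlinarith
    have tel : ∀ J : ℕ, J ≤ 2 ^ n →
        ‖(∫ ω, Uh B₁ B₂ Y lam y A₁ A₂ α₁ α₂ τ c s d J ω ∂μ) - PF A₁ A₂ α₁ α₂ τ y‖ ≤
        ∑ j ∈ Finset.range J, C₀ * d * (r * M + r⁻¹ *
          ((if d * (j : ℝ) < r ^ 2 then 1 else 0) + 2 * r ^ 2) + M * d / δ ^ 2) := by
      intro J
      induction J with
      | zero => intro _; simp [Uh, Wh, Yh_eq]
      | succ j ih =>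
        intro hj
        have hj' : j ≤ 2 ^ n := by omega
        have hdj : d * j ≤ t := by
          rw [← hdN]; gcongr
        have hs := h.Uh_step hP c s hK hd0 (HK d hd0 hdt) j hdj hr hδ
        rw [Finset.sum_range_succ]
        have tri : ∀ a b p : ℂ, ‖a - p‖ ≤ ‖b - p‖ + ‖a - b‖ := by
          intro a b p
          calc ‖a - p‖ = ‖(b - p) + (a - b)‖ := by congr 1; ring
            _ ≤ _ := norm_add_le _ _
        refine (tri _ (∫ ω, Uh B₁ B₂ Y lam y A₁ A₂ α₁ α₂ τ c s d j ω ∂μ) _).trans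
          (add_le_add (ih hj') (hs.trans ?_))
        rw [← hC₀, ← hM]
        gcongr
        exact hN n hn2 j hj'
    refine (tel (2 ^ n) le_rfl).trans ?_
    have hsum : ∑ j ∈ Finset.range (2 ^ n), C₀ * d * (r * M + r⁻¹ *
          ((if d * (j : ℝ) < r ^ 2 then 1 else 0) + 2 * r ^ 2) + M * d / δ ^ 2) =
        C₀ * (t * (r * M + r⁻¹ * (2 * r ^ 2) + M * d / δ ^ 2) +
          r⁻¹ * ∑ j ∈ Finset.range (2 ^ n), (if d * (j : ℝ) < r ^ 2 then d else 0)) := by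
      have : ∀ j : ℕ, C₀ * d * (r * M + r⁻¹ *
          ((if d * (j : ℝ) < r ^ 2 then 1 else 0) + 2 * r ^ 2) + M * d / δ ^ 2) =
          C₀ * d * (r * M + r⁻¹ * (2 * r ^ 2) + M * d / δ ^ 2) + C₀ * r⁻¹ *
            (if d * (j : ℝ) < r ^ 2 then d else 0) := by
        intro j; split_ifs <;> ring
      simp_rw [this]
      rw [Finset.sum_add_distrib, Finset.sum_const, Finset.card_range,
        nsmul_eq_mul, ← Finset.mul_sum, ← hdN]
      ring
    rw [hsum]
    have hcs := count_small hd0 (sq_nonneg r) (2 ^ n)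
    have hb : t * (r * M + r⁻¹ * (2 * r ^ 2) + M * d / δ ^ 2) +
          r⁻¹ * ∑ j ∈ Finset.range (2 ^ n), (if d * (j : ℝ) < r ^ 2 then d else 0) ≤
        t * (r * M + r⁻¹ * (2 * r ^ 2) + M * d / δ ^ 2) + r⁻¹ * (r ^ 2 + d) := by gcongr
    have hr2 : r⁻¹ * r ^ 2 = r := by field_simp
    have : t * (r * M + r⁻¹ * (2 * r ^ 2) + M * d / δ ^ 2) + r⁻¹ * (r ^ 2 + d) ≤
        (t * M + 2 + 2 * t) * r := by
      have e1 : t * (r * M + r⁻¹ * (2 * r ^ 2) + M * d / δ ^ 2) + r⁻¹ * (r ^ 2 + d) =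
        t * r * M + 2 * t * (r⁻¹ * r ^ 2) + r⁻¹ * r ^ 2 + (r⁻¹ * d + t * M / δ ^ 2 * d) := by ring
      rw [e1, hr2]; nlinarith
    calc _ ≤ C₀ * ((t * M + 2 + 2 * t) * r) := by gcongr; exact hb.trans this
      _ = _ := by ring
  rw [Metric.tendsto_nhds]
  intro ε hε
  set L := C₀ * (t * M + 2 + 2 * t) with hL
  have hLp : 0 < L := by positivity
  filter_upwards [key (ε / (2 * L)) (by positivity)] with n hn
  rw [dist_eq_norm]
  refine hn.trans_lt ?_
  rw [show L * (ε / (2 * L)) = ε / 2 by field_simp]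
  linarith

lemma Ctx.transform [IsProbabilityMeasure μ] (h : Ctx μ F B₁ B₂ Y I₁ I₂ lam y)
    (hP : TF A₁ A₂ α₁ α₂ τ) (c s : ℂ) {t : ℝ} (ht : 0 < t)
    (e1 : s - α₁ * lam + (c + α₁) ^ 2 / 2 = 0) (e2 : s - α₂ * lam + (c + α₂) ^ 2 / 2 = 0) :
    Integrable (fun ω => Complex.exp (s * t + c * (I₁ t ω + I₂ t ω : ℝ)) *
      PF A₁ A₂ α₁ α₂ τ (Y t ω)) μ ∧
    ∫ ω, Complex.exp (s * t + c * (I₁ t ω + I₂ t ω : ℝ)) * PF A₁ A₂ α₁ α₂ τ (Y t ω) ∂μ =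
      PF A₁ A₂ α₁ α₂ τ y := by
  have tot := h.Uh_total hP c s ht e1 e2
  have T1 : TendstoInMeasure μ (fun n ω => Wh B₁ B₂ Y (t / 2 ^ n) (2 ^ n) ω) atTop
      (fun ω => I₁ t ω + I₂ t ω) := by
    have := tim_add (h.tendsto₁ ht.le) (h.tendsto₂ ht.le)
    simp_rw [J_add] at this
    exact this
  have hdN : ∀ n : ℕ, t / 2 ^ n * ((2 ^ n : ℕ) : ℝ) = t := by
    intro n; push_cast; field_simp
  have T2 : TendstoInMeasure μ (fun n ω => Yh B₁ B₂ Y lam y (t / 2 ^ n) (2 ^ n) ω) atTop (Y t) := by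
    rw [tendstoInMeasure_iff_norm]
    intro e he
    rw [ENNReal.tendsto_nhds_zero]
    intro q hq
    by_cases hqt : q = ⊤
    · subst hqt; exact Eventually.of_forall fun _ => le_top
    have hq' : 0 < q.toReal := ENNReal.toReal_pos hq.ne' hqt
    obtain ⟨N, hN⟩ := h.close ht he hq'
    filter_upwards [eventually_ge_atTop N] with n hn
    have := hN n hn (2 ^ n) le_rfl
    rw [hdN, ENNReal.ofReal_toReal hqt] at this
    simpa only [Real.norm_eq_abs] using this
  obtain ⟨n1, hn1, ha1⟩ := T1.exists_seq_tendsto_ae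
  have T2' : TendstoInMeasure μ (fun n ω => Yh B₁ B₂ Y lam y (t / 2 ^ (n1 n)) (2 ^ (n1 n)) ω) atTop
      (Y t) := fun ε hε => (T2 ε hε).comp hn1.tendsto_atTop
  obtain ⟨n2, hn2, ha2⟩ := T2'.exists_seq_tendsto_ae
  set N : ℕ → ℕ := fun k => n1 (n2 k)
  have hNt : Tendsto N atTop atTop := hn1.tendsto_atTop.comp hn2.tendsto_atTop
  have hae : ∀ᵐ ω ∂μ, Tendsto (fun k => Uh B₁ B₂ Y lam y A₁ A₂ α₁ α₂ τ c s (t / 2 ^ (N k))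
      (2 ^ (N k)) ω) atTop (nhds (Complex.exp (s * t + c * (I₁ t ω + I₂ t ω : ℝ)) *
      PF A₁ A₂ α₁ α₂ τ (Y t ω))) := by
    filter_upwards [ha1, ha2] with ω h1 h2
    have h1' := h1.comp hn2.tendsto_atTop
    unfold Uh
    simp_rw [hdN]
    refine Tendsto.mul ?_ ((hP.PF_continuous.tendsto _).comp h2)
    have hc : Continuous (fun x : ℝ => Complex.exp (s * t + c * (x : ℂ))) := by fun_prop
    exact (hc.tendsto _).comp h1'
  set M := (Real.exp (‖s‖ * t) * (‖A₁‖ + ‖A₂‖)) ^ 2 * Real.exp ((2 * c.re) ^ 2 * t / 2)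
  have hV := vitali2 (M := M) (by positivity)
    (fun k => h.Uh_meas hP c s (d := t / 2 ^ (N k)) (by positivity) (2 ^ (N k))) (fun k => ?_) hae
  · refine ⟨hV.1, tendsto_nhds_unique hV.2 ?_⟩
    exact tot.comp hNt
  · have hd : 0 ≤ t / 2 ^ (N k) := by positivity
    obtain ⟨i2, v2⟩ := h.Wh_exp hd (2 ^ (N k)) (hdN _).le (2 * c.re)
    have hb : ∀ ω, ENNReal.ofReal (‖Uh B₁ B₂ Y lam y A₁ A₂ α₁ α₂ τ c s (t / 2 ^ (N k))
        (2 ^ (N k)) ω‖ ^ 2) ≤ ENNReal.ofReal ((Real.exp (‖s‖ * t) * (‖A₁‖ + ‖A₂‖)) ^ 2 *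
          Real.exp (2 * c.re * Wh B₁ B₂ Y (t / 2 ^ (N k)) (2 ^ (N k)) ω)) := by
      intro ω
      apply ENNReal.ofReal_le_ofReal
      have := Ctx.Uh_norm (B₁ := B₁) (B₂ := B₂) (Y := Y) (lam := lam) (y := y)
        hP c s hd (2 ^ (N k)) (hdN _).le ω
      refine (pow_le_pow_left₀ (norm_nonneg _) this 2).trans (le_of_eq ?_)
      rw [mul_pow, ← Real.exp_nat_mul (c.re * _)]
      congr 2; push_cast; ring
    refine (lintegral_mono hb).trans ?_
    rw [← ofReal_integral_eq_lintegral_ofReal (i2.const_mul _)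
      (ae_of_all _ fun ω => by positivity), integral_const_mul]
    apply ENNReal.ofReal_le_ofReal
    exact mul_le_mul_of_nonneg_left v2 (by positivity)

end lims

section uniq
open Complex (I)

def fE (b β : ℝ) (p : ℝ × ℝ) : ℂ :=
  Complex.exp (I * (b * p.2 : ℝ)) *
    (β * (Real.cos (β * |p.1|) : ℝ) + (1 + I * b) * (Real.sin (β * |p.1|) : ℝ))

def fO (b β : ℝ) (p : ℝ × ℝ) : ℂ :=
  Complex.exp (I * (b * p.2 : ℝ)) * (Real.sin (β * p.1) : ℝ)

lemma ext_2d {M₁ M₂ : Measure (ℝ × ℝ)} [IsFiniteMeasure M₁] [IsFiniteMeasure M₂]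
    (h : ∀ β b : ℝ, ∫ p, Complex.exp (I * (β * p.1 + b * p.2 : ℝ)) ∂M₁ =
      ∫ p, Complex.exp (I * (β * p.1 + b * p.2 : ℝ)) ∂M₂) : M₁ = M₂ := by
  apply Measure.ext_of_charFunDual
  ext L
  rw [charFunDual_apply, charFunDual_apply]
  have : ∀ v : ℝ × ℝ, (L v : ℝ) = L (1, 0) * v.1 + L (0, 1) * v.2 := by
    intro v
    have e : v = v.1 • ((1 : ℝ), (0 : ℝ)) + v.2 • ((0 : ℝ), (1 : ℝ)) := by
      ext <;> simp
    conv_lhs => rw [e]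
    rw [map_add, map_smul, map_smul]
    simp only [smul_eq_mul]; ring
  have e2 : ∀ v : ℝ × ℝ, Complex.exp ((L v : ℝ) * I) =
      Complex.exp (I * (L (1, 0) * v.1 + L (0, 1) * v.2 : ℝ)) := by
    intro v; rw [mul_comm, ← this v]
  have h' := h (L (1, 0)) (L (0, 1))
  simp only [← e2] at h'
  exact h'

lemma norm_exp_I (x : ℝ) : ‖Complex.exp (I * x)‖ = 1 := by
  rw [mul_comm]; exact Complex.norm_exp_ofReal_mul_I x

lemma int_bdd {E : Type*} [MeasurableSpace E] {M : Measure E} [IsFiniteMeasure M] {f : E → ℂ}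
    (hf : Measurable f) (C : ℝ) (hb : ∀ p, ‖f p‖ ≤ C) : Integrable f M :=
  (integrable_const C).mono' hf.aestronglyMeasurable (ae_of_all _ hb)

def expM : Measure ℝ :=
  (volume.restrict (Ioi 0)).withDensity fun x => ENNReal.ofReal (Real.exp (-x))

instance : IsFiniteMeasure expM :=
  isFiniteMeasure_withDensity_ofReal (integrableOn_exp_neg_Ioi 0).2

lemma expM_char (a : ℝ) : ∫ x, Complex.exp (I * (a * x : ℝ)) ∂expM = 1 / (1 - I * a) := by
  unfold expM
  rw [integral_withDensity_eq_integral_toReal_smul (by fun_prop) (ae_of_all _ fun x => by simp)]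
  have : ∀ x : ℝ, (ENNReal.ofReal (Real.exp (-x))).toReal • Complex.exp (I * (a * x : ℝ)) =
      Complex.exp ((-1 + I * a) * x) := by
    intro x
    rw [ENNReal.toReal_ofReal (Real.exp_pos _).le, Complex.real_smul, Complex.ofReal_exp,
      ← Complex.exp_add]
    congr 1; push_cast; ring
  simp_rw [this]
  rw [integral_exp_mul_complex_Ioi (by simp)]
  simp only [Complex.ofReal_zero, mul_zero, Complex.exp_zero]
  rw [show (1 - I * (a:ℂ)) = -(-1 + I * a) by ring, div_neg, neg_div]

lemma expM_pos : ∀ᵐ x ∂expM, 0 < x := by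
  have h : ∀ᵐ x ∂(volume.restrict (Ioi (0:ℝ))), x ∈ Ioi (0:ℝ) := ae_restrict_mem measurableSet_Ioi
  exact (withDensity_absolutelyContinuous _ _).ae_le h

def NM (M : Measure (ℝ × ℝ)) : Measure (ℝ × ℝ) :=
  (M.prod expM).map fun q => (|q.1.1| + q.2, q.1.2 - q.2)

lemma NM_meas : Measurable (fun q : (ℝ × ℝ) × ℝ => (|q.1.1| + q.2, q.1.2 - q.2)) := by
  have : Measurable (fun q : (ℝ × ℝ) × ℝ => |q.1.1|) := by
    apply Continuous.measurable; fun_prop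
  fun_prop

instance (M : Measure (ℝ × ℝ)) [IsFiniteMeasure M] : IsFiniteMeasure (NM M) := by
  unfold NM; infer_instance

def Ph (M : Measure (ℝ × ℝ)) (b β : ℝ) : ℂ :=
  ∫ p, Complex.exp (I * (β * |p.1| + b * p.2 : ℝ)) ∂M

lemma NM_char (M : Measure (ℝ × ℝ)) [IsFiniteMeasure M] (β b : ℝ) :
    ∫ p, Complex.exp (I * (β * p.1 + b * p.2 : ℝ)) ∂(NM M) =
      Ph M b β * (1 / (1 - I * (β - b : ℝ))) := by
  unfold NM
  rw [integral_map NM_meas.aemeasurable (by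
    apply Continuous.aestronglyMeasurable; fun_prop)]
  rw [← expM_char, Ph, ← integral_prod_mul]
  refine integral_congr_ae (ae_of_all _ fun q => ?_)
  simp only
  rw [← Complex.exp_add]
  congr 1; push_cast; ring

lemma NM_pos (M : Measure (ℝ × ℝ)) [IsFiniteMeasure M] : ∀ᵐ p ∂(NM M), 0 < p.1 := by
  unfold NM
  rw [ae_map_iff NM_meas.aemeasurable (measurableSet_lt measurable_const measurable_fst)]
  have : ∀ᵐ q ∂(M.prod expM), 0 < q.2 := by
    have := (Measure.quasiMeasurePreserving_snd (μ := M) (ν := expM)).ae expM_pos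
    exact this
  filter_upwards [this] with q hq
  have := abs_nonneg q.1.1
  linarith

lemma fE_int (M : Measure (ℝ × ℝ)) [IsFiniteMeasure M] (b β : ℝ) :
    ∫ p, fE b β p ∂M = (-I / 2) * (1 + I * b - I * β) * (1 + I * b + I * β) *
      (Ph M b β * (1 / (1 - I * (β - b : ℝ))) - Ph M b (-β) * (1 / (1 - I * (-β - b : ℝ)))) := by
  have i1 : ∀ β : ℝ, Integrable (fun p : ℝ × ℝ => Complex.exp (I * (β * |p.1| + b * p.2 : ℝ))) M :=
    fun β => int_bdd (by apply Continuous.measurable; fun_prop) 1 (fun p => (norm_exp_I _).le)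
  have n1 : (1 - I * ((β - b : ℝ) : ℂ)) ≠ 0 := by
    intro h; have := congrArg Complex.re h; simp at this
  have n2 : (1 - I * ((-β - b : ℝ) : ℂ)) ≠ 0 := by
    intro h; have := congrArg Complex.re h; simp at this
  have e : ∀ p : ℝ × ℝ, fE b β p = (-I / 2) * (1 + I * b + I * β) *
      Complex.exp (I * (β * |p.1| + b * p.2 : ℝ)) - (-I / 2) * (1 + I * b - I * β) *
      Complex.exp (I * (-β * |p.1| + b * p.2 : ℝ)) := by
    intro p
    have h1 : Complex.exp (I * (β * |p.1| + b * p.2 : ℝ)) = Complex.exp (I * (b * p.2 : ℝ)) *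
        (Complex.cos (β * |p.1| : ℝ) + Complex.sin (β * |p.1| : ℝ) * I) := by
      rw [← Complex.exp_mul_I, ← Complex.exp_add]; congr 1; push_cast; ring
    have h2 : Complex.exp (I * (-β * |p.1| + b * p.2 : ℝ)) = Complex.exp (I * (b * p.2 : ℝ)) *
        (Complex.cos (β * |p.1| : ℝ) - Complex.sin (β * |p.1| : ℝ) * I) := by
      have : Complex.cos (β * |p.1| : ℝ) - Complex.sin (β * |p.1| : ℝ) * I =
          Complex.cos (-(β * |p.1| : ℝ)) + Complex.sin (-(β * |p.1| : ℝ)) * I := by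
        rw [Complex.cos_neg, Complex.sin_neg]; ring
      rw [this, ← Complex.exp_mul_I, ← Complex.exp_add]; congr 1; push_cast; ring
    rw [h1, h2, fE, Complex.ofReal_cos, Complex.ofReal_sin]
    linear_combination (Complex.exp (I * (b * p.2 : ℝ)) * β * Complex.cos (β * |p.1| : ℝ) +
      Complex.exp (I * (b * p.2 : ℝ)) * (1 + I * b) * Complex.sin (β * |p.1| : ℝ)) * Complex.I_sq
  simp_rw [e]
  rw [integral_sub ((i1 β).const_mul _) ((i1 (-β)).const_mul _), integral_const_mul,
    integral_const_mul]
  change _ * Ph M b β - _ * Ph M b (-β) = _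
  have m1 : (1 + I * (b:ℂ) - I * β) = (1 - I * ((β - b : ℝ) : ℂ)) := by push_cast; ring
  have m2 : (1 + I * (b:ℂ) + I * β) = (1 - I * ((-β - b : ℝ) : ℂ)) := by push_cast; ring
  rw [m1, m2]
  field_simp
  ring

theorem uniq {M₁ M₂ : Measure (ℝ × ℝ)} [IsFiniteMeasure M₁] [IsFiniteMeasure M₂]
    (hE : ∀ b β : ℝ, ∫ p, fE b β p ∂M₁ = ∫ p, fE b β p ∂M₂)
    (hO : ∀ b β : ℝ, ∫ p, fO b β p ∂M₁ = ∫ p, fO b β p ∂M₂) : M₁ = M₂ := by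
  have n1 : ∀ x : ℝ, (1 - I * (x : ℂ)) ≠ 0 := by
    intro x h; have := congrArg Complex.re h; simp at this
  set rf : ℝ × ℝ → ℝ × ℝ := fun p => (-p.1, p.2) with hrf
  have hrfm : Measurable rf := by rw [hrf]; fun_prop
  have hN : NM M₁ + (NM M₂).map rf = NM M₂ + (NM M₁).map rf := by
    apply ext_2d
    intro β b
    have hc : Continuous (fun p : ℝ × ℝ => Complex.exp (I * (β * p.1 + b * p.2 : ℝ))) := by fun_prop
    have ii : ∀ (M : Measure (ℝ × ℝ)) [IsFiniteMeasure M],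
        Integrable (fun p : ℝ × ℝ => Complex.exp (I * (β * p.1 + b * p.2 : ℝ))) M :=
      fun M _ => int_bdd hc.measurable 1 (fun p => (norm_exp_I _).le)
    have hr : ∀ (M : Measure (ℝ × ℝ)) [IsFiniteMeasure M],
        ∫ p, Complex.exp (I * (β * p.1 + b * p.2 : ℝ)) ∂((NM M).map rf) =
          Ph M b (-β) * (1 / (1 - I * (-β - b : ℝ))) := by
      intro M _
      rw [integral_map hrfm.aemeasurable hc.aestronglyMeasurable, ← NM_char]
      refine integral_congr_ae (ae_of_all _ fun q => ?_)
      simp only [hrf]; congr 3; ring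
    rw [integral_add_measure (ii _) (ii _), integral_add_measure (ii _) (ii _), hr, hr,
      NM_char, NM_char]
    have := hE b β
    rw [fE_int, fE_int] at this
    have nz : (-I / 2) * (1 + I * b - I * β) * (1 + I * b + I * β) ≠ 0 := by
      have m1 : (1 + I * (b:ℂ) - I * β) = (1 - I * ((β - b : ℝ) : ℂ)) := by push_cast; ring
      have m2 : (1 + I * (b:ℂ) + I * β) = (1 - I * ((-β - b : ℝ) : ℂ)) := by push_cast; ring
      rw [m1, m2]
      refine mul_ne_zero (mul_ne_zero ?_ (n1 _)) (n1 _)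
      simp
    have := mul_left_cancel₀ nz this
    linear_combination this
  have hNN : NM M₁ = NM M₂ := by
    set S : Set (ℝ × ℝ) := {p | 0 < p.1} with hS
    have hSm : MeasurableSet S := measurableSet_lt measurable_const measurable_fst
    have h0 : ∀ (M : Measure (ℝ × ℝ)) [IsFiniteMeasure M], ((NM M).map rf).restrict S = 0 := by
      intro M _
      rw [Measure.restrict_eq_zero, Measure.map_apply hrfm hSm]
      have := NM_pos M
      refine measure_mono_null (fun p hp => ?_) (ae_iff.1 this)
      simp only [hS, hrf, mem_preimage, mem_ofPred_eq] at hp ⊢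
      linarith
    have h1 : ∀ (M : Measure (ℝ × ℝ)) [IsFiniteMeasure M], (NM M).restrict S = NM M := by
      intro M _
      rw [Measure.restrict_eq_self_of_ae_mem]
      exact NM_pos M
    have := congrArg (fun M => Measure.restrict M S) hN
    simp only [Measure.restrict_add, h0, h1, add_zero] at this
    exact this
  have hPh : ∀ b β, Ph M₁ b β = Ph M₂ b β := by
    intro b β
    have h1 := NM_char M₁ β b
    rw [hNN, NM_char M₂ β b] at h1
    have : (1 / (1 - I * ((β - b : ℝ) : ℂ))) ≠ 0 := one_div_ne_zero (n1 _)
    exact (mul_right_cancel₀ this h1).symm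
  apply ext_2d
  intro β b
  have e : ∀ p : ℝ × ℝ, Complex.exp (I * (β * p.1 + b * p.2 : ℝ)) =
      (1 / 2) * Complex.exp (I * (β * |p.1| + b * p.2 : ℝ)) +
      (1 / 2) * Complex.exp (I * (-β * |p.1| + b * p.2 : ℝ)) + I * fO b β p := by
    intro p
    have h1 : ∀ x : ℝ, Complex.exp (I * (x + b * p.2 : ℝ)) = Complex.exp (I * (b * p.2 : ℝ)) *
        (Complex.cos x + Complex.sin x * I) := by
      intro x
      rw [← Complex.exp_mul_I, ← Complex.exp_add]; congr 1; push_cast; ring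
    rw [h1, h1, h1, fO]
    rcases le_total 0 p.1 with h | h
    · rw [abs_of_nonneg h]; push_cast
      rw [neg_mul, Complex.cos_neg, Complex.sin_neg]; ring
    · rw [abs_of_nonpos h]; push_cast
      simp only [neg_mul, mul_neg, neg_neg, Complex.cos_neg, Complex.sin_neg]; ring
  have ii : ∀ (β : ℝ) (M : Measure (ℝ × ℝ)) [IsFiniteMeasure M],
      Integrable (fun p : ℝ × ℝ => Complex.exp (I * (β * |p.1| + b * p.2 : ℝ))) M :=
    fun β M _ => int_bdd (by apply Continuous.measurable; fun_prop) 1 (fun p => (norm_exp_I _).le)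
  have iO : ∀ (M : Measure (ℝ × ℝ)) [IsFiniteMeasure M], Integrable (fO b β) M := by
    intro M _
    refine int_bdd (by apply Continuous.measurable; unfold fO; fun_prop) 1 (fun p => ?_)
    rw [fO, norm_mul, norm_exp_I, one_mul, Complex.norm_real]
    exact Real.abs_sin_le_one _
  have ev : ∀ (M : Measure (ℝ × ℝ)) [IsFiniteMeasure M],
      ∫ p, Complex.exp (I * (β * p.1 + b * p.2 : ℝ)) ∂M =
      (1 / 2) * Ph M b β + (1 / 2) * Ph M b (-β) + I * ∫ p, fO b β p ∂M := by
    intro M _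
    simp_rw [e]
    have i2 : Integrable (fun p : ℝ × ℝ => (1 / 2) * Complex.exp (I * (β * |p.1| + b * p.2 : ℝ)) +
      (1 / 2) * Complex.exp (I * (-β * |p.1| + b * p.2 : ℝ))) M :=
      ((ii β M).const_mul _).add ((ii (-β) M).const_mul _)
    rw [integral_add i2 ((iO M).const_mul _),
      integral_add ((ii β M).const_mul _) ((ii (-β) M).const_mul _), integral_const_mul,
      integral_const_mul, integral_const_mul]
    rfl
  rw [ev, ev, hPh, hPh, hO]

end uniq

section oned
open Complex (I)

def ph (t x : ℝ) : ℝ := Real.exp (-x ^ 2 / (2 * t)) / Real.sqrt (2 * Real.pi * t)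

lemma ph_nonneg (t x : ℝ) : 0 ≤ ph t x := by unfold ph; positivity

lemma ph_neg (t x : ℝ) : ph t (-x) = ph t x := by simp [ph]

lemma ph_pdf {t : ℝ} (ht : 0 < t) (y x : ℝ) :
    ph t (x - y) = gaussianPDFReal y t.toNNReal x := by
  unfold ph gaussianPDFReal
  rw [Real.coe_toNNReal _ ht.le]
  rw [div_eq_mul_inv, mul_comm]

lemma ph_int {t : ℝ} (ht : 0 < t) (y : ℝ) : Integrable (fun x => ph t (x - y)) := by
  simp_rw [ph_pdf ht]
  exact integrable_gaussianPDFReal _ _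

lemma ph_char {t : ℝ} (ht : 0 < t) (y β : ℝ) :
    ∫ x : ℝ, (ph t (x - y) : ℂ) * Complex.exp (β * x * I) =
      Complex.exp (β * y * I - t * β ^ 2 / 2) := by
  have hv : t.toNNReal ≠ 0 := by simpa using ht
  have h1 := charFun_gaussianReal (μ := y) (v := t.toNNReal) β
  rw [charFun_apply_real, integral_gaussianReal_eq_integral_smul hv] at h1
  simp_rw [ph_pdf ht]
  simp only [Complex.real_smul] at h1
  rw [h1, show ((t.toNNReal : ℝ) : ℂ) = (t : ℂ) by rw [Real.coe_toNNReal _ ht.le]]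

lemma ph_mul_int {t : ℝ} (ht : 0 < t) (y : ℝ) {q : ℝ → ℝ} (hq : Continuous q) (hb : ∀ x, |q x| ≤ 1) :
    Integrable (fun x => ph t (x - y) * q x) := by
  refine (ph_int ht y).mono ((ph_int ht y).aestronglyMeasurable.mul hq.aestronglyMeasurable)
    (ae_of_all _ fun x => ?_)
  rw [norm_mul, Real.norm_eq_abs (q x)]
  exact mul_le_of_le_one_right (norm_nonneg _) (hb x)

lemma ph_cos_sin {t : ℝ} (ht : 0 < t) (y β : ℝ) :
    (∫ x : ℝ, ph t (x - y) * Real.cos (β * x) = Real.exp (-(t * β ^ 2 / 2)) * Real.cos (β * y)) ∧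
    (∫ x : ℝ, ph t (x - y) * Real.sin (β * x) = Real.exp (-(t * β ^ 2 / 2)) * Real.sin (β * y)) := by
  have ic := ph_mul_int ht y (q := fun x => Real.cos (β * x)) (by fun_prop)
    (fun x => Real.abs_cos_le_one _)
  have is := ph_mul_int ht y (q := fun x => Real.sin (β * x)) (by fun_prop)
    (fun x => Real.abs_sin_le_one _)
  have h := ph_char ht y β
  have e : ∀ x : ℝ, (ph t (x - y) : ℂ) * Complex.exp (β * x * I) =
      ((ph t (x - y) * Real.cos (β * x) : ℝ) : ℂ) + ((ph t (x - y) * Real.sin (β * x) : ℝ) : ℂ) * I := by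
    intro x
    rw [Complex.exp_mul_I]; push_cast; ring
  simp_rw [e] at h
  have ic' : Integrable (fun x : ℝ => ((ph t (x - y) * Real.cos (β * x) : ℝ) : ℂ)) := ic.ofReal
  have is' : Integrable (fun x : ℝ => ((ph t (x - y) * Real.sin (β * x) : ℝ) : ℂ)) := is.ofReal
  rw [integral_add ic' (is'.mul_const I), integral_mul_const, integral_complex_ofReal,
    integral_complex_ofReal] at h
  have r : Complex.exp (β * y * I - t * β ^ 2 / 2) =
      ((Real.exp (-(t * β ^ 2 / 2)) * Real.cos (β * y) : ℝ) : ℂ) +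
      ((Real.exp (-(t * β ^ 2 / 2)) * Real.sin (β * y) : ℝ) : ℂ) * I := by
    rw [sub_eq_add_neg, Complex.exp_add, Complex.exp_mul_I]; push_cast; ring
  rw [r] at h
  have cre : ∀ a b c d : ℝ, (a : ℂ) + b * I = c + d * I → a = c ∧ b = d := by
    intro a b c d h
    exact ⟨by simpa using congrArg Complex.re h, by simpa using congrArg Complex.im h⟩
  exact cre _ _ _ _ h

lemma fold_int {q : ℝ → ℝ} (hq : Integrable q) :
    ∫ x, q x = ∫ x in Ioi (0:ℝ), (q x + q (-x)) := by
  have h1 := intervalIntegral.integral_Iic_add_Ioi (b := (0:ℝ)) hq.integrableOn hq.integrableOn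
  have h2 := integral_comp_neg_Ioi (0:ℝ) q
  rw [neg_zero] at h2
  rw [← h1, ← h2, integral_add hq.integrableOn hq.comp_neg.integrableOn]
  ring

lemma fold_sin {t : ℝ} (ht : 0 < t) (y β : ℝ) :
    ∫ x in Ioi (0:ℝ), (ph t (x - y) - ph t (x + y)) * Real.sin (β * x) =
      Real.exp (-(t * β ^ 2 / 2)) * Real.sin (β * y) := by
  rw [← (ph_cos_sin ht y β).2, fold_int (ph_mul_int ht y (by fun_prop)
    (fun x => Real.abs_sin_le_one _))]
  refine integral_congr_ae (ae_of_all _ fun x => ?_)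
  simp only
  rw [show -x - y = -(x + y) by ring, ph_neg, mul_neg, Real.sin_neg]; ring

lemma fold_cos {t : ℝ} (ht : 0 < t) (y β : ℝ) :
    ∫ x in Ioi (0:ℝ), (ph t (x - y) + ph t (x + y)) * Real.cos (β * x) =
      Real.exp (-(t * β ^ 2 / 2)) * Real.cos (β * y) := by
  rw [← (ph_cos_sin ht y β).1, fold_int (ph_mul_int ht y (by fun_prop)
    (fun x => Real.abs_cos_le_one _))]
  refine integral_congr_ae (ae_of_all _ fun x => ?_)
  simp only
  rw [show -x - y = -(x + y) by ring, ph_neg, mul_neg, Real.cos_neg]; ring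

lemma ph_deriv {t : ℝ} (ht : 0 < t) (x : ℝ) :
    HasDerivAt (ph t) (-(x / Real.sqrt (2 * Real.pi * t ^ 3) * Real.exp (-x ^ 2 / (2 * t)))) x := by
  have h1 : HasDerivAt (fun x : ℝ => -x ^ 2 / (2 * t)) (-(2 * x) / (2 * t)) x := by
    simpa using ((hasDerivAt_pow 2 x).neg).div_const (2 * t)
  have h2 := h1.exp.div_const (Real.sqrt (2 * Real.pi * t))
  refine h2.congr_deriv ?_
  have h3 : Real.sqrt (2 * Real.pi * t ^ 3) = t * Real.sqrt (2 * Real.pi * t) := by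
    rw [show 2 * Real.pi * t ^ 3 = t ^ 2 * (2 * Real.pi * t) by ring,
      Real.sqrt_mul (by positivity), Real.sqrt_sq ht.le]
  rw [h3]
  have : 0 < Real.sqrt (2 * Real.pi * t) := by positivity
  field_simp

def fw (t y r : ℝ) : ℝ :=
  2 * ((y + r) / Real.sqrt (2 * Real.pi * t ^ 3)) * Real.exp (-(y + r) ^ 2 / (2 * t))

lemma fw_nonneg {t y r : ℝ} (h : 0 ≤ y + r) : 0 ≤ fw t y r := by unfold fw; positivity

lemma fw_cont (t y : ℝ) : Continuous (fw t y) := by unfold fw; fun_prop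

lemma fw_int {t : ℝ} (ht : 0 < t) (y : ℝ) : Integrable (fw t y) := by
  have h := (integrable_mul_exp_neg_mul_sq (b := 1 / (2 * t)) (by positivity)).const_mul
    (2 / Real.sqrt (2 * Real.pi * t ^ 3))
  have h2 := h.comp_add_left y
  refine h2.congr (ae_of_all _ fun r => ?_)
  simp only [fw]
  rw [show -(1 / (2 * t)) * (y + r) ^ 2 = -(y + r) ^ 2 / (2 * t) by ring]; ring

lemma ph_tendsto {t : ℝ} (ht : 0 < t) : Tendsto (ph t) atTop (nhds 0) := by
  unfold ph
  have h1 : Tendsto (fun x : ℝ => -x ^ 2 / (2 * t)) atTop atBot := by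
    have : Tendsto (fun x : ℝ => x ^ 2 / (2 * t)) atTop atTop :=
      (tendsto_pow_atTop two_ne_zero).atTop_div_const (by positivity)
    refine (tendsto_neg_atTop_atBot.comp this).congr fun x => ?_
    simp only [Function.comp]; ring
  simpa using (Real.tendsto_exp_atBot.comp h1).div_const (Real.sqrt (2 * Real.pi * t))

lemma fw_sin {t : ℝ} (ht : 0 < t) (y β : ℝ) :
    ∫ r in Ioi (0:ℝ), fw t y r * Real.sin (β * r) =
      2 * β * ∫ r in Ioi (0:ℝ), ph t (r + y) * Real.cos (β * r) := by
  have i1 : Integrable (fun r => fw t y r * Real.sin (β * r)) := by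
    refine (fw_int ht y).mono ((fw_cont t y).mul (by fun_prop)).aestronglyMeasurable
      (ae_of_all _ fun x => ?_)
    rw [norm_mul]
    exact mul_le_of_le_one_right (norm_nonneg _) (Real.abs_sin_le_one _)
  have i2 : Integrable (fun r => ph t (r + y) * Real.cos (β * r)) := by
    have := ph_mul_int ht (-y) (q := fun x => Real.cos (β * x)) (by fun_prop)
      (fun x => Real.abs_cos_le_one _)
    simpa only [sub_neg_eq_add] using this
  have hd : ∀ r ∈ Ici (0:ℝ), HasDerivAt (fun r => 2 * (ph t (r + y) * Real.sin (β * r)))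
      (2 * β * (ph t (r + y) * Real.cos (β * r)) - fw t y r * Real.sin (β * r)) r := by
    intro r _
    have h1 : HasDerivAt (fun r => ph t (r + y)) _ r := (ph_deriv ht (r + y)).comp_add_const r y
    have h2 : HasDerivAt (fun r => Real.sin (β * r)) (Real.cos (β * r) * β) r := by
      simpa using ((hasDerivAt_id r).const_mul β).sin
    refine ((h1.mul h2).const_mul 2).congr_deriv ?_
    unfold fw
    rw [show (y + r) = r + y by ring]; ring
  have hlim : Tendsto (fun r => 2 * (ph t (r + y) * Real.sin (β * r))) atTop (nhds 0) := by
    have h1 : Tendsto (fun r => 2 * ph t (r + y)) atTop (nhds 0) := by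
      simpa using ((ph_tendsto ht).comp (tendsto_atTop_add_const_right _ y tendsto_id)).const_mul 2
    refine squeeze_zero_norm (fun r => ?_) h1
    rw [norm_mul, norm_mul, Real.norm_eq_abs, Real.norm_eq_abs, Real.norm_eq_abs, abs_two,
      abs_of_nonneg (ph_nonneg _ _)]
    have := Real.abs_sin_le_one (β * r)
    have := ph_nonneg t (r + y)
    nlinarith
  have := integral_Ioi_of_hasDerivAt_of_tendsto' hd
    (((i2.const_mul (2 * β)).sub i1).integrableOn) hlim
  rw [integral_sub (i2.const_mul _).integrableOn i1.integrableOn, integral_const_mul] at this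
  simp at this
  linarith

end oned

section pim
open Complex (I)

def wt (l : ℝ) (p : ℝ × ℝ) : ℝ := Real.exp (l * (p.1 + p.2) + (p.1 + p.2 - |p.1 - p.2|))
def TT (p : ℝ × ℝ) : ℝ × ℝ := (p.1 - p.2, p.1 + p.2 - |p.1 - p.2|)

lemma wt_cont (l : ℝ) : Continuous (wt l) := by unfold wt; fun_prop
lemma TT_cont : Continuous TT := by unfold TT; fun_prop
lemma fE_cont (b β : ℝ) : Continuous (fE b β) := by unfold fE; fun_prop
lemma fO_cont (b β : ℝ) : Continuous (fO b β) := by unfold fO; fun_prop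

lemma fE_bdd (b β : ℝ) (p : ℝ × ℝ) : ‖fE b β p‖ ≤ |β| + ‖(1 + I * b : ℂ)‖ := by
  rw [fE, norm_mul, norm_exp_I, one_mul]
  refine (norm_add_le _ _).trans ?_
  rw [norm_mul, norm_mul, Complex.norm_real, Complex.norm_real, Complex.norm_real]
  exact add_le_add (mul_le_of_le_one_right (norm_nonneg _) (Real.abs_cos_le_one _))
    (mul_le_of_le_one_right (norm_nonneg _) (Real.abs_sin_le_one _))

lemma fO_bdd (b β : ℝ) (p : ℝ × ℝ) : ‖fO b β p‖ ≤ 1 := by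
  rw [fO, norm_mul, norm_exp_I, one_mul, Complex.norm_real]
  exact Real.abs_sin_le_one _

def V1 (g h x₁ x₂ t : ℝ) (p : ℝ × ℝ) : ℝ :=
  if p.2 < p.1 ∧ p.2 < x₂ + g * t then wedgeDensity g h x₁ x₂ t p.1 p.2 * wt (g + h) p else 0

def K0 (g h x₁ x₂ t : ℝ) : ℝ :=
  Real.exp ((g + h) * (x₁ + x₂ + 2 * g * t) - (g + h) ^ 2 * t / 2)

lemma planar_wt (g h x₁ x₂ t : ℝ) (p : ℝ × ℝ) :
    planarDensity g h x₁ x₂ t p.1 p.2 * wt (g + h) p =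
      V1 g h x₁ x₂ t p + V1 g h x₁ x₂ t p.swap := by
  have hs : wt (g + h) p.swap = wt (g + h) p := by
    simp only [wt, Prod.fst_swap, Prod.snd_swap]
    rw [abs_sub_comm, add_comm p.2]
  unfold planarDensity V1
  rw [hs]
  simp only [Prod.fst_swap, Prod.snd_swap]
  by_cases h1 : p.2 < p.1 ∧ p.2 < x₂ + g * t
  · rw [if_pos h1, if_pos h1, if_neg (fun h2 => lt_asymm h1.1 h2.1), add_zero]
  · rw [if_neg h1, if_neg h1]
    split_ifs <;> simp

lemma wedge_cont (g h x₁ x₂ t : ℝ) :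
    Continuous (fun p : ℝ × ℝ => wedgeDensity g h x₁ x₂ t p.1 p.2) := by
  unfold wedgeDensity; fun_prop

lemma reg_meas (a : ℝ) : MeasurableSet {p : ℝ × ℝ | p.2 < p.1 ∧ p.2 < a} :=
  (measurableSet_lt measurable_snd measurable_fst).inter
    (measurableSet_lt measurable_snd measurable_const)

lemma reg_meas' (a : ℝ) : MeasurableSet {p : ℝ × ℝ | p.1 < p.2 ∧ p.1 < a} :=
  (measurableSet_lt measurable_fst measurable_snd).inter
    (measurableSet_lt measurable_fst measurable_const)

lemma V1_meas (g h x₁ x₂ t : ℝ) : Measurable (V1 g h x₁ x₂ t) :=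
  Measurable.ite (reg_meas _) ((wedge_cont g h x₁ x₂ t).mul (wt_cont _)).measurable measurable_const

lemma planar_meas (g h x₁ x₂ t : ℝ) :
    Measurable (fun p : ℝ × ℝ => planarDensity g h x₁ x₂ t p.1 p.2) :=
  Measurable.ite (reg_meas _) (wedge_cont g h x₁ x₂ t).measurable
    (Measurable.ite (reg_meas' _)
      ((wedge_cont g h x₁ x₂ t).comp continuous_swap).measurable measurable_const)

lemma planar_nonneg (g h : ℝ) {x₁ x₂ t : ℝ} (hx : x₂ ≤ x₁) (p : ℝ × ℝ) :
    0 ≤ planarDensity g h x₁ x₂ t p.1 p.2 := by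
  have w : ∀ a b : ℝ, b < a → b < x₂ + g * t → 0 ≤ wedgeDensity g h x₁ x₂ t a b := by
    intro a b h1 h2
    have : 0 ≤ a - 3 * b + (x₁ + x₂) + 2 * g * t := by linarith
    unfold wedgeDensity; positivity
  unfold planarDensity
  split_ifs with h1 h2
  · exact w _ _ h1.1 h1.2
  · exact w _ _ h2.1 h2.2
  · exact le_rfl

def Sh (a : ℝ) (q : ℝ × ℝ) : ℝ × ℝ := (q.2 + (3 * q.1 - 2 * a), q.1)

lemma Sh_mp (a : ℝ) : MeasurePreserving (Sh a) := by
  have h1 : MeasurePreserving (fun q : ℝ × ℝ => (q.1, q.2 + (3 * q.1 - 2 * a)))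
      (volume.prod volume) (volume.prod volume) := by
    refine (MeasurePreserving.id volume).skew_product (g := fun x r => r + (3 * x - 2 * a))
      (by fun_prop) (ae_of_all _ fun x => ?_)
    exact (measurePreserving_add_right volume (3 * x - 2 * a)).map_eq
  exact (Measure.measurePreserving_swap (μ := (volume : Measure ℝ)) (ν := volume)).comp h1

lemma V1_Sh {g h x₁ x₂ t : ℝ} (ht : 0 < t) (q : ℝ × ℝ) :
    V1 g h x₁ x₂ t (Sh (x₂ + g * t) q) =
      if q.1 < x₂ + g * t ∧ (x₂ + g * t) - q.2 / 2 < q.1 then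
        K0 g h x₁ x₂ t * fw t (x₁ - x₂) q.2 * Real.exp (2 * q.1) else 0 := by
  unfold V1 Sh
  simp only
  have hiff : (q.1 < q.2 + (3 * q.1 - 2 * (x₂ + g * t)) ∧ q.1 < x₂ + g * t) ↔
      (q.1 < x₂ + g * t ∧ (x₂ + g * t) - q.2 / 2 < q.1) := by
    constructor
    · rintro ⟨h1, h2⟩; exact ⟨h2, by linarith⟩
    · rintro ⟨h1, h2⟩; exact ⟨by linarith, h1⟩
  simp only [hiff]
  split_ifs with hc
  · unfold wedgeDensity wt K0 fw
    simp only
    have hab : |q.2 + (3 * q.1 - 2 * (x₂ + g * t)) - q.1| =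
        q.2 + (3 * q.1 - 2 * (x₂ + g * t)) - q.1 := abs_of_nonneg (by linarith [hc.1, hc.2])
    rw [hab]
    set r := q.2
    set ξ := q.1
    have e1 : r + (3 * ξ - 2 * (x₂ + g * t)) - 3 * ξ + (x₁ + x₂) + 2 * g * t = x₁ - x₂ + r := by ring
    rw [e1]
    have e2 : ∀ A B C D E : ℝ, 2 * Real.exp A * B * Real.exp C * Real.exp D =
        2 * B * Real.exp (A + C + D) := by
      intro A B C D E; rw [Real.exp_add, Real.exp_add]; ring
    have e3 : ∀ A B C D : ℝ, Real.exp A * (2 * B * Real.exp C) * Real.exp D =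
        2 * B * Real.exp (A + C + D) := by
      intro A B C D; rw [Real.exp_add, Real.exp_add]; ring
    rw [e2 _ _ _ _ 0, e3]
    congr 2
    field_simp
    ring
  · rfl

lemma V1_Sh_bound {g h x₁ x₂ t : ℝ} (hx : x₂ ≤ x₁) (ht : 0 < t) (q : ℝ × ℝ) :
    ‖V1 g h x₁ x₂ t (Sh (x₂ + g * t) q)‖ ≤
      (Iio (x₂ + g * t)).indicator (fun ξ => K0 g h x₁ x₂ t * Real.exp (2 * ξ)) q.1 *
        (Ioi (0:ℝ)).indicator (fw t (x₁ - x₂)) q.2 := by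
  rw [V1_Sh ht]
  have hnn : 0 ≤ (Ioi (0:ℝ)).indicator (fw t (x₁ - x₂)) q.2 := by
    refine indicator_nonneg (fun r hr => fw_nonneg ?_) _
    have : 0 < r := hr
    linarith
  have hK : 0 ≤ K0 g h x₁ x₂ t := (Real.exp_pos _).le
  split_ifs with hc
  · have hr : q.2 ∈ Ioi (0:ℝ) := by
      have := hc.1; have := hc.2; simp only [mem_Ioi]; linarith
    have hf : 0 ≤ fw t (x₁ - x₂) q.2 := fw_nonneg (by have : 0 < q.2 := hr; linarith)
    rw [indicator_of_mem (show q.1 ∈ Iio (x₂ + g * t) from hc.1), indicator_of_mem hr,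
      Real.norm_of_nonneg (by positivity)]
    apply le_of_eq; ring
  · rw [norm_zero]
    refine mul_nonneg (indicator_nonneg (fun r hr => by positivity) _) hnn

lemma V1_Sh_int {g h x₁ x₂ t : ℝ} (hx : x₂ ≤ x₁) (ht : 0 < t) :
    Integrable (fun q => V1 g h x₁ x₂ t (Sh (x₂ + g * t) q)) := by
  have i1 : Integrable ((Iio (x₂ + g * t)).indicator
      (fun ξ => K0 g h x₁ x₂ t * Real.exp (2 * ξ))) := by
    rw [integrable_indicator_iff measurableSet_Iio]
    apply Integrable.const_mul
    have := integrableOn_exp_mul_Iic (a := 2) (by norm_num) (x₂ + g * t)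
    exact this.mono_set Iio_subset_Iic_self
  have i2 : Integrable ((Ioi (0:ℝ)).indicator (fw t (x₁ - x₂))) :=
    (fw_int ht _).indicator measurableSet_Ioi
  refine (i1.mul_prod i2).mono' ?_ (ae_of_all _ fun q => V1_Sh_bound hx ht q)
  exact ((V1_meas _ _ _ _ _).comp (Sh_mp _).measurable).aestronglyMeasurable

lemma V1_int {g h x₁ x₂ t : ℝ} (hx : x₂ ≤ x₁) (ht : 0 < t) :
    Integrable (V1 g h x₁ x₂ t) := by
  have := V1_Sh_int (h := h) hx ht (g := g)
  rw [← (Sh_mp (x₂ + g * t)).map_eq]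
  exact (integrable_map_measure (V1_meas _ _ _ _ _).aestronglyMeasurable
    (Sh_mp _).measurable.aemeasurable).2 this

/-- The planar part of the claimed law. -/
def piW (g h x₁ x₂ t : ℝ) : Measure (ℝ × ℝ) :=
  volume.withDensity fun p => ENNReal.ofReal (planarDensity g h x₁ x₂ t p.1 p.2)

lemma piW_wt {g h x₁ x₂ t : ℝ} (hx : x₂ ≤ x₁) (ht : 0 < t) :
    Integrable (wt (g + h)) (piW g h x₁ x₂ t) := by
  unfold piW
  rw [integrable_withDensity_iff_integrable_smul' (planar_meas g h x₁ x₂ t).ennreal_ofReal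
    (ae_of_all _ fun p => ENNReal.ofReal_lt_top)]
  have hi := V1_int (h := h) hx ht (g := g)
  have hi2 : Integrable (fun p : ℝ × ℝ => V1 g h x₁ x₂ t p.swap) := hi.swap
  refine (hi.add hi2).congr (ae_of_all _ fun p => ?_)
  simp only [Pi.add_apply]
  rw [ENNReal.toReal_ofReal (planar_nonneg g h hx p), smul_eq_mul, planar_wt]

lemma piW_integral {g h x₁ x₂ t : ℝ} (hx : x₂ ≤ x₁) (ht : 0 < t) {G : ℝ × ℝ → ℂ}
    (hG : Continuous G) {C : ℝ} (hb : ∀ p, ‖G p‖ ≤ C) :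
    ∫ p, (wt (g + h) p : ℂ) * G p ∂(piW g h x₁ x₂ t) =
      ∫ p, (V1 g h x₁ x₂ t p : ℂ) * (G p + G p.swap) := by
  unfold piW
  rw [integral_withDensity_eq_integral_toReal_smul (planar_meas g h x₁ x₂ t).ennreal_ofReal
    (ae_of_all _ fun p => ENNReal.ofReal_lt_top)]
  have hi : Integrable (fun p : ℝ × ℝ => (V1 g h x₁ x₂ t p : ℂ)) := (V1_int hx ht).ofReal
  have i1 : Integrable (fun p : ℝ × ℝ => (V1 g h x₁ x₂ t p : ℂ) * G p) :=
    hi.mul_bdd (c := C) hG.aestronglyMeasurable (ae_of_all _ hb)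
  have i2 : Integrable (fun p : ℝ × ℝ => (V1 g h x₁ x₂ t p : ℂ) * G p.swap) :=
    hi.mul_bdd (c := C) (hG.comp continuous_swap).aestronglyMeasurable (ae_of_all _ fun p => hb _)
  have i3 : Integrable (fun p : ℝ × ℝ => (V1 g h x₁ x₂ t p.swap : ℂ) * G p) := by
    have := i2.swap
    exact this
  simp_rw [mul_add]
  rw [integral_add i1 i2]
  have sw : ∫ p : ℝ × ℝ, (V1 g h x₁ x₂ t p : ℂ) * G p.swap =
      ∫ p : ℝ × ℝ, (V1 g h x₁ x₂ t p.swap : ℂ) * G p := by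
    have := integral_prod_swap (μ := (volume : Measure ℝ)) (ν := volume)
      (fun p : ℝ × ℝ => (V1 g h x₁ x₂ t p : ℂ) * G p.swap)
    rw [← Measure.volume_eq_prod] at this
    rw [← this]; simp
  rw [sw, ← integral_add i1 i3]
  refine integral_congr_ae (ae_of_all _ fun p => ?_)
  simp only
  rw [ENNReal.toReal_ofReal (planar_nonneg g h hx p), Complex.real_smul, ← add_mul, ← mul_assoc,
    ← Complex.ofReal_add, ← planar_wt, Complex.ofReal_mul]

end pim

section pie
open Complex (I)

lemma fE_TT_swap (b β : ℝ) (p : ℝ × ℝ) : fE b β (TT p.swap) = fE b β (TT p) := by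
  simp only [fE, TT, Prod.fst_swap, Prod.snd_swap]
  rw [abs_sub_comm p.2 p.1, add_comm p.2 p.1]

lemma fO_TT_swap (b β : ℝ) (p : ℝ × ℝ) : fO b β (TT p.swap) = -fO b β (TT p) := by
  simp only [fO, TT, Prod.fst_swap, Prod.snd_swap]
  rw [abs_sub_comm p.2 p.1, add_comm p.2 p.1, show β * (p.2 - p.1) = -(β * (p.1 - p.2)) by ring,
    Real.sin_neg]
  push_cast; ring

lemma piW_O {g h x₁ x₂ t : ℝ} (hx : x₂ ≤ x₁) (ht : 0 < t) (b β : ℝ) :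
    ∫ p, (wt (g + h) p : ℂ) * fO b β (TT p) ∂(piW g h x₁ x₂ t) = 0 := by
  rw [piW_integral hx ht (G := fun p => fO b β (TT p)) ((fO_cont b β).comp TT_cont)
    (C := 1) (fun p => fO_bdd _ _ _)]
  simp [fO_TT_swap]

lemma inner_deriv (b β a r ξ : ℝ) :
    HasDerivAt (fun ξ : ℝ => Complex.exp (2 * (1 + I * b) * ξ) *
        (Real.sin (β * (r + 2 * ξ - 2 * a)) : ℝ))
      (2 * (Complex.exp (2 * (1 + I * b) * ξ) * (β * (Real.cos (β * (r + 2 * ξ - 2 * a)) : ℝ) +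
        (1 + I * b) * (Real.sin (β * (r + 2 * ξ - 2 * a)) : ℝ)))) ξ := by
  have h1 : HasDerivAt (fun ξ : ℝ => (ξ : ℂ)) 1 ξ := Complex.ofRealCLM.hasDerivAt
  have h2 : HasDerivAt (fun ξ : ℝ => Complex.exp (2 * (1 + I * b) * ξ))
      (Complex.exp (2 * (1 + I * b) * ξ) * (2 * (1 + I * b) * 1)) ξ := (h1.const_mul _).cexp
  have h3 : HasDerivAt (fun ξ : ℝ => Real.sin (β * (r + 2 * ξ - 2 * a)))
      (Real.cos (β * (r + 2 * ξ - 2 * a)) * (β * (2 * 1))) ξ :=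
    ((((hasDerivAt_id ξ).const_mul 2).const_add r).sub_const (2 * a)).const_mul β |>.sin
  refine (h2.mul h3.ofReal_comp).congr_deriv ?_
  push_cast; ring

lemma inner_E {g h x₁ x₂ t : ℝ} (ht : 0 < t) (b β r : ℝ) :
    ∫ ξ : ℝ, (V1 g h x₁ x₂ t (Sh (x₂ + g * t) (ξ, r)) : ℂ) *
        (2 * fE b β (TT (Sh (x₂ + g * t) (ξ, r)))) =
      (Ioi (0:ℝ)).indicator (fun r => (K0 g h x₁ x₂ t : ℂ) *
        Complex.exp (2 * (1 + I * b) * (x₂ + g * t : ℝ)) *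
        ((fw t (x₁ - x₂) r * Real.sin (β * r) : ℝ) : ℂ)) r := by
  set a := x₂ + g * t with ha
  set D : ℝ → ℂ := fun ξ => 2 * (Complex.exp (2 * (1 + I * b) * ξ) *
        (β * (Real.cos (β * (r + 2 * ξ - 2 * a)) : ℝ) +
        (1 + I * b) * (Real.sin (β * (r + 2 * ξ - 2 * a)) : ℝ))) with hD
  have e : ∀ ξ : ℝ, (V1 g h x₁ x₂ t (Sh a (ξ, r)) : ℂ) * (2 * fE b β (TT (Sh a (ξ, r)))) =
      (Ioo (a - r / 2) a).indicator (fun ξ => ((K0 g h x₁ x₂ t * fw t (x₁ - x₂) r : ℝ) : ℂ) *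
        D ξ) ξ := by
    intro ξ
    rw [ha, V1_Sh ht, ← ha]
    simp only
    by_cases hc : ξ < a ∧ a - r / 2 < ξ
    · rw [if_pos hc, indicator_of_mem (show ξ ∈ Ioo (a - r / 2) a from ⟨hc.2, hc.1⟩)]
      simp only [hD, fE, TT, Sh]
      have hd : r + (3 * ξ - 2 * a) - ξ = r + 2 * ξ - 2 * a := by ring
      have hp : 0 ≤ r + 2 * ξ - 2 * a := by linarith [hc.2]
      rw [hd, abs_of_nonneg hp]
      have he : ((Real.exp (2 * ξ) : ℝ) : ℂ) *
          Complex.exp (I * (b * (r + (3 * ξ - 2 * a) + ξ - (r + 2 * ξ - 2 * a)) : ℝ)) =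
          Complex.exp (2 * (1 + I * b) * ξ) := by
        rw [Complex.ofReal_exp, ← Complex.exp_add]; congr 1; push_cast; ring
      rw [← he]; push_cast; ring
    · rw [if_neg hc, indicator_of_notMem (fun hm : ξ ∈ Ioo (a - r / 2) a => hc ⟨hm.2, hm.1⟩)]
      simp
  simp_rw [e]
  rw [integral_indicator measurableSet_Ioo, integral_const_mul]
  by_cases hr : 0 < r
  · rw [indicator_of_mem (show r ∈ Ioi (0:ℝ) from hr), ← integral_Ioc_eq_integral_Ioo,
      ← intervalIntegral.integral_of_le (by linarith)]
    rw [intervalIntegral.integral_eq_sub_of_hasDerivAt (fun ξ _ => inner_deriv b β a r ξ)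
      (Continuous.intervalIntegrable (by fun_prop) _ _)]
    rw [show r + 2 * a - 2 * a = r by ring, show r + 2 * (a - r / 2) - 2 * a = 0 by ring]
    simp only [mul_zero, Real.sin_zero]
    push_cast; ring
  · rw [indicator_of_notMem (by simpa using hr), Ioo_eq_empty (by linarith)]
    simp

lemma piW_E {g h x₁ x₂ t : ℝ} (hx : x₂ ≤ x₁) (ht : 0 < t) (b β : ℝ) :
    ∫ p, (wt (g + h) p : ℂ) * fE b β (TT p) ∂(piW g h x₁ x₂ t) =
      (K0 g h x₁ x₂ t : ℂ) * Complex.exp (2 * (1 + I * b) * (x₂ + g * t : ℝ)) *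
        ((2 * β * ∫ r in Ioi (0:ℝ), ph t (r + (x₁ - x₂)) * Real.cos (β * r) : ℝ) : ℂ) := by
  rw [piW_integral hx ht (G := fun p => fE b β (TT p)) ((fE_cont b β).comp TT_cont)
    (fun p => fE_bdd _ _ _)]
  simp only [fE_TT_swap, ← two_mul]
  have hc : Continuous fun p => 2 * fE b β (TT p) := continuous_const.mul ((fE_cont b β).comp TT_cont)
  have hi : Integrable (fun q => (V1 g h x₁ x₂ t (Sh (x₂ + g * t) q) : ℂ) *
      (2 * fE b β (TT (Sh (x₂ + g * t) q)))) := by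
    have h1 : Integrable (fun q => (V1 g h x₁ x₂ t (Sh (x₂ + g * t) q) : ℂ)) :=
      (V1_Sh_int hx ht).ofReal
    refine h1.mul_bdd (c := 2 * (|β| + ‖(1 + I * b : ℂ)‖))
      (hc.measurable.comp (Sh_mp _).measurable).aestronglyMeasurable (ae_of_all _ fun q => ?_)
    rw [norm_mul, Complex.norm_ofNat]
    exact mul_le_mul_of_nonneg_left (fE_bdd _ _ _) (by norm_num)
  have hmap : ∫ p, (V1 g h x₁ x₂ t p : ℂ) * (2 * fE b β (TT p)) =
      ∫ q, (V1 g h x₁ x₂ t (Sh (x₂ + g * t) q) : ℂ) *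
      (2 * fE b β (TT (Sh (x₂ + g * t) q))) := by
    conv_lhs => rw [← (Sh_mp (x₂ + g * t)).map_eq]
    refine integral_map (Sh_mp _).measurable.aemeasurable ?_
    exact ((Complex.measurable_ofReal.comp (V1_meas _ _ _ _ _)).mul
      hc.measurable).aestronglyMeasurable
  rw [hmap, Measure.volume_eq_prod, integral_prod_symm _ hi]
  simp_rw [inner_E ht b β]
  rw [integral_indicator measurableSet_Ioi, integral_const_mul, integral_complex_ofReal,
    fw_sin ht]

end pie

section pir
open Complex (I)

lemma ray_cont (g h x₁ x₂ t : ℝ) : Continuous (rayDensity g h x₁ x₂ t) := by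
  unfold rayDensity; fun_prop

lemma ray_wt {g h x₁ x₂ t : ℝ} (ht : 0 < t) {ξ : ℝ} (hξ : x₂ + g * t ≤ ξ) :
    rayDensity g h x₁ x₂ t ξ * wt (g + h) (ξ, x₂ + g * t) =
      K0 g h x₁ x₂ t * Real.exp (2 * (x₂ + g * t)) *
        (ph t (ξ - (x₂ + g * t) - (x₁ - x₂)) - ph t (ξ - (x₂ + g * t) + (x₁ - x₂))) := by
  unfold rayDensity wt K0 ph
  simp only
  rw [abs_of_nonneg (by linarith)]
  have e1 : ∀ S A B C D : ℝ, 1 / S * (Real.exp A - Real.exp B * Real.exp C) * Real.exp D =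
      (Real.exp (A + D) - Real.exp (B + C + D)) / S := by
    intro S A B C D; simp only [Real.exp_add]; ring
  have e2 : ∀ S A B C D : ℝ, Real.exp A * Real.exp B * (Real.exp C / S - Real.exp D / S) =
      (Real.exp (A + B + C) - Real.exp (A + B + D)) / S := by
    intro S A B C D; simp only [Real.exp_add]; ring
  rw [e1, e2]
  congr 3 <;> · field_simp; ring

lemma ph_diff_nonneg {t : ℝ} (ht : 0 < t) {D y : ℝ} (hD : 0 ≤ D) (hy : 0 ≤ y) :
    0 ≤ ph t (D - y) - ph t (D + y) := by
  unfold ph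
  rw [sub_nonneg]
  apply div_le_div_of_nonneg_right _ (Real.sqrt_nonneg _)
  apply Real.exp_le_exp.2
  apply div_le_div_of_nonneg_right _ (by positivity)
  nlinarith [mul_nonneg hD hy]

lemma wt_pos (l : ℝ) (p : ℝ × ℝ) : 0 < wt l p := Real.exp_pos _

lemma ray_nonneg {g h x₁ x₂ t : ℝ} (hx : x₂ ≤ x₁) (ht : 0 < t) {ξ : ℝ} (hξ : x₂ + g * t ≤ ξ) :
    0 ≤ rayDensity g h x₁ x₂ t ξ := by
  have h1 : 0 ≤ rayDensity g h x₁ x₂ t ξ * wt (g + h) (ξ, x₂ + g * t) := by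
    rw [ray_wt ht hξ]
    exact mul_nonneg (mul_nonneg (Real.exp_pos _).le (Real.exp_pos _).le)
      (ph_diff_nonneg ht (by linarith) (by linarith))
  exact nonneg_of_mul_nonneg_left h1 (wt_pos _ _)

/-- The ray part of the claimed law. -/
def piR (g h x₁ x₂ t : ℝ) : Measure (ℝ × ℝ) :=
  ((volume.restrict (Ioi (x₂ + g * t))).withDensity
    (fun ξ => ENNReal.ofReal (rayDensity g h x₁ x₂ t ξ))).map (fun ξ => (ξ, x₂ + g * t))

lemma ph_int' {t : ℝ} (ht : 0 < t) (y : ℝ) : Integrable (fun x => ph t (x + y)) := by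
  simpa using ph_int ht (-y)

lemma piR_wt {g h x₁ x₂ t : ℝ} (hx : x₂ ≤ x₁) (ht : 0 < t) :
    Integrable (wt (g + h)) (piR g h x₁ x₂ t) := by
  unfold piR
  rw [integrable_map_measure (wt_cont _).aestronglyMeasurable (by fun_prop)]
  rw [integrable_withDensity_iff_integrable_smul' (ray_cont g h x₁ x₂ t).measurable.ennreal_ofReal
    (ae_of_all _ fun p => ENNReal.ofReal_lt_top)]
  have i1 : Integrable (fun ξ => K0 g h x₁ x₂ t * Real.exp (2 * (x₂ + g * t)) *
        (ph t (ξ - (x₂ + g * t) - (x₁ - x₂)) - ph t (ξ - (x₂ + g * t) + (x₁ - x₂)))) := by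
    have := ((ph_int ht (x₁ - x₂)).comp_sub_right (x₂ + g * t)).sub
      ((ph_int' ht (x₁ - x₂)).comp_sub_right (x₂ + g * t))
    exact this.const_mul _
  refine (i1.restrict (s := Ioi (x₂ + g * t))).congr ?_
  filter_upwards [ae_restrict_mem measurableSet_Ioi] with ξ hξ
  rw [← ray_wt ht (le_of_lt hξ), ENNReal.toReal_ofReal (ray_nonneg hx ht (le_of_lt hξ))]
  rfl

lemma piR_integral {g h x₁ x₂ t : ℝ} (hx : x₂ ≤ x₁) (ht : 0 < t) {G : ℝ × ℝ → ℂ}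
    (hG : Continuous G) :
    ∫ p, (wt (g + h) p : ℂ) * G p ∂(piR g h x₁ x₂ t) =
      (K0 g h x₁ x₂ t : ℂ) * Complex.exp (2 * (x₂ + g * t : ℝ)) *
      ∫ D in Ioi (0:ℝ), ((ph t (D - (x₁ - x₂)) - ph t (D + (x₁ - x₂)) : ℝ) : ℂ) *
        G (D + (x₂ + g * t), x₂ + g * t) := by
  unfold piR
  have hw := wt_cont (g + h)
  rw [integral_map (by fun_prop) (by
    apply Continuous.aestronglyMeasurable; fun_prop)]
  rw [integral_withDensity_eq_integral_toReal_smul (ray_cont g h x₁ x₂ t).measurable.ennreal_ofReal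
    (ae_of_all _ fun p => ENNReal.ofReal_lt_top)]
  have := (measurePreserving_add_right (volume : Measure ℝ) (x₂ + g * t)).setIntegral_preimage_emb
    (measurableEmbedding_addRight _) (fun ξ => (ENNReal.ofReal (rayDensity g h x₁ x₂ t ξ)).toReal •
      ((wt (g + h) (ξ, x₂ + g * t) : ℂ) * G (ξ, x₂ + g * t))) (Ioi (x₂ + g * t))
  rw [← this, preimage_add_const_Ioi, sub_self, ← integral_const_mul]
  refine setIntegral_congr_fun measurableSet_Ioi fun D hD => ?_
  have hD' : x₂ + g * t ≤ D + (x₂ + g * t) := by have : 0 < D := hD; linarith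
  rw [ENNReal.toReal_ofReal (ray_nonneg hx ht hD'), Complex.real_smul, ← mul_assoc, ← mul_assoc,
    ← Complex.ofReal_mul, ray_wt ht hD', add_sub_cancel_right]
  push_cast; ring

lemma piR_O {g h x₁ x₂ t : ℝ} (hx : x₂ ≤ x₁) (ht : 0 < t) (b β : ℝ) :
    ∫ p, (wt (g + h) p : ℂ) * fO b β (TT p) ∂(piR g h x₁ x₂ t) =
      (K0 g h x₁ x₂ t : ℂ) * Complex.exp (2 * (1 + I * b) * (x₂ + g * t : ℝ)) *
        ((Real.exp (-(t * β ^ 2 / 2)) * Real.sin (β * (x₁ - x₂)) : ℝ) : ℂ) := by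
  rw [piR_integral hx ht (G := fun p => fO b β (TT p)) ((fO_cont b β).comp TT_cont)]
  rw [← fold_sin ht, ← integral_complex_ofReal, ← integral_const_mul, ← integral_const_mul]
  refine setIntegral_congr_fun measurableSet_Ioi fun D hD => ?_
  have hD' : 0 ≤ D := le_of_lt hD
  simp only [fO, TT, add_sub_cancel_right]
  rw [abs_of_nonneg hD']
  have he : Complex.exp (2 * (x₂ + g * t : ℝ)) *
      Complex.exp (I * (b * (D + (x₂ + g * t) + (x₂ + g * t) - D) : ℝ)) =
      Complex.exp (2 * (1 + I * b) * (x₂ + g * t : ℝ)) := by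
    rw [← Complex.exp_add]; congr 1; push_cast; ring
  rw [← he]; push_cast; ring

lemma piR_E {g h x₁ x₂ t : ℝ} (hx : x₂ ≤ x₁) (ht : 0 < t) (b β : ℝ) :
    ∫ p, (wt (g + h) p : ℂ) * fE b β (TT p) ∂(piR g h x₁ x₂ t) =
      (K0 g h x₁ x₂ t : ℂ) * Complex.exp (2 * (1 + I * b) * (x₂ + g * t : ℝ)) *
        (β * ((∫ D in Ioi (0:ℝ), (ph t (D - (x₁ - x₂)) - ph t (D + (x₁ - x₂))) *
            Real.cos (β * D) : ℝ) : ℂ) +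
          (1 + I * b) * ((Real.exp (-(t * β ^ 2 / 2)) * Real.sin (β * (x₁ - x₂)) : ℝ) : ℂ)) := by
  rw [piR_integral hx ht (G := fun p => fE b β (TT p)) ((fE_cont b β).comp TT_cont)]
  have i0 : Integrable (fun D => ph t (D - (x₁ - x₂)) - ph t (D + (x₁ - x₂))) :=
    (ph_int ht _).sub (ph_int' ht _)
  have i1 : IntegrableOn (fun D => (((ph t (D - (x₁ - x₂)) - ph t (D + (x₁ - x₂))) *
      Real.cos (β * D) : ℝ) : ℂ)) (Ioi 0) := by
    refine Integrable.ofReal (Integrable.restrict ?_)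
    exact i0.mul_bdd (c := 1) (by fun_prop) (ae_of_all _ fun x => Real.abs_cos_le_one _)
  have i2 : IntegrableOn (fun D => (((ph t (D - (x₁ - x₂)) - ph t (D + (x₁ - x₂))) *
      Real.sin (β * D) : ℝ) : ℂ)) (Ioi 0) := by
    refine Integrable.ofReal (Integrable.restrict ?_)
    exact i0.mul_bdd (c := 1) (by fun_prop) (ae_of_all _ fun x => Real.abs_sin_le_one _)
  rw [← fold_sin ht, ← integral_complex_ofReal, ← integral_complex_ofReal,
    ← integral_const_mul, ← integral_const_mul, ← integral_const_mul, ← integral_add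
      (i1.const_mul _) (i2.const_mul _), ← integral_const_mul]
  refine setIntegral_congr_fun measurableSet_Ioi fun D hD => ?_
  have hD' : 0 ≤ D := le_of_lt hD
  simp only [fE, TT, add_sub_cancel_right]
  rw [abs_of_nonneg hD']
  have he : Complex.exp (2 * (x₂ + g * t : ℝ)) *
      Complex.exp (I * (b * (D + (x₂ + g * t) + (x₂ + g * t) - D) : ℝ)) =
      Complex.exp (2 * (1 + I * b) * (x₂ + g * t : ℝ)) := by
    rw [← Complex.exp_add]; congr 1; push_cast; ring
  rw [← he]; push_cast; ring

lemma cos_combine {t : ℝ} (ht : 0 < t) (y β : ℝ) :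
    (∫ D in Ioi (0:ℝ), (ph t (D - y) - ph t (D + y)) * Real.cos (β * D)) +
      2 * ∫ r in Ioi (0:ℝ), ph t (r + y) * Real.cos (β * r) =
    Real.exp (-(t * β ^ 2 / 2)) * Real.cos (β * y) := by
  have i0 : Integrable (fun D => ph t (D - y) - ph t (D + y)) :=
    (ph_int ht _).sub (ph_int' ht _)
  have i1 : IntegrableOn (fun D => (ph t (D - y) - ph t (D + y)) * Real.cos (β * D)) (Ioi 0) :=
    (i0.mul_bdd (c := 1) (by fun_prop) (ae_of_all _ fun x => Real.abs_cos_le_one _)).restrict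
  have i2 : IntegrableOn (fun D => ph t (D + y) * Real.cos (β * D)) (Ioi 0) :=
    ((ph_int' ht y).mul_bdd (c := 1) (by fun_prop)
      (ae_of_all _ fun x => Real.abs_cos_le_one _)).restrict
  rw [← fold_cos ht, ← integral_const_mul, ← integral_add i1 (i2.const_mul 2)]
  refine integral_congr_ae (ae_of_all _ fun x => ?_)
  simp only; ring

/-- The claimed law. -/
def piT (g h x₁ x₂ t : ℝ) : Measure (ℝ × ℝ) := piW g h x₁ x₂ t + piR g h x₁ x₂ t

lemma piT_wt {g h x₁ x₂ t : ℝ} (hx : x₂ ≤ x₁) (ht : 0 < t) :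
    Integrable (wt (g + h)) (piT g h x₁ x₂ t) := (piW_wt hx ht).add_measure (piR_wt hx ht)

lemma piT_O {g h x₁ x₂ t : ℝ} (hx : x₂ ≤ x₁) (ht : 0 < t) (b β : ℝ) :
    ∫ p, (wt (g + h) p : ℂ) * fO b β (TT p) ∂(piT g h x₁ x₂ t) =
      (K0 g h x₁ x₂ t : ℂ) * Complex.exp (2 * (1 + I * b) * (x₂ + g * t : ℝ)) *
        ((Real.exp (-(t * β ^ 2 / 2)) * Real.sin (β * (x₁ - x₂)) : ℝ) : ℂ) := by
  have hm : AEStronglyMeasurable (fun p => fO b β (TT p)) (piW g h x₁ x₂ t) :=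
    ((fO_cont b β).comp TT_cont).aestronglyMeasurable
  have hm' : AEStronglyMeasurable (fun p => fO b β (TT p)) (piR g h x₁ x₂ t) :=
    ((fO_cont b β).comp TT_cont).aestronglyMeasurable
  have j1 : Integrable (fun p => (wt (g + h) p : ℂ)) (piW g h x₁ x₂ t) := (piW_wt hx ht).ofReal
  have j2 : Integrable (fun p => (wt (g + h) p : ℂ)) (piR g h x₁ x₂ t) := (piR_wt hx ht).ofReal
  unfold piT
  rw [integral_add_measure (j1.mul_bdd (c := 1) hm (ae_of_all _ fun p => fO_bdd _ _ _))
    (j2.mul_bdd (c := 1) hm' (ae_of_all _ fun p => fO_bdd _ _ _)), piW_O hx ht, zero_add,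
    piR_O hx ht]

lemma piT_E {g h x₁ x₂ t : ℝ} (hx : x₂ ≤ x₁) (ht : 0 < t) (b β : ℝ) :
    ∫ p, (wt (g + h) p : ℂ) * fE b β (TT p) ∂(piT g h x₁ x₂ t) =
      (K0 g h x₁ x₂ t : ℂ) * Complex.exp (2 * (1 + I * b) * (x₂ + g * t : ℝ)) *
        ((Real.exp (-(t * β ^ 2 / 2)) : ℝ) * (β * (Real.cos (β * (x₁ - x₂)) : ℝ) +
          (1 + I * b) * (Real.sin (β * (x₁ - x₂)) : ℝ))) := by
  have hm : AEStronglyMeasurable (fun p => fE b β (TT p)) (piW g h x₁ x₂ t) :=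
    ((fE_cont b β).comp TT_cont).aestronglyMeasurable
  have hm' : AEStronglyMeasurable (fun p => fE b β (TT p)) (piR g h x₁ x₂ t) :=
    ((fE_cont b β).comp TT_cont).aestronglyMeasurable
  have j1 : Integrable (fun p => (wt (g + h) p : ℂ)) (piW g h x₁ x₂ t) := (piW_wt hx ht).ofReal
  have j2 : Integrable (fun p => (wt (g + h) p : ℂ)) (piR g h x₁ x₂ t) := (piR_wt hx ht).ofReal
  unfold piT
  rw [integral_add_measure (j1.mul_bdd hm (ae_of_all _ fun p => fE_bdd _ _ _))
    (j2.mul_bdd hm' (ae_of_all _ fun p => fE_bdd _ _ _)), piW_E hx ht, piR_E hx ht]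
  have hc := cos_combine ht (x₁ - x₂) β
  set J1 := ∫ D in Ioi (0:ℝ), (ph t (D - (x₁ - x₂)) - ph t (D + (x₁ - x₂))) * Real.cos (β * D)
  set J2 := ∫ r in Ioi (0:ℝ), ph t (r + (x₁ - x₂)) * Real.cos (β * r)
  have hc' : (J1 : ℂ) + 2 * J2 = (Real.exp (-(t * β ^ 2 / 2)) : ℝ) *
      (Real.cos (β * (x₁ - x₂)) : ℝ) := by exact_mod_cast hc
  rw [mul_add ((Real.exp (-(t * β ^ 2 / 2)) : ℝ) : ℂ), mul_left_comm _ (β : ℂ), ← hc']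
  push_cast; ring

end pir

section fin
open Complex (I)

def TTi (q : ℝ × ℝ) : ℝ × ℝ := ((q.2 + |q.1| + q.1) / 2, (q.2 + |q.1| - q.1) / 2)

lemma TTi_TT (p : ℝ × ℝ) : TTi (TT p) = p := by
  unfold TTi TT
  ext <;> simp only <;> ring

lemma TTi_cont : Continuous TTi := by unfold TTi; fun_prop

def wM (l : ℝ) (P : Measure (ℝ × ℝ)) : Measure (ℝ × ℝ) :=
  P.withDensity fun p => ENNReal.ofReal (wt l p)

lemma wM_integral (l : ℝ) (P : Measure (ℝ × ℝ)) {G : ℝ × ℝ → ℂ} (hG : Continuous G) :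
    ∫ q, G q ∂((wM l P).map TT) = ∫ p, (wt l p : ℂ) * G (TT p) ∂P := by
  rw [integral_map TT_cont.measurable.aemeasurable hG.aestronglyMeasurable]
  unfold wM
  rw [integral_withDensity_eq_integral_toReal_smul (wt_cont l).measurable.ennreal_ofReal
    (ae_of_all _ fun p => ENNReal.ofReal_lt_top)]
  refine integral_congr_ae (ae_of_all _ fun p => ?_)
  simp only
  rw [ENNReal.toReal_ofReal (wt_pos l p).le, Complex.real_smul]

lemma uniq2 {P Q : Measure (ℝ × ℝ)} (l : ℝ) (hP : Integrable (wt l) P) (hQ : Integrable (wt l) Q)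
    (hE : ∀ b β : ℝ, ∫ p, (wt l p : ℂ) * fE b β (TT p) ∂P = ∫ p, (wt l p : ℂ) * fE b β (TT p) ∂Q)
    (hO : ∀ b β : ℝ, ∫ p, (wt l p : ℂ) * fO b β (TT p) ∂P = ∫ p, (wt l p : ℂ) * fO b β (TT p) ∂Q) :
    P = Q := by
  have f1 : IsFiniteMeasure (wM l P) := isFiniteMeasure_withDensity_ofReal hP.2
  have f2 : IsFiniteMeasure (wM l Q) := isFiniteMeasure_withDensity_ofReal hQ.2
  have h : (wM l P).map TT = (wM l Q).map TT := by
    apply uniq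
    · intro b β; rw [wM_integral l P (fE_cont b β), wM_integral l Q (fE_cont b β), hE]
    · intro b β; rw [wM_integral l P (fO_cont b β), wM_integral l Q (fO_cont b β), hO]
  have h' := congrArg (Measure.map TTi) h
  have hid : TTi ∘ TT = id := funext TTi_TT
  rw [Measure.map_map TTi_cont.measurable TT_cont.measurable,
    Measure.map_map TTi_cont.measurable TT_cont.measurable, hid, Measure.map_id,
    Measure.map_id] at h'
  have h2 := congrArg (fun M : Measure (ℝ × ℝ) => M.withDensity
    (fun p => (ENNReal.ofReal (wt l p))⁻¹)) h'
  simp only [wM] at h2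
  rw [withDensity_inv_same (wt_cont l).measurable.ennreal_ofReal
      (ae_of_all _ fun p => by simpa using wt_pos l p) (ae_of_all _ fun p => ENNReal.ofReal_ne_top),
    withDensity_inv_same (wt_cont l).measurable.ennreal_ofReal
      (ae_of_all _ fun p => by simpa using wt_pos l p)
      (ae_of_all _ fun p => ENNReal.ofReal_ne_top)] at h2
  exact h2

end fin

section fin2
open Complex (I)

lemma pf_form (P Q k : ℂ) (β x : ℝ) :
    pf ((P - I * Q) / 2) ((P + I * Q) / 2) (-k + I * β) (-k - I * β) x =
      Complex.exp (-k * x) * (P * (Real.cos (β * x) : ℝ) + Q * (Real.sin (β * x) : ℝ)) := by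
  have h1 : Complex.exp ((-k + I * β) * x) = Complex.exp (-k * x) *
      ((Real.cos (β * x) : ℝ) + (Real.sin (β * x) : ℝ) * I) := by
    rw [Complex.ofReal_cos, Complex.ofReal_sin, ← Complex.exp_mul_I, ← Complex.exp_add]
    congr 1; push_cast; ring
  have h2 : Complex.exp ((-k - I * β) * x) = Complex.exp (-k * x) *
      ((Real.cos (β * x) : ℝ) - (Real.sin (β * x) : ℝ) * I) := by
    have := Complex.exp_mul_I (-((β * x : ℝ) : ℂ))
    rw [Complex.cos_neg, Complex.sin_neg, ← Complex.ofReal_cos, ← Complex.ofReal_sin, neg_mul, neg_mul,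
      ← sub_eq_add_neg] at this
    rw [← this, ← Complex.exp_add]
    congr 1; push_cast; ring
  unfold pf
  rw [h1, h2]
  linear_combination (-Q * Complex.exp (-k * x) * (Real.sin (β * x) : ℝ)) * Complex.I_sq

lemma TF_E (b β : ℝ) : TF ((β - I * (1 + I * b)) / 2) ((β + I * (1 + I * b)) / 2)
    (-(1 + I * b) + I * β) (-(1 + I * b) - I * β) 1 where
  ht := Or.inl rfl
  h0 := by simp
  h1 := by linear_combination (-2 * β * (1 + I * b)) * Complex.I_sq
  r1 := by simp
  r2 := by simp

lemma TF_O (b β : ℝ) : TF ((0 - I * 1) / 2) ((0 + I * 1) / 2)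
    (-(1 + I * b) + I * β) (-(1 + I * b) - I * β) (-1) where
  ht := Or.inr rfl
  h0 := by ring
  h1 := by simp
  r1 := by simp
  r2 := by simp

lemma PF_E (b β x : ℝ) : PF ((β - I * (1 + I * b)) / 2) ((β + I * (1 + I * b)) / 2)
    (-(1 + I * b) + I * β) (-(1 + I * b) - I * β) 1 x =
    Complex.exp (-(1 + I * b) * (|x| : ℝ)) * (β * (Real.cos (β * |x|) : ℝ) +
      (1 + I * b) * (Real.sin (β * |x|) : ℝ)) := by
  rcases le_total 0 x with hx | hx
  · rw [(TF_E b β).PF_nonneg hx, pf_form, abs_of_nonneg hx]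
  · rw [(TF_E b β).PF_nonpos hx, pf_form, abs_of_nonpos hx, one_mul]

lemma PF_O (b β x : ℝ) : PF ((0 - I * 1) / 2) ((0 + I * 1) / 2)
    (-(1 + I * b) + I * β) (-(1 + I * b) - I * β) (-1) x =
    Complex.exp (-(1 + I * b) * (|x| : ℝ)) * (Real.sin (β * x) : ℝ) := by
  rcases le_total 0 x with hx | hx
  · rw [(TF_O b β).PF_nonneg hx, pf_form, abs_of_nonneg hx]; ring
  · rw [(TF_O b β).PF_nonpos hx, pf_form, abs_of_nonpos hx, mul_neg, Real.sin_neg]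
    push_cast; ring

lemma wt_fE (l b β : ℝ) (p : ℝ × ℝ) : (wt l p : ℂ) * fE b β (TT p) =
    Complex.exp ((l + (1 + I * b)) * (p.1 + p.2 : ℝ)) *
    PF ((β - I * (1 + I * b)) / 2) ((β + I * (1 + I * b)) / 2)
    (-(1 + I * b) + I * β) (-(1 + I * b) - I * β) 1 (p.1 - p.2) := by
  rw [PF_E]
  simp only [wt, fE, TT]
  rw [Complex.ofReal_exp, ← mul_assoc, ← mul_assoc, ← Complex.exp_add, ← Complex.exp_add]
  congr 2; push_cast; ring

lemma wt_fO (l b β : ℝ) (p : ℝ × ℝ) : (wt l p : ℂ) * fO b β (TT p) =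
    Complex.exp ((l + (1 + I * b)) * (p.1 + p.2 : ℝ)) *
    PF ((0 - I * 1) / 2) ((0 + I * 1) / 2)
    (-(1 + I * b) + I * β) (-(1 + I * b) - I * β) (-1) (p.1 - p.2) := by
  rw [PF_O]
  simp only [wt, fO, TT]
  rw [Complex.ofReal_exp, ← mul_assoc, ← mul_assoc, ← Complex.exp_add, ← Complex.exp_add]
  congr 2; push_cast; ring

lemma drift_ii {f₁ f₂ : ℝ → ℝ} (h1 : Continuous f₁) (h2 : Continuous f₂) (u v a b : ℝ) :
    IntervalIntegrable (fun s => if f₁ s ≤ f₂ s then u else v) volume a b := by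
  have hm : Measurable (fun s => if f₁ s ≤ f₂ s then u else v) :=
    Measurable.ite (measurableSet_le h1.measurable h2.measurable) measurable_const measurable_const
  refine (intervalIntegrable_const (c := |u| + |v|)).mono_fun hm.aestronglyMeasurable ?_
  refine ae_of_all _ fun s => ?_
  dsimp only
  rw [Real.norm_of_nonneg (by positivity : 0 ≤ |u| + |v|)]
  split_ifs <;> simp

/-- The martingale-type identity, transported to the law of the solution. -/
lemma sol_transform {g h : ℝ} (hgh : 0 < g + h)
    {x₁ x₂ t : ℝ} (ht : 0 < t) [IsProbabilityMeasure μ] {X₁ X₂ : ℝ → Ω → ℝ}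
    (hBM : IsPlanarBM μ F B₁ B₂) (hsol : Solves11 μ F g h 1 0 x₁ x₂ B₁ B₂ X₁ X₂)
    {A₁ A₂ α₁ α₂ τ : ℂ} (hP : TF A₁ A₂ α₁ α₂ τ) (c s : ℂ)
    (e1 : s - α₁ * (g + h : ℝ) + (c + α₁) ^ 2 / 2 = 0)
    (e2 : s - α₂ * (g + h : ℝ) + (c + α₂) ^ 2 / 2 = 0) :
    Integrable (fun ω => Complex.exp (c * (X₁ t ω + X₂ t ω : ℝ)) *
      PF A₁ A₂ α₁ α₂ τ (X₁ t ω - X₂ t ω)) μ ∧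
    ∫ ω, Complex.exp (c * (X₁ t ω + X₂ t ω : ℝ)) * PF A₁ A₂ α₁ α₂ τ (X₁ t ω - X₂ t ω) ∂μ =
      Complex.exp (c * (x₁ + x₂ + (g - h) * t : ℝ) - s * t) * PF A₁ A₂ α₁ α₂ τ (x₁ - x₂) := by
  obtain ⟨had, hcont, I₁, I₂, s1, s2, heq⟩ := hsol
  have hctx : Ctx μ F B₁ B₂ (fun t ω => X₁ t ω - X₂ t ω) I₁ I₂ (g + h) (x₁ - x₂) := by
    refine ⟨hBM.1, hBM.2.1, ?_, ?_, ?_, ?_, ?_, hgh.le⟩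
    · intro u hu
      have : Measurable[F u] (fun ω => (X₁ u ω, X₂ u ω)) := measurable_iff_comap_le.2 (had u hu)
      exact (measurable_fst.sub measurable_snd).comp this
    · filter_upwards [hcont] with ω hω using hω.1.sub hω.2
    · simpa only [sub_nonpos] using s1
    · simpa only [sub_nonpos] using s2
    · filter_upwards [heq, hcont] with ω hω hc u hu
      rw [(hω u hu).1, (hω u hu).2]
      have : (∫ s in (0:ℝ)..u, (if X₁ s ω - X₂ s ω ≤ 0 then (g + h) else -(g + h))) =
          (∫ s in (0:ℝ)..u, (if X₁ s ω ≤ X₂ s ω then g else -h)) -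
          (∫ s in (0:ℝ)..u, (if X₁ s ω ≤ X₂ s ω then -h else g)) := by
        rw [← intervalIntegral.integral_sub (drift_ii hc.1 hc.2 _ _ _ _)
          (drift_ii hc.1 hc.2 _ _ _ _)]
        refine intervalIntegral.integral_congr fun s _ => ?_
        simp only [sub_nonpos]
        split_ifs <;> ring
      rw [this]; ring
  obtain ⟨hi, hI⟩ := hctx.transform hP c s ht e1 e2
  have hZ : ∀ᵐ ω ∂μ, X₁ t ω + X₂ t ω = x₁ + x₂ + (g - h) * t + (I₁ t ω + I₂ t ω) := by
    filter_upwards [heq, hcont] with ω hω hc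
    have : (∫ s in (0:ℝ)..t, (if X₁ s ω ≤ X₂ s ω then g else -h)) +
          (∫ s in (0:ℝ)..t, (if X₁ s ω ≤ X₂ s ω then -h else g)) = (g - h) * t := by
      rw [← intervalIntegral.integral_add (drift_ii hc.1 hc.2 _ _ _ _)
          (drift_ii hc.1 hc.2 _ _ _ _)]
      have : ∀ s ∈ uIcc 0 t, (if X₁ s ω ≤ X₂ s ω then g else -h) +
          (if X₁ s ω ≤ X₂ s ω then -h else g) = g - h := by
        intro s _; split_ifs <;> ring
      rw [intervalIntegral.integral_congr this, intervalIntegral.integral_const]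
      simp; ring
    obtain ⟨q1, q2⟩ := hω t ht.le
    linarith
  have key : ∀ᵐ ω ∂μ, Complex.exp (c * (x₁ + x₂ + (g - h) * t : ℝ) - s * t) *
      (Complex.exp (s * t + c * (I₁ t ω + I₂ t ω : ℝ)) * PF A₁ A₂ α₁ α₂ τ (X₁ t ω - X₂ t ω)) =
      Complex.exp (c * (X₁ t ω + X₂ t ω : ℝ)) * PF A₁ A₂ α₁ α₂ τ (X₁ t ω - X₂ t ω) := by
    filter_upwards [hZ] with ω hω
    rw [hω, ← mul_assoc, ← Complex.exp_add]
    congr 2; push_cast; ring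
  refine ⟨(hi.const_mul _).congr key, ?_⟩
  rw [← integral_congr_ae key, integral_const_mul, hI]

end fin2

section fin3
open Complex (I)

lemma law_eq {g h : ℝ} (hgh : 0 < g + h)
    {x₁ x₂ t : ℝ} (hx : x₂ ≤ x₁) (ht : 0 < t) [IsProbabilityMeasure μ] {X₁ X₂ : ℝ → Ω → ℝ}
    (hBM : IsPlanarBM μ F B₁ B₂) (hsol : Solves11 μ F g h 1 0 x₁ x₂ B₁ B₂ X₁ X₂) :
    μ.map (fun ω => (X₁ t ω, X₂ t ω)) = piT g h x₁ x₂ t := by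
  have hX : Measurable (fun ω => (X₁ t ω, X₂ t ω)) :=
    measurable_iff_comap_le.2 ((hsol.1 t ht.le).trans (hBM.1.le t))
  have hy : |x₁ - x₂| = x₁ - x₂ := abs_of_nonneg (by linarith)
  refine uniq2 (g + h) ?_ (piT_wt hx ht) ?_ ?_
  · rw [integrable_map_measure (wt_cont _).aestronglyMeasurable hX.aemeasurable]
    have hTF : TF 1 0 0 0 1 := ⟨Or.inl rfl, by simp, by simp, by simp, by simp⟩
    have := (sol_transform hgh ht hBM hsol hTF ((g + h + 1 : ℝ) : ℂ)
      (-((g + h + 1 : ℝ) : ℂ) ^ 2 / 2) (by ring) (by ring)).1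
    refine this.norm.mono' ((wt_cont _).measurable.comp hX).aestronglyMeasurable
      (ae_of_all _ fun ω => ?_)
    have hp : PF 1 0 0 0 1 (X₁ t ω - X₂ t ω) = 1 := by simp [PF, pf]
    rw [hp, mul_one, ← Complex.ofReal_mul, ← Complex.ofReal_exp, Complex.norm_real,
      Real.norm_of_nonneg (Real.exp_pos _).le]
    simp only [Function.comp]
    rw [Real.norm_of_nonneg (wt_pos _ _).le, wt]
    apply Real.exp_le_exp.2
    simp only
    nlinarith [abs_nonneg (X₁ t ω - X₂ t ω)]
  · intro b β
    have hc : Continuous fun p => (wt (g + h) p : ℂ) * fE b β (TT p) :=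
      (Complex.continuous_ofReal.comp (wt_cont _)).mul ((fE_cont b β).comp TT_cont)
    rw [integral_map hX.aemeasurable hc.aestronglyMeasurable, piT_E hx ht]
    simp_rw [wt_fE]
    rw [(sol_transform hgh ht hBM hsol (TF_E b β) (((g + h : ℝ) : ℂ) + (1 + I * b))
      (-(1 + I * b) * (g + h : ℝ) - ((g + h : ℝ) ^ 2 - β ^ 2) / 2)
      (by push_cast; linear_combination (β ^ 2 / 2 : ℂ) * Complex.I_sq)
      (by push_cast; linear_combination (β ^ 2 / 2 : ℂ) * Complex.I_sq)).2, PF_E, hy, K0,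
      Complex.ofReal_exp, Complex.ofReal_exp, ← mul_assoc, ← mul_assoc, ← Complex.exp_add,
      ← Complex.exp_add, ← Complex.exp_add]
    congr 2; push_cast; ring
  · intro b β
    have hc : Continuous fun p => (wt (g + h) p : ℂ) * fO b β (TT p) :=
      (Complex.continuous_ofReal.comp (wt_cont _)).mul ((fO_cont b β).comp TT_cont)
    rw [integral_map hX.aemeasurable hc.aestronglyMeasurable, piT_O hx ht]
    simp_rw [wt_fO]
    rw [(sol_transform hgh ht hBM hsol (TF_O b β) (((g + h : ℝ) : ℂ) + (1 + I * b))
      (-(1 + I * b) * (g + h : ℝ) - ((g + h : ℝ) ^ 2 - β ^ 2) / 2)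
      (by push_cast; linear_combination (β ^ 2 / 2 : ℂ) * Complex.I_sq)
      (by push_cast; linear_combination (β ^ 2 / 2 : ℂ) * Complex.I_sq)).2, PF_O, hy, K0,
      Complex.ofReal_mul, Complex.ofReal_exp, Complex.ofReal_exp, ← mul_assoc, ← mul_assoc,
      ← Complex.exp_add, ← Complex.exp_add, ← Complex.exp_add]
    congr 2; push_cast; ring

lemma piT_apply (g h x₁ x₂ t : ℝ) {A : Set (ℝ × ℝ)} (hA : MeasurableSet A) :
    piT g h x₁ x₂ t A =
        (∫⁻ p in A, ENNReal.ofReal (planarDensity g h x₁ x₂ t p.1 p.2)) +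
        (∫⁻ ξ in {ξ : ℝ | x₂ + g * t < ξ ∧ (ξ, x₂ + g * t) ∈ A},
          ENNReal.ofReal (rayDensity g h x₁ x₂ t ξ)) := by
  have hm : Measurable (fun ξ : ℝ => (ξ, x₂ + g * t)) := by fun_prop
  unfold piT piW piR
  rw [Measure.add_apply, withDensity_apply _ hA, Measure.map_apply hm hA,
    withDensity_apply _ (hm hA), Measure.restrict_restrict (hm hA)]
  congr 3
  ext ξ
  simp [and_comm]

end fin3

end Helpers

/-- (5.8)-(5.10) of the paper. In the degenerate case `ρ = 1,
σ = 0` with `x₁ ≥ x₂`, the joint distribution of `(X₁(t), X₂(t))` is the sum of an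
absolutely continuous part with the explicit density `planarDensity` (supported on the
two wedges `{ξ₁ > ξ₂, ξ₂ < x₂+gt}` and `{ξ₁ < ξ₂, ξ₁ < x₂+gt}`, the latter with the
arguments interchanged) and a singular part on the ray `{ξ₁ > ξ₂ = x₂ + gt}` with the
one-dimensional density `rayDensity`. -/
theorem degenerate_joint_distribution
    (g h : ℝ) (hg : 0 ≤ g) (hh : 0 ≤ h) (hgh : 0 < g + h)
    (x₁ x₂ : ℝ) (hx : x₂ ≤ x₁) (t : ℝ) (ht : 0 < t)
    {Ω : Type*} [mΩ : MeasurableSpace Ω] (μ : Measure Ω) [IsProbabilityMeasure μ]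
    (F : ℝ → MeasurableSpace Ω) (B₁ B₂ X₁ X₂ : ℝ → Ω → ℝ)
    (hBM : IsPlanarBM μ F B₁ B₂)
    (hsol : Solves11 μ F g h 1 0 x₁ x₂ B₁ B₂ X₁ X₂) :
    ∀ A : Set (ℝ × ℝ), MeasurableSet A →
      Measure.map (fun ω => (X₁ t ω, X₂ t ω)) μ A =
        (∫⁻ p in A, ENNReal.ofReal (planarDensity g h x₁ x₂ t p.1 p.2)) +
        (∫⁻ ξ in {ξ : ℝ | x₂ + g * t < ξ ∧ (ξ, x₂ + g * t) ∈ A},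
          ENNReal.ofReal (rayDensity g h x₁ x₂ t ξ)) := by
  intro A hA
  rw [law_eq hgh hx ht hBM hsol, piT_apply g h x₁ x₂ t hA]

end SDEPaper
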